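/- Let G be a connected affine algebraic group over ℂ and A_s a torus with trivial G-action. Then the pushout map Φ : Hom(Π_G, A_s) → Ext_alg(G, A_s), γ ↦ γ_*G̃, factors through an isomorphism of abelian groups Φ' : Hom(π₁(G'_red), A_s) ≅ Ext_alg(G, A_s), where π₁(G'_red) ⊆ Π_G is the fundamental group of the semisimple part G'_red of a Levi subgroup of G. -/

import Mathlib

noncomputable section

open MvPolynomial

/-- Points of affine `n`-space over `ℂ`. -/
abbrev Pt (n : ℕ) : Type := Fin n → ℂ

/-- A subset of `ℂ^n` is an (affine) algebraic set if it is the common zero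
locus of a set of polynomials. -/
def IsAlgebraicSet {n : ℕ} (V : Set (Pt n)) : Prop :=
  ∃ S : Set (MvPolynomial (Fin n) ℂ), V = {x : Pt n | ∀ p ∈ S, eval x p = 0}

/-- A map `ℂ^n → ℂ^m` is regular (polynomial) on a subset `V ⊆ ℂ^n`. -/
def IsRegularOn {n m : ℕ} (V : Set (Pt n)) (f : Pt n → Pt m) : Prop :=
  ∃ P : Fin m → MvPolynomial (Fin n) ℂ, ∀ x ∈ V, ∀ i, f x i = eval x (P i)

def Pt.left {n m : ℕ} (z : Pt (n + m)) : Pt n := fun i => z (Fin.castAdd m i)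
def Pt.right {n m : ℕ} (z : Pt (n + m)) : Pt m := fun i => z (Fin.natAdd n i)

/-- An affine algebraic group over `ℂ`, realized as an algebraic subset of some
`ℂ^n`, with polynomial multiplication and inversion. -/
structure AffAlgGroup : Type where
  n : ℕ
  carrier : Set (Pt n)
  isAlgebraic : IsAlgebraicSet carrier
  one : Pt n
  one_mem : one ∈ carrier
  mul : Pt n → Pt n → Pt n
  inv : Pt n → Pt n
  mul_mem : ∀ {x y : Pt n}, x ∈ carrier → y ∈ carrier → mul x y ∈ carrier
  inv_mem : ∀ {x : Pt n}, x ∈ carrier → inv x ∈ carrier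
  mul_assoc' : ∀ {x y z : Pt n}, x ∈ carrier → y ∈ carrier → z ∈ carrier →
    mul (mul x y) z = mul x (mul y z)
  one_mul' : ∀ {x : Pt n}, x ∈ carrier → mul one x = x
  mul_one' : ∀ {x : Pt n}, x ∈ carrier → mul x one = x
  inv_mul' : ∀ {x : Pt n}, x ∈ carrier → mul (inv x) x = one
  mul_regular : IsRegularOn
    {z : Pt (n + n) | Pt.left z ∈ carrier ∧ Pt.right z ∈ carrier}
    (fun z => mul (Pt.left z) (Pt.right z))
  inv_regular : IsRegularOn carrier inv

namespace AffAlgGroup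

/-- The group of `ℂ`-points of `G`, as a bundled group. -/
def Gp (G : AffAlgGroup) : Type := {x : Pt G.n // x ∈ G.carrier}

instance (G : AffAlgGroup) : Group G.Gp where
  mul x y := ⟨G.mul x.1 y.1, G.mul_mem x.2 y.2⟩
  one := ⟨G.one, G.one_mem⟩
  inv x := ⟨G.inv x.1, G.inv_mem x.2⟩
  mul_assoc a b c := Subtype.ext (G.mul_assoc' a.2 b.2 c.2)
  one_mul a := Subtype.ext (G.one_mul' a.2)
  mul_one a := Subtype.ext (G.mul_one' a.2)
  inv_mul_cancel a := Subtype.ext (G.inv_mul' a.2)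

/-- The Euclidean (classical) topology on the points of `G`. -/
instance (G : AffAlgGroup) : TopologicalSpace G.Gp :=
  instTopologicalSpaceSubtype

/-- Connectedness of an affine algebraic group: the carrier cannot be divided
into two disjoint relatively (Zariski-)closed pieces. -/
def IsConnected (G : AffAlgGroup) : Prop :=
  ∀ V W : Set (Pt G.n), IsAlgebraicSet V → IsAlgebraicSet W →
    G.carrier ⊆ V ∪ W → G.carrier ∩ (V ∩ W) = ∅ →
    G.carrier ⊆ V ∨ G.carrier ⊆ W

def IsAbelianGrp (G : AffAlgGroup) : Prop :=
  ∀ x ∈ G.carrier, ∀ y ∈ G.carrier, G.mul x y = G.mul y x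

/-- `G` is a torus: it is isomorphic, as an algebraic group, to `(ℂ*)^k`;
the isomorphism and its inverse are required to be given by (Laurent)
polynomials. -/
def IsTorus (G : AffAlgGroup) : Prop :=
  ∃ (k : ℕ) (φ : (Fin k → ℂˣ) → Pt G.n),
    (∀ u, φ u ∈ G.carrier) ∧
    Function.Injective φ ∧
    (∀ x ∈ G.carrier, ∃ u, φ u = x) ∧
    φ (fun _ => 1) = G.one ∧
    (∀ u v, φ (u * v) = G.mul (φ u) (φ v)) ∧
    (∀ i : Fin G.n, ∃ P : MvPolynomial (Fin k ⊕ Fin k) ℂ,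
      ∀ u, φ u i = eval (Sum.elim (fun j => (u j : ℂ)) (fun j => ((u j)⁻¹ : ℂˣ))) P) ∧
    (∀ j : Fin k, ∃ Q : MvPolynomial (Fin G.n) ℂ, ∀ u, (u j : ℂ) = eval (φ u) Q)

end AffAlgGroup

/-- matrix entry access for a point of `ℂ^{m·m}` viewed as an `m × m` matrix -/
def matEntry {m : ℕ} (x : Pt (m * m)) (i j : Fin m) : ℂ := x (finProdFinEquiv (i, j))

/-- matrix multiplication on points of `ℂ^{m·m}` -/
def matMulPt (m : ℕ) (x y : Pt (m * m)) : Pt (m * m) :=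
  fun idx => ∑ k : Fin m,
    matEntry x (finProdFinEquiv.symm idx).1 k * matEntry y k (finProdFinEquiv.symm idx).2

/-- the identity matrix as a point of `ℂ^{m·m}` -/
def idMatPt (m : ℕ) : Pt (m * m) :=
  fun idx => if (finProdFinEquiv.symm idx).1 = (finProdFinEquiv.symm idx).2 then 1 else 0

/-- an upper triangular matrix with `1`'s on the diagonal -/
def IsUnitriangular (m : ℕ) (x : Pt (m * m)) : Prop :=
  (∀ i : Fin m, matEntry x i i = 1) ∧ (∀ i j : Fin m, j < i → matEntry x i j = 0)

/-- `G` is unipotent: it admits a faithful polynomial representation by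
upper triangular unipotent matrices. -/
def AffAlgGroup.IsUnipotent (G : AffAlgGroup) : Prop :=
  ∃ (m : ℕ) (φ : Pt G.n → Pt (m * m)),
    IsRegularOn G.carrier φ ∧
    Set.InjOn φ G.carrier ∧
    (∀ x ∈ G.carrier, IsUnitriangular m (φ x)) ∧
    (∀ x ∈ G.carrier, ∀ y ∈ G.carrier, φ (G.mul x y) = matMulPt m (φ x) (φ y))

/-- A homomorphism of affine algebraic groups: a polynomial map which is
multiplicative on points. -/
structure AlgGroupHom (G H : AffAlgGroup) : Type where
  toFun : Pt G.n → Pt H.n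
  maps_to : ∀ {x : Pt G.n}, x ∈ G.carrier → toFun x ∈ H.carrier
  map_mul : ∀ {x y : Pt G.n}, x ∈ G.carrier → y ∈ G.carrier →
    toFun (G.mul x y) = H.mul (toFun x) (toFun y)
  regular : IsRegularOn G.carrier toFun

/-- An algebraic action of `G` on `A` by group automorphisms. -/
structure AlgAction (G A : AffAlgGroup) : Type where
  act : Pt G.n → Pt A.n → Pt A.n
  maps_to : ∀ {g : Pt G.n} {a : Pt A.n}, g ∈ G.carrier → a ∈ A.carrier →
    act g a ∈ A.carrier
  act_one : ∀ {a : Pt A.n}, a ∈ A.carrier → act G.one a = a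
  act_mul : ∀ {g h : Pt G.n} {a : Pt A.n}, g ∈ G.carrier → h ∈ G.carrier →
    a ∈ A.carrier → act (G.mul g h) a = act g (act h a)
  act_map_mul : ∀ {g : Pt G.n} {a b : Pt A.n}, g ∈ G.carrier → a ∈ A.carrier →
    b ∈ A.carrier → act g (A.mul a b) = A.mul (act g a) (act g b)
  act_bij : ∀ {g : Pt G.n}, g ∈ G.carrier → ∀ a ∈ A.carrier, ∃ b ∈ A.carrier, act g b = a
  regular : IsRegularOn
    {z : Pt (G.n + A.n) | Pt.left z ∈ G.carrier ∧ Pt.right z ∈ A.carrier}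
    (fun z => act (Pt.left z) (Pt.right z))

/-- the trivial action of `G` on `A` -/
def AlgAction.IsTrivial {G A : AffAlgGroup} (ρ : AlgAction G A) : Prop :=
  ∀ g ∈ G.carrier, ∀ a ∈ A.carrier, ρ.act g a = a

/-- An extension `1 → A → E → G → 1` of affine algebraic groups inducing
(via conjugation in `E`) the action `ρ` of `G` on `A`. -/
structure AlgExtension (G A : AffAlgGroup) (ρ : AlgAction G A) : Type where
  E : AffAlgGroup
  i : AlgGroupHom A E
  q : AlgGroupHom E G
  i_inj : Set.InjOn i.toFun A.carrier
  q_surj : ∀ g ∈ G.carrier, ∃ x ∈ E.carrier, q.toFun x = g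
  exact : ∀ x ∈ E.carrier, (q.toFun x = G.one ↔ ∃ a ∈ A.carrier, i.toFun a = x)
  conj_compat : ∀ x ∈ E.carrier, ∀ a ∈ A.carrier,
    E.mul x (E.mul (i.toFun a) (E.inv x)) = i.toFun (ρ.act (q.toFun x) a)

namespace AlgExtension

variable {G A : AffAlgGroup} {ρ : AlgAction G A}

/-- An extension splits if the quotient map admits an algebraic group
theoretic section. -/
def Splits (e : AlgExtension G A ρ) : Prop :=
  ∃ σ : AlgGroupHom G e.E, ∀ g ∈ G.carrier, e.q.toFun (σ.toFun g) = g

/-- Equivalence of extensions (via a morphism over `G` and under `A`;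
such a morphism is automatically an isomorphism). -/
def Equiv (e₁ e₂ : AlgExtension G A ρ) : Prop :=
  ∃ f : AlgGroupHom e₁.E e₂.E,
    (∀ a ∈ A.carrier, f.toFun (e₁.i.toFun a) = e₂.i.toFun a) ∧
    (∀ x ∈ e₁.E.carrier, e₂.q.toFun (f.toFun x) = e₁.q.toFun x)

/-- `e₃` is a Baer sum of `e₁` and `e₂`: there is a regular map from the fiber
product `E₁ ×_G E₂` to `E₃` which is multiplicative, lies over `G` and
restricts to the multiplication `A × A → A` on the kernels.  (This
characterizes the Baer sum up to equivalence.) -/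
def IsBaerSum (e₁ e₂ e₃ : AlgExtension G A ρ) : Prop :=
  ∃ h : Pt (e₁.E.n + e₂.E.n) → Pt e₃.E.n,
    IsRegularOn {z : Pt (e₁.E.n + e₂.E.n) | Pt.left z ∈ e₁.E.carrier ∧
      Pt.right z ∈ e₂.E.carrier ∧ e₁.q.toFun (Pt.left z) = e₂.q.toFun (Pt.right z)} h ∧
    (∀ x ∈ e₁.E.carrier, ∀ y ∈ e₂.E.carrier, e₁.q.toFun x = e₂.q.toFun y →
      h (Fin.append x y) ∈ e₃.E.carrier) ∧
    (∀ x x' y y', x ∈ e₁.E.carrier → x' ∈ e₁.E.carrier → y ∈ e₂.E.carrier →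
      y' ∈ e₂.E.carrier → e₁.q.toFun x = e₂.q.toFun y → e₁.q.toFun x' = e₂.q.toFun y' →
      h (Fin.append (e₁.E.mul x x') (e₂.E.mul y y')) =
        e₃.E.mul (h (Fin.append x y)) (h (Fin.append x' y'))) ∧
    (∀ x ∈ e₁.E.carrier, ∀ y ∈ e₂.E.carrier, e₁.q.toFun x = e₂.q.toFun y →
      e₃.q.toFun (h (Fin.append x y)) = e₁.q.toFun x) ∧
    (∀ a ∈ A.carrier, ∀ b ∈ A.carrier,
      h (Fin.append (e₁.i.toFun a) (e₂.i.toFun b)) = e₃.i.toFun (A.mul a b))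

end AlgExtension

/-- A realization of the abelian group `Ext_alg(G, A)` of equivalence classes
of extensions of `G` by `A` (inducing the action `ρ`), with addition given by
the Baer sum, and zero element the class of split extensions. -/
structure IsExtGroup (G A : AffAlgGroup) (ρ : AlgAction G A)
    (Ext : Type) [AddCommGroup Ext] : Prop where
  exists_cls : ∃ cls : AlgExtension G A ρ → Ext,
    Function.Surjective cls ∧
    (∀ e₁ e₂, cls e₁ = cls e₂ ↔ Relation.EqvGen AlgExtension.Equiv e₁ e₂) ∧
    (∀ e, cls e = 0 ↔ e.Splits) ∧
    (∀ e₁ e₂ e₃, AlgExtension.IsBaerSum e₁ e₂ e₃ → cls e₁ + cls e₂ = cls e₃)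

/-- The class map itself, when we need to name it. -/
structure ExtClassMap (G A : AffAlgGroup) (ρ : AlgAction G A)
    (Ext : Type) [AddCommGroup Ext] : Type where
  cls : AlgExtension G A ρ → Ext
  surj : Function.Surjective cls
  cls_eq_iff : ∀ e₁ e₂, cls e₁ = cls e₂ ↔ Relation.EqvGen AlgExtension.Equiv e₁ e₂
  cls_eq_zero_iff : ∀ e, cls e = 0 ↔ e.Splits
  cls_baer : ∀ e₁ e₂ e₃, AlgExtension.IsBaerSum e₁ e₂ e₃ → cls e₁ + cls e₂ = cls e₃

/-- An algebraic subgroup of `G`. -/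
structure AlgSubgroup (G : AffAlgGroup) : Type where
  carrier : Set (Pt G.n)
  subset : carrier ⊆ G.carrier
  isAlgebraic : IsAlgebraicSet carrier
  one_mem : G.one ∈ carrier
  mul_mem : ∀ {x y : Pt G.n}, x ∈ carrier → y ∈ carrier → G.mul x y ∈ carrier
  inv_mem : ∀ {x : Pt G.n}, x ∈ carrier → G.inv x ∈ carrier

namespace AlgSubgroup

variable {G : AffAlgGroup}

/-- An algebraic subgroup is itself an affine algebraic group. -/
def toGrp (H : AlgSubgroup G) : AffAlgGroup where
  n := G.n
  carrier := H.carrier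
  isAlgebraic := H.isAlgebraic
  one := G.one
  one_mem := H.one_mem
  mul := G.mul
  inv := G.inv
  mul_mem := H.mul_mem
  inv_mem := H.inv_mem
  mul_assoc' hx hy hz := G.mul_assoc' (H.subset hx) (H.subset hy) (H.subset hz)
  one_mul' hx := G.one_mul' (H.subset hx)
  mul_one' hx := G.mul_one' (H.subset hx)
  inv_mul' hx := G.inv_mul' (H.subset hx)
  mul_regular := by
    obtain ⟨P, hP⟩ := G.mul_regular
    exact ⟨P, fun z hz => hP z ⟨H.subset hz.1, H.subset hz.2⟩⟩
  inv_regular := by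
    obtain ⟨P, hP⟩ := G.inv_regular
    exact ⟨P, fun x hx => hP x (H.subset hx)⟩

def IsNormal (H : AlgSubgroup G) : Prop :=
  ∀ g ∈ G.carrier, ∀ x ∈ H.carrier, G.mul g (G.mul x (G.inv g)) ∈ H.carrier

/-- `H` is the unipotent radical of `G`: the largest connected normal
unipotent algebraic subgroup. -/
def IsUnipotentRadical (H : AlgSubgroup G) : Prop :=
  H.IsNormal ∧ H.toGrp.IsConnected ∧ H.toGrp.IsUnipotent ∧
    ∀ K : AlgSubgroup G, K.IsNormal → K.toGrp.IsConnected → K.toGrp.IsUnipotent →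
      K.carrier ⊆ H.carrier

/-- `G` is reductive: its unipotent radical is trivial. -/
def _root_.AffAlgGroup.IsReductive (G : AffAlgGroup) : Prop :=
  ∀ K : AlgSubgroup G, K.IsNormal → K.toGrp.IsConnected → K.toGrp.IsUnipotent →
    K.carrier = {G.one}

end AlgSubgroup

/-- A Levi decomposition `G = G_u ⋊ G_red` of `G`:  `Gu` is the unipotent
radical and `L` is a connected reductive algebraic subgroup with
`Gu ∩ L = 1` and `Gu · L = G`. -/
structure LeviDecomposition (G : AffAlgGroup) : Type where
  Gu : AlgSubgroup G
  L : AlgSubgroup G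
  Gu_radical : Gu.IsUnipotentRadical
  L_connected : L.toGrp.IsConnected
  L_reductive : L.toGrp.IsReductive
  inter : Gu.carrier ∩ L.carrier = {G.one}
  decomp : ∀ x ∈ G.carrier, ∃ u ∈ Gu.carrier, ∃ l ∈ L.carrier, x = G.mul u l

/-- The group homomorphism on point groups induced by a morphism of algebraic
groups. -/
def AlgGroupHom.toGpHom {G H : AffAlgGroup} (f : AlgGroupHom G H) : G.Gp →* H.Gp :=
  MonoidHom.mk' (fun x => ⟨f.toFun x.1, f.maps_to x.2⟩)
    (fun a b => Subtype.ext (f.map_mul a.2 b.2))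

/-- The subgroup of the point group underlying an algebraic subgroup. -/
def AlgSubgroup.toSubgroup {G : AffAlgGroup} (H : AlgSubgroup G) : Subgroup G.Gp where
  carrier := {x : G.Gp | x.1 ∈ H.carrier}
  one_mem' := H.one_mem
  mul_mem' := fun ha hb => H.mul_mem ha hb
  inv_mem' := fun ha => H.inv_mem ha

/-- Iterated product (powers) in an algebraic group. -/
def AffAlgGroup.pow (G : AffAlgGroup) (x : Pt G.n) : ℕ → Pt G.n
  | 0 => G.one
  | k + 1 => G.mul x (G.pow x k)

/-- The inclusion homomorphism of an algebraic subgroup. -/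
def AlgSubgroup.incl {A : AffAlgGroup} (H : AlgSubgroup A) : H.toGrp.Gp →* A.Gp :=
  MonoidHom.mk' (fun x => ⟨x.1, H.subset x.2⟩) (fun _ _ => rfl)

/-! ### The canonical covering `G̃ = G_u ⋊ (Z × G̃'_red) → G` -/

/-- Data of the canonical algebraic covering `q_G : G̃ → G` attached to a Levi
decomposition `G = G_u ⋊ L`: here `Z` is the identity component of the center
of `L` (the maximal connected central algebraic subgroup), `Lder = [L, L]` is
the derived group of `L`, and `G̃ = G_u ⋊ (Z × G̃'_red)`, where `G̃'_red` is the
universal (simply connected) algebraic covering group of `Lder`. -/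
structure CoveringData (G : AffAlgGroup) (LD : LeviDecomposition G) : Type where
  /-- the identity component of the center of the Levi subgroup `L` -/
  Z : AlgSubgroup G
  Z_sub : Z.carrier ⊆ LD.L.carrier
  Z_central : ∀ z ∈ Z.carrier, ∀ l ∈ LD.L.carrier, G.mul z l = G.mul l z
  Z_connected : Z.toGrp.IsConnected
  Z_max : ∀ K : AlgSubgroup G, K.carrier ⊆ LD.L.carrier →
    (∀ z ∈ K.carrier, ∀ l ∈ LD.L.carrier, G.mul z l = G.mul l z) →
    K.toGrp.IsConnected → K.carrier ⊆ Z.carrier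
  /-- the derived group `[L, L]` of the Levi subgroup -/
  Lder : AlgSubgroup G
  Lder_sub : Lder.carrier ⊆ LD.L.carrier
  Lder_comm : ∀ x ∈ LD.L.carrier, ∀ y ∈ LD.L.carrier,
    G.mul x (G.mul y (G.mul (G.inv x) (G.inv y))) ∈ Lder.carrier
  Lder_min : ∀ K : AlgSubgroup G,
    (∀ x ∈ LD.L.carrier, ∀ y ∈ LD.L.carrier,
      G.mul x (G.mul y (G.mul (G.inv x) (G.inv y))) ∈ K.carrier) →
    Lder.carrier ⊆ K.carrier
  /-- the covering group `G̃` and the covering morphism -/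
  Gt : AffAlgGroup
  qG : AlgGroupHom Gt G
  qG_surj : ∀ g ∈ G.carrier, ∃ x ∈ Gt.carrier, qG.toFun x = g
  /-- the three factors of `G̃ = G_u ⋊ (Z × G̃'_red)` -/
  Gu' : AlgSubgroup Gt
  Zc : AlgSubgroup Gt
  Gs : AlgSubgroup Gt
  Gu'_normal : Gu'.IsNormal
  Zc_Gs_comm : ∀ z ∈ Zc.carrier, ∀ s ∈ Gs.carrier, Gt.mul z s = Gt.mul s z
  Zc_Gs_inter : Zc.carrier ∩ Gs.carrier = {Gt.one}
  decomp : ∀ x ∈ Gt.carrier, ∃ u ∈ Gu'.carrier, ∃ z ∈ Zc.carrier, ∃ s ∈ Gs.carrier,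
    x = Gt.mul u (Gt.mul z s)
  levi_inter : {x | x ∈ Gu'.carrier ∧
      ∃ z ∈ Zc.carrier, ∃ s ∈ Gs.carrier, x = Gt.mul z s} = {Gt.one}
  /-- `q_G` restricts to an isomorphism `G_u' ≅ G_u` -/
  qG_Gu'_inj : Set.InjOn qG.toFun Gu'.carrier
  qG_Gu'_img : qG.toFun '' Gu'.carrier = LD.Gu.carrier
  /-- `q_G` restricts to an isomorphism `Z_c ≅ Z` -/
  qG_Zc_inj : Set.InjOn qG.toFun Zc.carrier
  qG_Zc_img : qG.toFun '' Zc.carrier = Z.carrier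
  /-- `q_G` maps `G̃'_red` onto `[L, L]`, and `G̃'_red` is connected and simply
  connected: it is the universal algebraic covering group of `[L, L]` -/
  qG_Gs_img : qG.toFun '' Gs.carrier = Lder.carrier
  Gs_connected : Gs.toGrp.IsConnected
  Gs_simplyConnected : ∀ γ : FundamentalGroup Gs.toGrp.Gp ⟨Gt.one, Gs.one_mem⟩, γ = 1
  /-- the kernel `Π_G` of the covering is finite and central -/
  ker_finite : {x ∈ Gt.carrier | qG.toFun x = G.one}.Finite
  ker_central : ∀ x ∈ Gt.carrier, qG.toFun x = G.one →
    ∀ y ∈ Gt.carrier, Gt.mul x y = Gt.mul y x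

namespace CoveringData

variable {G : AffAlgGroup} {LD : LeviDecomposition G}

/-- The kernel `Π_G` of the covering `q_G : G̃ → G`, as a subgroup of the point
group of `G̃`. -/
def PiG (CD : CoveringData G LD) : Subgroup CD.Gt.Gp := CD.qG.toGpHom.ker

/-- The fundamental group `π₁(G'_red)` of the derived group of the Levi
subgroup, realized as the kernel of `G̃'_red → G'_red`, a subgroup of `Π_G`. -/
def pi1Gs (CD : CoveringData G LD) : Subgroup CD.Gt.Gp where
  carrier := {x : CD.Gt.Gp | x.1 ∈ CD.Gs.carrier ∧ x ∈ CD.PiG}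
  one_mem' := ⟨CD.Gs.one_mem, one_mem CD.PiG⟩
  mul_mem' := fun hx hy => ⟨CD.Gs.mul_mem hx.1 hy.1, mul_mem hx.2 hy.2⟩
  inv_mem' := fun hx => ⟨CD.Gs.inv_mem hx.1, inv_mem hx.2⟩

lemma pi1Gs_le_PiG (CD : CoveringData G LD) : CD.pi1Gs ≤ CD.PiG := fun _ hx => hx.2

/-- `ext` is (equivalent to) the pushout extension `γ_* G̃ = (A × G̃)/Γ(γ)` of
`G` by `A` along `γ : Π_G → A`:  this is characterized by the existence of a
morphism `h : G̃ → E` over `G` restricting to `γ` on `Π_G`. -/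
def IsPushoutOf (CD : CoveringData G LD) {A : AffAlgGroup} {ρ : AlgAction G A}
    (γ : ↥CD.PiG →* A.Gp) (ext : AlgExtension G A ρ) : Prop :=
  ∃ h : AlgGroupHom CD.Gt ext.E,
    (∀ x ∈ CD.Gt.carrier, ext.q.toFun (h.toFun x) = CD.qG.toFun x) ∧
    (∀ x : ↥CD.PiG, h.toFun x.1.1 = ext.i.toFun (γ x).1)

end CoveringData

/-- An affine variety over `ℂ`, given by its points and its algebra of regular functions. -/
class AffVar (X : Type) where
  /-- the regular functions -/
  functions : Subalgebra ℂ (X → ℂ)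
  fg : functions.FG
  sep : ∀ x y, (∀ p ∈ functions, p x = p y) → x = y
  point : ∀ ψ : functions →ₐ[ℂ] ℂ, ∃ x, ∀ p : functions, ψ p = p.1 x

namespace AffVar

/-- The algebra of regular functions of an affine variety. -/
abbrev reg (X : Type) [AffVar X] : Subalgebra ℂ (X → ℂ) := functions

/-- Precomposition with a map, as a homomorphism of function algebras. -/
def pull {X Y : Type} (f : X → Y) : (Y → ℂ) →ₐ[ℂ] (X → ℂ) where
  toFun p := p ∘ f
  map_one' := rfl
  map_mul' _ _ := rfl
  map_zero' := rfl
  map_add' _ _ := rfl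
  commutes' _ := rfl

@[simp] lemma pull_apply {X Y : Type} (f : X → Y) (p : Y → ℂ) (x : X) : pull f p x = p (f x) := rfl

/-- A map of affine varieties is regular if it pulls regular functions back to regular functions. -/
def IsReg {X Y : Type} [AffVar X] [AffVar Y] (f : X → Y) : Prop :=
  ∀ p ∈ reg Y, (fun x => p (f x)) ∈ reg X

section basic

variable {X Y Z : Type} [AffVar X] [AffVar Y] [AffVar Z]

lemma IsReg.comp {g : Y → Z} {f : X → Y} (hg : IsReg g) (hf : IsReg f) :
    IsReg (fun x => g (f x)) := fun p hp => hf _ (hg p hp)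

lemma isReg_id : IsReg (fun x : X => x) := fun _ hp => hp

lemma const_mem (c : ℂ) : (fun _ : X => c) ∈ reg X := (reg X).algebraMap_mem c

lemma isReg_const (y : Y) : IsReg (fun _ : X => y) := fun p _ => const_mem (p y)

/-- The comorphism of a regular map. -/
def IsReg.comap {f : X → Y} (hf : IsReg f) : reg Y →ₐ[ℂ] reg X :=
  ((pull f).comp (reg Y).val).codRestrict (reg X) (fun p => hf p.1 p.2)

@[simp] lemma IsReg.comap_apply {f : X → Y} (hf : IsReg f) (p : reg Y) (x : X) :
    (hf.comap p).1 x = p.1 (f x) := rfl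

/-- Evaluation at a point. -/
def ev (x : X) : reg X →ₐ[ℂ] ℂ := (Pi.evalAlgHom ℂ (fun _ : X => ℂ) x).comp (reg X).val

@[simp] lemma ev_apply (x : X) (p : reg X) : ev x p = p.1 x := rfl

instance : Algebra.FiniteType ℂ (reg X) := (reg X).fg_iff_finiteType.mp fg

instance : IsNoetherianRing (reg X) := Algebra.FiniteType.isNoetherianRing ℂ _

/-- A homomorphism of algebras of regular functions comes from a regular map. -/
lemma exists_of_algHom (ψ : reg Y →ₐ[ℂ] reg X) :
    ∃ f : X → Y, IsReg f ∧ ∀ (p : reg Y) x, p.1 (f x) = (ψ p).1 x := by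
  choose f hf using fun x => point ((ev x).comp ψ)
  refine ⟨f, fun p hp => ?_, fun p x => (hf x p).symm⟩
  have : (fun x => p (f x)) = (ψ ⟨p, hp⟩).1 := funext fun x => (hf x ⟨p, hp⟩).symm
  rw [this]; exact (ψ ⟨p, hp⟩).2


/-- The regular functions on a product. -/
def prodReg (X Y : Type) [AffVar X] [AffVar Y] : Subalgebra ℂ (X × Y → ℂ) :=
  (reg X).map (pull Prod.fst) ⊔ (reg Y).map (pull Prod.snd)

lemma fst_mem_prodReg {p : X → ℂ} (hp : p ∈ reg X) : (fun z : X × Y => p z.1) ∈ prodReg X Y :=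
  (le_sup_left : _ ≤ prodReg X Y) ⟨p, hp, rfl⟩

lemma snd_mem_prodReg {p : Y → ℂ} (hp : p ∈ reg Y) : (fun z : X × Y => p z.2) ∈ prodReg X Y :=
  (le_sup_right : _ ≤ prodReg X Y) ⟨p, hp, rfl⟩

lemma exists_sum_of_mem_prodReg {P : X × Y → ℂ} (hP : P ∈ prodReg X Y) :
    ∃ (n : ℕ) (a : Fin n → reg X) (b : Fin n → reg Y),
      ∀ x y, P (x, y) = ∑ i, (a i).1 x * (b i).1 y := by
  have h := Algebra.TensorProduct.productMap_range
    ((pull (Prod.fst : X × Y → X)).comp (reg X).val)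
    ((pull (Prod.snd : X × Y → Y)).comp (reg Y).val)
  rw [AlgHom.range_comp, AlgHom.range_comp, Subalgebra.range_val, Subalgebra.range_val] at h
  have hP' : P ∈ (Algebra.TensorProduct.productMap
    ((pull (Prod.fst : X × Y → X)).comp (reg X).val)
    ((pull (Prod.snd : X × Y → Y)).comp (reg Y).val)).range := by rw [h]; exact hP
  obtain ⟨t, rfl⟩ := hP'
  clear hP h
  induction t with
  | zero => exact ⟨0, Fin.elim0, Fin.elim0, by simp⟩
  | tmul a b => exact ⟨1, fun _ => a, fun _ => b, by simp⟩
  | add s t hs ht =>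
    obtain ⟨n, a, b, h₁⟩ := hs
    obtain ⟨m, c, d, h₂⟩ := ht
    refine ⟨n + m, Fin.append a c, Fin.append b d, fun x y => ?_⟩
    have h₁ := h₁ x y
    have h₂ := h₂ x y
    simp only [AlgHom.toRingHom_eq_coe, RingHom.coe_coe] at h₁ h₂ ⊢
    rw [map_add, Pi.add_apply, h₁, h₂, Fin.sum_univ_add]
    simp

instance instProd : AffVar (X × Y) where
  functions := prodReg X Y
  fg := (fg.map _).sup (fg.map _)
  sep z w h := Prod.ext
    (sep _ _ fun _ hp => h _ (fst_mem_prodReg hp)) (sep _ _ fun _ hp => h _ (snd_mem_prodReg hp))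
  point ψ := by
    let f₁ : reg X →ₐ[ℂ] prodReg X Y :=
      ((pull (Prod.fst : X × Y → X)).comp (reg X).val).codRestrict _ (fun p => fst_mem_prodReg p.2)
    let f₂ : reg Y →ₐ[ℂ] prodReg X Y :=
      ((pull (Prod.snd : X × Y → Y)).comp (reg Y).val).codRestrict _ (fun p => snd_mem_prodReg p.2)
    obtain ⟨x, hx⟩ := point (ψ.comp f₁)
    obtain ⟨y, hy⟩ := point (ψ.comp f₂)
    refine ⟨(x, y), fun P => ?_⟩
    obtain ⟨n, a, b, h⟩ := exists_sum_of_mem_prodReg P.2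
    have : P = ∑ i, f₁ (a i) * f₂ (b i) := by
      apply Subtype.ext
      funext z
      simp only [AddSubmonoidClass.coe_finsetSum, Finset.sum_apply]
      exact h z.1 z.2
    rw [h x y, this, map_sum]
    refine Finset.sum_congr rfl fun i _ => ?_
    rw [map_mul]
    exact congrArg₂ _ (hx (a i)) (hy (b i))

lemma isReg_fst : IsReg (Prod.fst : X × Y → X) := fun _ hp => fst_mem_prodReg hp
lemma isReg_snd : IsReg (Prod.snd : X × Y → Y) := fun _ hp => snd_mem_prodReg hp

lemma exists_sum_of_mem_prod {P : X × Y → ℂ} (hP : P ∈ reg (X × Y)) :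
    ∃ (n : ℕ) (a : Fin n → reg X) (b : Fin n → reg Y),
      ∀ x y, P (x, y) = ∑ i, (a i).1 x * (b i).1 y := exists_sum_of_mem_prodReg hP

lemma sum_mem_reg {ι : Type*} (s : Finset ι) {f : ι → X → ℂ} (h : ∀ i ∈ s, f i ∈ reg X) :
    (fun x => ∑ i ∈ s, f i x) ∈ reg X := by
  have : (fun x => ∑ i ∈ s, f i x) = ∑ i ∈ s, f i := by ext x; simp
  rw [this]; exact sum_mem h

lemma prod_mem_reg {ι : Type*} (s : Finset ι) {f : ι → X → ℂ} (h : ∀ i ∈ s, f i ∈ reg X) :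
    (fun x => ∏ i ∈ s, f i x) ∈ reg X := by
  have : (fun x => ∏ i ∈ s, f i x) = ∏ i ∈ s, f i := by ext x; simp
  rw [this]; exact prod_mem h

lemma mul_mem_reg {f g : X → ℂ} (hf : f ∈ reg X) (hg : g ∈ reg X) :
    (fun x => f x * g x) ∈ reg X := mul_mem hf hg

lemma IsReg.prodMk {f : X → Y} {g : X → Z} (hf : IsReg f) (hg : IsReg g) :
    IsReg (fun x => (f x, g x)) := by
  intro P hP
  obtain ⟨n, a, b, h⟩ := exists_sum_of_mem_prod hP
  simp only [h]
  exact sum_mem_reg _ fun i _ => mul_mem_reg (hf _ (a i).2) (hg _ (b i).2)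

end basic

end AffVar

/-- An affine algebraic group, given by its points and its algebra of regular functions. -/
class AffGrp (X : Type) [Group X] extends AffVar X where
  inv_reg : AffVar.IsReg (fun x : X => x⁻¹)
  mul_reg : AffVar.IsReg (fun z : X × X => z.1 * z.2)

namespace AffVar

lemma IsReg.mul {X H : Type} [AffVar X] [Group H] [AffGrp H] {f g : X → H} (hf : IsReg f)
    (hg : IsReg g) : IsReg (fun x => f x * g x) := AffGrp.mul_reg.comp (hf.prodMk hg)

lemma IsReg.inv {X H : Type} [AffVar X] [Group H] [AffGrp H] {f : X → H} (hf : IsReg f) :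
    IsReg (fun x => (f x)⁻¹) := AffGrp.inv_reg.comp hf

lemma IsReg.pow {X H : Type} [AffVar X] [Group H] [AffGrp H] {f : X → H} (hf : IsReg f) (n : ℕ) :
    IsReg (fun x => f x ^ n) := by
  induction n with
  | zero => simpa using isReg_const 1
  | succ n ih => simpa only [pow_succ] using ih.mul hf

instance {H K : Type} [Group H] [AffGrp H] [Group K] [AffGrp K] : AffGrp (H × K) where
  inv_reg := (isReg_fst.inv).prodMk (isReg_snd.inv)
  mul_reg := ((isReg_fst.comp isReg_fst).mul (isReg_fst.comp isReg_snd)).prodMk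
    ((isReg_snd.comp isReg_fst).mul (isReg_snd.comp isReg_snd))

/-! ### Zero loci -/

section closed

variable {X Y : Type} [AffVar X] [AffVar Y]

/-- Zariski closed sets. -/
def IsZClosed (C : Set X) : Prop := ∃ S : Set (X → ℂ), S ⊆ reg X ∧ C = {x | ∀ p ∈ S, p x = 0}

lemma IsZClosed.inter {C D : Set X} (hC : IsZClosed C) (hD : IsZClosed D) : IsZClosed (C ∩ D) := by
  obtain ⟨S, hS, rfl⟩ := hC
  obtain ⟨T, hT, rfl⟩ := hD
  refine ⟨S ∪ T, Set.union_subset hS hT, ?_⟩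
  ext x; simp [or_imp, forall_and]

lemma isZClosed_iInter {ι : Sort*} {C : ι → Set X} (hC : ∀ i, IsZClosed (C i)) :
    IsZClosed (⋂ i, C i) := by
  choose S hS hS' using hC
  refine ⟨⋃ i, S i, Set.iUnion_subset hS, ?_⟩
  ext x
  simp only [Set.mem_iInter, hS', Set.mem_ofPred_eq, Set.mem_iUnion]
  tauto

lemma isZClosed_eq_zero {p : X → ℂ} (hp : p ∈ reg X) : IsZClosed {x | p x = 0} :=
  ⟨{p}, by simpa using hp, by simp⟩

lemma IsZClosed.preimage {C : Set Y} (hC : IsZClosed C) {f : X → Y} (hf : IsReg f) :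
    IsZClosed (f ⁻¹' C) := by
  obtain ⟨S, hS, rfl⟩ := hC
  refine ⟨pull f '' S, ?_, ?_⟩
  · rintro _ ⟨p, hp, rfl⟩; exact hf p (hS hp)
  · ext x; simp

lemma isZClosed_eq {f g : X → Y} (hf : IsReg f) (hg : IsReg g) : IsZClosed {x | f x = g x} := by
  refine ⟨(fun p => pull f p - pull g p) '' (reg Y), ?_, ?_⟩
  · rintro _ ⟨p, hp, rfl⟩; exact sub_mem (hf p hp) (hg p hp)
  · ext x
    simp only [Set.mem_ofPred_eq, Set.forall_mem_image, Pi.sub_apply, pull_apply, sub_eq_zero]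
    exact ⟨fun h p _ => by rw [h], fun h => sep _ _ h⟩

lemma isZClosed_singleton (x : X) : IsZClosed {x} := by
  simpa using isZClosed_eq (isReg_id (X := X)) (isReg_const x)

lemma IsZClosed.union {C D : Set X} (hC : IsZClosed C) (hD : IsZClosed D) : IsZClosed (C ∪ D) := by
  obtain ⟨S, hS, rfl⟩ := hC
  obtain ⟨T, hT, rfl⟩ := hD
  refine ⟨Set.image2 (· * ·) S T, ?_, ?_⟩
  · rintro _ ⟨s, hs, t, ht, rfl⟩; exact mul_mem (hS hs) (hT ht)
  · ext x
    simp only [Set.mem_union, Set.mem_ofPred_eq, Set.forall_mem_image2, Pi.mul_apply, mul_eq_zero]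
    constructor
    · rintro (h | h) s hs t ht
      · exact Or.inl (h s hs)
      · exact Or.inr (h t ht)
    · intro h
      by_contra! hc
      obtain ⟨⟨s, hs, hs'⟩, t, ht, ht'⟩ := hc
      exact (h s hs t ht).elim hs' ht'

lemma isZClosed_of_finite {C : Set X} (hC : C.Finite) : IsZClosed C := by
  induction C, hC using Set.Finite.induction_on with
  | empty => exact ⟨{1}, by simp, by ext x; simp⟩
  | insert _ _ ih => rw [Set.insert_eq]; exact (isZClosed_singleton _).union ih

/-- A Zariski closed subset is an affine variety. -/
@[reducible] def ofClosed {C : Set X} (hC : IsZClosed C) : AffVar C where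
  functions := (reg X).map (pull Subtype.val)
  fg := fg.map _
  sep x y h := Subtype.ext (sep _ _ fun p hp => h _ ⟨p, hp, rfl⟩)
  point ψ := by
    let r : reg X →ₐ[ℂ] (reg X).map (pull (Subtype.val : C → X)) :=
      ((pull Subtype.val).comp (reg X).val).codRestrict _ (fun p => ⟨p.1, p.2, rfl⟩)
    obtain ⟨x, hx⟩ := point (ψ.comp r)
    have hxC : x ∈ C := by
      obtain ⟨S, hS, rfl⟩ := hC
      intro p hp
      have h0 : r ⟨p, hS hp⟩ = 0 := Subtype.ext (funext fun y => y.2 p hp)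
      have := hx ⟨p, hS hp⟩
      rw [AlgHom.comp_apply, h0, map_zero] at this
      exact this.symm
    refine ⟨⟨x, hxC⟩, ?_⟩
    rintro ⟨_, p, hp, rfl⟩
    exact hx ⟨p, hp⟩

lemma isReg_val {C : Set X} (hC : IsZClosed C) :
    letI := ofClosed hC; IsReg (Subtype.val : C → X) := fun p hp => ⟨p, hp, rfl⟩

lemma isReg_codRestrict {C : Set X} (hC : IsZClosed C) {f : Y → X} (hf : IsReg f)
    (h : ∀ y, f y ∈ C) : letI := ofClosed hC; IsReg (fun y => (⟨f y, h y⟩ : C)) := by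
  rintro _ ⟨p, hp, rfl⟩
  exact hf p hp

end closed

/-- A Zariski closed subgroup is an affine algebraic group. -/
@[reducible] def subgroupGrp {H : Type} [Group H] [AffGrp H] {K : Subgroup H}
    (hK : IsZClosed (K : Set H)) : AffGrp K :=
  letI : AffVar K := ofClosed hK
  { toAffVar := ofClosed hK
    inv_reg := isReg_codRestrict hK (isReg_val hK).inv (fun y => (y⁻¹).2)
    mul_reg := isReg_codRestrict hK (((isReg_val hK).comp isReg_fst).mul
      ((isReg_val hK).comp isReg_snd)) (fun z => (z.1 * z.2).2) }

end AffVar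

/-! ### Nullstellensatz and descent of regular functions -/

section Nullstellensatz

/-- Maximal ideals of finitely generated `ℂ`-algebras are kernels of points. -/
lemma exists_algHom_ker_eq {A : Type*} [CommRing A] [Algebra ℂ A] [Algebra.FiniteType ℂ A]
    (M : Ideal A) [M.IsMaximal] : ∃ ψ : A →ₐ[ℂ] ℂ, ∀ a, ψ a = 0 ↔ a ∈ M := by
  let : Field (A ⧸ M) := Ideal.Quotient.field M
  have : Algebra.FiniteType ℂ (A ⧸ M) := inferInstance
  have : Module.Finite ℂ (A ⧸ M) := finite_of_finite_type_of_isJacobsonRing ℂ (A ⧸ M)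
  let e : ℂ ≃ₐ[ℂ] (A ⧸ M) := AlgEquiv.ofBijective (Algebra.ofId ℂ (A ⧸ M))
    IsAlgClosed.algebraMap_bijective_of_isIntegral
  refine ⟨(e.symm : (A ⧸ M) →ₐ[ℂ] ℂ).comp (Ideal.Quotient.mkₐ ℂ M), fun a => ?_⟩
  simp [Ideal.Quotient.eq_zero_iff_mem]

lemma isNilpotent_of_forall_algHom {A : Type*} [CommRing A] [Algebra ℂ A] [Algebra.FiniteType ℂ A]
    (a : A) (h : ∀ ψ : A →ₐ[ℂ] ℂ, ψ a = 0) : IsNilpotent a := by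
  have : IsJacobsonRing A := isJacobsonRing_of_finiteType (A := ℂ)
  have : a ∈ (⊥ : Ideal A).radical := by
    rw [Ideal.radical_eq_jacobson]
    refine Ideal.mem_sInf.mpr fun {M} hM => ?_
    have := hM.2
    obtain ⟨ψ, hψ⟩ := exists_algHom_ker_eq M
    exact (hψ a).mp (h ψ)
  obtain ⟨n, hn⟩ := this
  exact ⟨n, by simpa using hn⟩

lemma AffVar.ideal_eq_top {X : Type} [AffVar X] (J : Ideal (AffVar.reg X))
    (hJ : ∀ x, ∃ p ∈ J, p.1 x ≠ 0) : J = ⊤ := by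
  by_contra h
  obtain ⟨M, hM, hJM⟩ := Ideal.exists_le_maximal J h
  obtain ⟨ψ, hψ⟩ := exists_algHom_ker_eq M
  obtain ⟨x, hx⟩ := AffVar.point ψ
  obtain ⟨p, hp, hpx⟩ := hJ x
  exact hpx ((hx p).symm.trans ((hψ p).mpr (hJM hp)))

end Nullstellensatz

section Field

open TensorProduct Polynomial

lemma linearIndependent_pow_of_transcendental {K L : Type*} [Field K] [Field L] [Algebra K L]
    {x : L} (hx : Transcendental K x) : LinearIndependent K (fun n : ℕ => x ^ n) := by
  have h := (Polynomial.basisMonomials K).linearIndependent.map' (Polynomial.aeval x).toLinearMap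
    (LinearMap.ker_eq_bot.mpr (transcendental_iff_injective.mp hx))
  have h2 : (fun n : ℕ => x ^ n) =
      (Polynomial.aeval x).toLinearMap ∘ Polynomial.basisMonomials K := by
    ext n
    simp [Polynomial.aeval_monomial]
  rw [h2]; exact h

lemma mem_range_of_isNilpotent_tmul_sub {K L : Type*} [Field K] [Field L] [CharZero K] [Algebra K L]
    (x : L) (h : IsNilpotent (x ⊗ₜ[K] (1 : L) - (1 : L) ⊗ₜ[K] x)) :
    x ∈ Set.range (algebraMap K L) := by
  obtain ⟨n, hn⟩ := h
  have hz : Polynomial.aeval ((1 : L) ⊗ₜ[K] x) ((Polynomial.X - Polynomial.C x) ^ n) = 0 := by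
    have : (Polynomial.aeval ((1 : L) ⊗ₜ[K] x)) (Polynomial.X - Polynomial.C x) =
        - (x ⊗ₜ[K] (1 : L) - (1 : L) ⊗ₜ[K] x) := by
      simp [Algebra.TensorProduct.algebraMap_apply]
    rw [map_pow, this, neg_pow, hn, mul_zero]
  have halg : IsAlgebraic K x := by
    by_contra hx
    have hli := linearIndependent_pow_of_transcendental hx
    have hli' := Module.Flat.linearIndependent_one_tmul (S := L) hli
    have hne : ((Polynomial.X - Polynomial.C x) ^ n : L[X]) ≠ 0 :=
      pow_ne_zero _ (Polynomial.X_sub_C_ne_zero x)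
    apply hne
    rw [Polynomial.aeval_eq_sum_range] at hz
    simp only [Algebra.TensorProduct.tmul_pow, one_pow] at hz
    have := linearIndependent_iff'.mp hli' (Finset.range _) _ hz
    ext i
    by_cases hi : i < ((Polynomial.X - Polynomial.C x) ^ n : L[X]).natDegree + 1
    · simpa using this i (Finset.mem_range.mpr hi)
    · rw [Polynomial.coeff_eq_zero_of_natDegree_lt (by omega)]; simp
  have hintegral : IsIntegral K x := halg.isIntegral
  set P := (minpoly K x).map (algebraMap K L) with hP
  have hPsep : P.Separable := (minpoly.irreducible hintegral).separable.map
  have hPz : Polynomial.aeval ((1 : L) ⊗ₜ[K] x) P = 0 := by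
    rw [hP, Polynomial.aeval_map_algebraMap]
    have : (1 : L) ⊗ₜ[K] x = (Algebra.TensorProduct.includeRight : L →ₐ[K] L ⊗[K] L) x := rfl
    rw [this, Polynomial.aeval_algHom_apply, minpoly.aeval, map_zero]
  have hroot : Polynomial.X - Polynomial.C x ∣ P := by
    rw [Polynomial.dvd_iff_isRoot, Polynomial.IsRoot, hP, Polynomial.eval_map_algebraMap,
      minpoly.aeval]
  obtain ⟨Q, hQ⟩ := hroot
  have hcop : IsCoprime ((Polynomial.X - Polynomial.C x) ^ n) Q := by
    rw [hQ] at hPsep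
    exact (hPsep.isCoprime).pow_left
  obtain ⟨a, b, hab⟩ := hcop
  have hw : Polynomial.aeval ((1 : L) ⊗ₜ[K] x) (Polynomial.X - Polynomial.C x) = 0 := by
    have : Polynomial.X - Polynomial.C x = (Polynomial.X - Polynomial.C x) * a *
        (Polynomial.X - Polynomial.C x) ^ n + b * P := by
      rw [hQ]
      calc _ = (Polynomial.X - Polynomial.C x) *
            (a * (Polynomial.X - Polynomial.C x) ^ n + b * Q) := by rw [hab, mul_one]
        _ = _ := by ring
    rw [this, map_add, map_mul _ _ (_ ^ n), map_mul _ b, hz, hPz, mul_zero, mul_zero, add_zero]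
  have hw' : (1 : L) ⊗ₜ[K] x = x ⊗ₜ[K] (1 : L) := by
    simpa [sub_eq_zero, Algebra.TensorProduct.algebraMap_apply] using hw
  by_contra hx
  have hli : LinearIndependent K ![(1 : L), x] := by
    rw [LinearIndependent.pair_iff' one_ne_zero]
    intro a ha
    exact hx ⟨a, by rw [Algebra.algebraMap_eq_smul_one, ha]⟩
  have h2 := hli.tmul_of_isDomain hli
  have := h2.injective.ne (show ((0 : Fin 2), (1 : Fin 2)) ≠ (1, 0) by decide)
  exact this (by simpa using hw')

lemma exists_mul_eq_of_isNilpotent_tmul_sub {R S K L : Type*} [CommRing R] [CommRing S] [Field K]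
    [Field L] [CharZero K] [Algebra R S] [Algebra R K] [Algebra R L] [Algebra S L] [Algebra K L]
    [IsScalarTower R S L] [IsScalarTower R K L] [IsFractionRing R K] [IsFractionRing S L]
    (φ : S) (hnil : IsNilpotent (φ ⊗ₜ[R] (1 : S) - (1 : S) ⊗ₜ[R] φ)) :
    ∃ a b : R, b ≠ 0 ∧ algebraMap R S b * φ = algebraMap R S a := by
  let f₁ : S →ₐ[R] L ⊗[K] L :=
    ((Algebra.TensorProduct.includeLeft : L →ₐ[K] L ⊗[K] L).restrictScalars R).comp
      (IsScalarTower.toAlgHom R S L)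
  let f₂ : S →ₐ[R] L ⊗[K] L :=
    ((Algebra.TensorProduct.includeRight : L →ₐ[K] L ⊗[K] L).restrictScalars R).comp
      (IsScalarTower.toAlgHom R S L)
  have hnil' := hnil.map (Algebra.TensorProduct.lift f₁ f₂ (fun _ _ => Commute.all _ _))
  have hnilL : IsNilpotent
      ((algebraMap S L φ) ⊗ₜ[K] (1 : L) - (1 : L) ⊗ₜ[K] (algebraMap S L φ)) := by
    rw [map_sub, Algebra.TensorProduct.lift_tmul, Algebra.TensorProduct.lift_tmul, map_one, map_one,
      one_mul, mul_one] at hnil'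
    exact hnil'
  obtain ⟨k, hk⟩ := mem_range_of_isNilpotent_tmul_sub _ hnilL
  obtain ⟨⟨a, b⟩, hab⟩ := IsLocalization.surj (nonZeroDivisors R) k
  have : Nontrivial R := (algebraMap R K).domain_nontrivial
  refine ⟨a, b.1, nonZeroDivisors.ne_zero b.2, ?_⟩
  apply IsFractionRing.injective S L
  have h1 := congrArg (algebraMap K L) hab
  rw [map_mul, hk, ← IsScalarTower.algebraMap_apply, ← IsScalarTower.algebraMap_apply,
    IsScalarTower.algebraMap_apply R S L, IsScalarTower.algebraMap_apply R S L] at h1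
  rw [map_mul, mul_comm]
  exact h1

lemma exists_mul_mem_of_forall_algHom {S : Type*} [CommRing S] [IsDomain S] [Algebra ℂ S]
    [Algebra.FiniteType ℂ S] (R : Subalgebra ℂ S) (φ : S)
    (h : ∀ ψ₁ ψ₂ : S →ₐ[ℂ] ℂ, (∀ r ∈ R, ψ₁ r = ψ₂ r) → ψ₁ φ = ψ₂ φ) :
    ∃ r ∈ R, r ≠ 0 ∧ r * φ ∈ R := by
  have : Algebra.FiniteType R S := Algebra.FiniteType.of_restrictScalars_finiteType ℂ R S
  have : Algebra.FiniteType S (S ⊗[R] S) := Algebra.FiniteType.baseChange S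
  have : Algebra.FiniteType ℂ (S ⊗[R] S) :=
    Algebra.FiniteType.trans (R := ℂ) (S := S) (A := S ⊗[R] S) ‹_› ‹_›
  have hnil : IsNilpotent (φ ⊗ₜ[R] (1 : S) - (1 : S) ⊗ₜ[R] φ) := by
    apply isNilpotent_of_forall_algHom
    intro ψ
    have := h (ψ.comp ((Algebra.TensorProduct.includeLeft : S →ₐ[R] S ⊗[R] S).restrictScalars ℂ))
      (ψ.comp ((Algebra.TensorProduct.includeRight : S →ₐ[R] S ⊗[R] S).restrictScalars ℂ)) ?_
    · simpa [sub_eq_zero] using this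
    · intro r hr
      have := Algebra.TensorProduct.tmul_one_eq_one_tmul (A := S) (B := S) (⟨r, hr⟩ : R)
      exact congrArg ψ this
  let L := FractionRing S
  have : FaithfulSMul R L := by
    rw [faithfulSMul_iff_algebraMap_injective]
    have : (algebraMap R L : R → L) = algebraMap S L ∘ (algebraMap R S) := by
      ext x; exact IsScalarTower.algebraMap_apply R S L x
    rw [this]
    exact (IsFractionRing.injective S L).comp Subtype.val_injective
  let K := FractionRing R
  let : Algebra K L := FractionRing.liftAlgebra R L
  have : CharZero K := charZero_of_injective_algebraMap (R := ℂ) (A := K) (algebraMap ℂ K).injective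
  have : IsScalarTower R K L := FractionRing.isScalarTower_liftAlgebra R L
  obtain ⟨a, b, hb, hab⟩ := exists_mul_eq_of_isNilpotent_tmul_sub (K := K) (L := L) φ hnil
  refine ⟨b, b.2, fun h => hb (Subtype.ext h), ?_⟩
  have hab' : (b : S) * φ = a := hab
  rw [hab']; exact a.2

end Field

namespace AffVar

/-- A function on `H` which becomes regular on a variety surjecting onto `H` is rational. -/
lemma exists_mul_mem_of_surjective {X H : Type} [AffVar X] [AffVar H] [IsDomain (reg X)]
    {f : X → H} (hf : IsReg f) (hs : Function.Surjective f) {φ : H → ℂ}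
    (hφ : (fun x => φ (f x)) ∈ reg X) :
    ∃ r ∈ reg H, r ≠ 0 ∧ (fun h => r h * φ h) ∈ reg H := by
  obtain ⟨_, ⟨r, rfl⟩, hr0, s, hs'⟩ := exists_mul_mem_of_forall_algHom hf.comap.range
    ⟨fun x => φ (f x), hφ⟩ (by
      intro ψ₁ ψ₂ h
      obtain ⟨x, hx⟩ := point ψ₁
      obtain ⟨y, hy⟩ := point ψ₂
      have : f x = f y := sep _ _ fun p hp => by
        have := h _ ⟨⟨p, hp⟩, rfl⟩
        rw [hx, hy] at this
        exact this
      rw [hx, hy]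
      exact congrArg φ this)
  refine ⟨r.1, r.2, fun h0 => hr0 ?_, ?_⟩
  · apply Subtype.ext; funext x
    exact congrFun h0 (f x)
  · have : (fun h => r.1 h * φ h) = s.1 := by
      funext h
      obtain ⟨x, rfl⟩ := hs h
      exact (congrFun (congrArg Subtype.val hs') x).symm
    rw [this]; exact s.2

lemma isDomain_of_surjective {X H : Type} [AffVar X] [AffVar H] [IsDomain (reg X)]
    {f : X → H} (hf : IsReg f) (hs : Function.Surjective f) : IsDomain (reg H) := by
  have : Function.Injective hf.comap := by
    intro p q h
    apply Subtype.ext; funext y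
    obtain ⟨x, rfl⟩ := hs y
    exact congrFun (congrArg Subtype.val h) x
  exact this.isDomain hf.comap

/-- A group homomorphism which becomes regular after pulling back along a surjective regular map
from an irreducible variety is itself regular. -/
theorem isReg_of_comp_surjective {X H K : Type} [AffVar X] [IsDomain (reg X)]
    [Group H] [AffGrp H] [Group K] [AffGrp K] {f : X → H} (hf : IsReg f)
    (hs : Function.Surjective f) (σ : H →* K) (hσ : IsReg (fun x => σ (f x))) : IsReg σ := by
  intro p hp
  have := isDomain_of_surjective hf hs
  obtain ⟨n, a, b, hab⟩ := exists_sum_of_mem_prod (AffGrp.mul_reg p hp)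
  choose r hr hr0 hrb using fun i =>
    exists_mul_mem_of_surjective hf hs (φ := fun h => (b i).1 (σ h)) (hσ _ (b i).2)
  let R : reg H := ∏ i, ⟨r i, hr i⟩
  have hR0 : R ≠ 0 := Finset.prod_ne_zero_iff.mpr fun i _ h => hr0 i (congrArg Subtype.val h)
  have hRb : ∀ i, (fun h => R.1 h * (b i).1 (σ h)) ∈ reg H := by
    intro i
    have : R = (∏ j ∈ Finset.univ.erase i, ⟨r j, hr j⟩) * ⟨r i, hr i⟩ :=
      (Finset.prod_erase_mul _ _ (Finset.mem_univ i)).symm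
    have h2 : (fun h => R.1 h * (b i).1 (σ h)) =
        (∏ j ∈ Finset.univ.erase i, (⟨r j, hr j⟩ : reg H)).1 *
          (fun h => r i h * (b i).1 (σ h)) := by
      funext h
      rw [this]
      simp only [Subalgebra.coe_mul, Pi.mul_apply]
      ring
    rw [h2]
    exact mul_mem (Subtype.prop _) (hrb i)
  let J : Ideal (reg H) :=
    { carrier := {s | (fun h => s.1 h * p (σ h)) ∈ reg H}
      add_mem' := fun {s t} hs ht => by
        change (fun h => (s + t).1 h * p (σ h)) ∈ reg H
        have : (fun h => (s + t).1 h * p (σ h)) =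
            (fun h => s.1 h * p (σ h)) + fun h => t.1 h * p (σ h) := by
          funext h; simp [add_mul]
        rw [this]
        exact add_mem (S := Subalgebra ℂ (H → ℂ)) hs ht
      zero_mem' := by simpa using const_mem (X := H) 0
      smul_mem' := fun c s hs => by
        change (fun h => (c * s).1 h * p (σ h)) ∈ reg H
        have : (fun h => (c * s).1 h * p (σ h)) = c.1 * fun h => s.1 h * p (σ h) := by
          funext h; simp [mul_assoc]
        rw [this]
        exact mul_mem c.2 hs }
  have hJ : J = ⊤ := by
    apply ideal_eq_top
    intro h₀
    have : ∃ x, R.1 x ≠ 0 := by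
      by_contra! hc
      exact hR0 (Subtype.ext (funext hc))
    obtain ⟨x, hx⟩ := this
    have ht : IsReg (fun h : H => (h₀ * x⁻¹)⁻¹ * h) := (isReg_const _).mul isReg_id
    refine ⟨⟨fun h => R.1 ((h₀ * x⁻¹)⁻¹ * h), ht _ R.2⟩, ?_, by simpa using hx⟩
    change (fun h => R.1 ((h₀ * x⁻¹)⁻¹ * h) * p (σ h)) ∈ reg H
    have : (fun h => R.1 ((h₀ * x⁻¹)⁻¹ * h) * p (σ h)) = fun h => ∑ i, (a i).1 (σ (h₀ * x⁻¹)) *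
        (R.1 ((h₀ * x⁻¹)⁻¹ * h) * (b i).1 (σ ((h₀ * x⁻¹)⁻¹ * h))) := by
      funext h
      have := hab (σ (h₀ * x⁻¹)) (σ ((h₀ * x⁻¹)⁻¹ * h))
      simp only [← map_mul, mul_inv_cancel_left] at this
      rw [this, Finset.mul_sum]
      refine Finset.sum_congr rfl fun i _ => ?_
      ring
    rw [this]
    exact sum_mem_reg _ fun i _ => mul_mem_reg (const_mem _) (ht _ (hRb i))
  have h1 : (1 : reg H) ∈ J := hJ ▸ trivial
  have : (fun h => (1 : reg H).1 h * p (σ h)) ∈ reg H := h1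
  simpa using this

end AffVar

/-! ### Irreducibility and identity components -/

namespace AffVar

section irreducible

variable {X Y : Type} [AffVar X] [AffVar Y]

lemma exists_ne_zero_and_ne_zero [IsDomain (reg X)] {p q : X → ℂ} (hp : p ∈ reg X) (hq : q ∈ reg X)
    (hp0 : p ≠ 0) (hq0 : q ≠ 0) : ∃ x, p x ≠ 0 ∧ q x ≠ 0 := by
  by_contra! h
  have h1 : (⟨p, hp⟩ * ⟨q, hq⟩ : reg X) = 0 := by
    apply Subtype.ext; funext x
    by_cases hx : p x = 0
    · simp [hx]
    · simp [h x hx]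
  rcases mul_eq_zero.mp h1 with h | h
  · exact hp0 (congrArg Subtype.val h)
  · exact hq0 (congrArg Subtype.val h)

lemma nonempty_of_isDomain [IsDomain (reg X)] : Nonempty X := by
  by_contra h
  rw [not_nonempty_iff] at h
  exact one_ne_zero (α := reg X) (Subtype.ext (funext fun x => h.elim x))

lemma isDomain_of_forall [Nonempty X]
    (h : ∀ p ∈ reg X, ∀ q ∈ reg X, p ≠ 0 → q ≠ 0 → ∃ x, p x ≠ 0 ∧ q x ≠ 0) : IsDomain (reg X) := by
  have : Nontrivial (reg X) := ⟨0, 1, fun h =>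
    zero_ne_one (congrFun (congrArg Subtype.val h) (Classical.arbitrary X))⟩
  have : NoZeroDivisors (reg X) := ⟨fun {p q} hpq => by
    by_contra! hc
    obtain ⟨x, hx, hx'⟩ := h p.1 p.2 q.1 q.2 (fun h => hc.1 (Subtype.ext h))
      (fun h => hc.2 (Subtype.ext h))
    have := congrFun (congrArg Subtype.val hpq) x
    exact mul_ne_zero hx hx' this⟩
  exact NoZeroDivisors.to_isDomain _

instance [IsDomain (reg X)] [IsDomain (reg Y)] : IsDomain (reg (X × Y)) := by
  have := nonempty_of_isDomain (X := X)
  have := nonempty_of_isDomain (X := Y)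
  apply isDomain_of_forall
  intro P hP Q hQ hP0 hQ0
  obtain ⟨⟨x₁, y₁⟩, h₁⟩ := Function.ne_iff.mp hP0
  obtain ⟨⟨x₂, y₂⟩, h₂⟩ := Function.ne_iff.mp hQ0
  obtain ⟨x, hx, hx'⟩ := exists_ne_zero_and_ne_zero (X := X)
    ((isReg_id.prodMk (isReg_const y₁)) P hP) ((isReg_id.prodMk (isReg_const y₂)) Q hQ)
    (Function.ne_iff.mpr ⟨x₁, h₁⟩) (Function.ne_iff.mpr ⟨x₂, h₂⟩)
  obtain ⟨y, hy, hy'⟩ := exists_ne_zero_and_ne_zero (X := Y)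
    (((isReg_const x).prodMk isReg_id) P hP) (((isReg_const x).prodMk isReg_id) Q hQ)
    (Function.ne_iff.mpr ⟨y₁, hx⟩) (Function.ne_iff.mpr ⟨y₂, hx'⟩)
  exact ⟨(x, y), hy, hy'⟩

lemma eq_univ_or_of_union [IsDomain (reg X)] {C D : Set X} (hC : IsZClosed C) (hD : IsZClosed D)
    (h : C ∪ D = Set.univ) : C = Set.univ ∨ D = Set.univ := by
  obtain ⟨S, hS, rfl⟩ := hC
  obtain ⟨T, hT, rfl⟩ := hD
  by_contra! hc
  simp only [ne_eq, Set.eq_univ_iff_forall, not_forall] at hc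
  obtain ⟨⟨x, hx⟩, y, hy⟩ := hc
  simp only [Set.mem_ofPred_eq, not_forall] at hx hy
  obtain ⟨p, hp, hpx⟩ := hx
  obtain ⟨q, hq, hqy⟩ := hy
  obtain ⟨z, hz, hz'⟩ := exists_ne_zero_and_ne_zero (hS hp) (hT hq)
    (Function.ne_iff.mpr ⟨x, hpx⟩) (Function.ne_iff.mpr ⟨y, hqy⟩)
  have : z ∈ ({x | ∀ p ∈ S, p x = 0} ∪ {x | ∀ p ∈ T, p x = 0} : Set X) := h ▸ trivial
  rcases this with h | h
  · exact hz (h p hp)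
  · exact hz' (h q hq)

/-- A regular map from an irreducible variety with finite image is constant. -/
lemma eq_of_finite_range [IsDomain (reg X)] {f : X → Y} (hf : IsReg f) (hfin : (Set.range f).Finite)
    (x x' : X) : f x = f x' := by
  have h1 : IsZClosed (f ⁻¹' {f x'}) := (isZClosed_singleton _).preimage hf
  have h2 : IsZClosed (f ⁻¹' (Set.range f \ {f x'})) := (isZClosed_of_finite hfin.sdiff).preimage hf
  rcases eq_univ_or_of_union h1 h2 (by ext z; simp) with h | h
  · exact (h ▸ trivial : x ∈ f ⁻¹' {f x'})
  · exact absurd (h ▸ trivial : x' ∈ f ⁻¹' (Set.range f \ {f x'})) (by simp)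

end irreducible

section zariski

open Topology

variable (X : Type) [AffVar X]

/-- The Zariski topology. -/
@[reducible] def zariski : TopologicalSpace X :=
  TopologicalSpace.induced
    (fun x => (⟨RingHom.ker (ev x), RingHom.ker_isPrime _⟩ : PrimeSpectrum (reg X))) inferInstance

lemma isClosed_zariski {C : Set X} : IsClosed[zariski X] C ↔ IsZClosed C := by
  rw [isClosed_induced_iff]
  constructor
  · rintro ⟨t, ht, rfl⟩
    obtain ⟨s, rfl⟩ := (PrimeSpectrum.isClosed_iff_zeroLocus _).mp ht
    refine ⟨Subtype.val '' s, ?_, ?_⟩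
    · rintro _ ⟨p, -, rfl⟩; exact p.2
    · ext x
      simp [PrimeSpectrum.mem_zeroLocus, Set.subset_def, RingHom.mem_ker]
  · rintro ⟨S, hS, rfl⟩
    refine ⟨PrimeSpectrum.zeroLocus {p | p.1 ∈ S}, PrimeSpectrum.isClosed_zeroLocus _, ?_⟩
    ext x
    simp only [PrimeSpectrum.mem_zeroLocus, Set.subset_def, Set.mem_preimage, Set.mem_ofPred_eq,
      SetLike.mem_coe, RingHom.mem_ker]
    exact ⟨fun h p hp => h ⟨p, hS hp⟩ hp, fun h p hp => h p.1 hp⟩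

variable {X}

lemma isDomain_ofClosed {C : Set X} (hC : IsZClosed C) (hi : @IsIrreducible X (zariski X) C) :
    letI := ofClosed hC; IsDomain (reg C) := by
  let _ := ofClosed hC
  let _ := zariski X
  have : Nonempty C := hi.1.to_subtype
  apply isDomain_of_forall
  rintro _ ⟨p, hp, rfl⟩ _ ⟨q, hq, rfl⟩ hp0 hq0
  by_contra! hc
  rcases isPreirreducible_iff_isClosed_union_isClosed.mp hi.2 {x | p x = 0} {x | q x = 0}
    ((isClosed_zariski X).mpr (isZClosed_eq_zero hp))
    ((isClosed_zariski X).mpr (isZClosed_eq_zero hq)) (fun x hx => by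
      by_cases h : p x = 0
      · exact Or.inl h
      · exact Or.inr (hc ⟨x, hx⟩ h)) with h | h
  · exact hp0 (funext fun x => h x.2)
  · exact hq0 (funext fun x => h x.2)

lemma continuous_zariski {Y : Type} [AffVar Y] {f : X → Y} (hf : IsReg f) :
    Continuous[zariski X, zariski Y] f := by
  let _ := zariski X
  let _ := zariski Y
  rw [continuous_iff_isClosed]
  intro C hC
  exact (isClosed_zariski X).mpr (((isClosed_zariski Y).mp hC).preimage hf)

open Pointwise in
/-- Every affine algebraic group has an irreducible closed normal subgroup of finite index. -/
theorem exists_identityComponent (H : Type) [Group H] [AffGrp H] :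
    ∃ N : Subgroup H, N.Normal ∧ N.FiniteIndex ∧ ∃ hN : IsZClosed (N : Set H),
      letI := ofClosed hN; IsDomain (reg N) := by
  let _ := zariski H
  have hnoeth : TopologicalSpace.NoetherianSpace H :=
    Topology.IsInducing.noetherianSpace (Topology.IsInducing.mk rfl)
  let comps := irreducibleComponents H
  have hfin : comps.Finite := TopologicalSpace.NoetherianSpace.finite_irreducibleComponents
  have hirr : ∀ (g : H) (V : Set H), IsIrreducible V → IsIrreducible (g • V) := by
    intro g V hV
    exact hV.image _ (continuous_zariski ((isReg_const g).mul isReg_id)).continuousOn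
  have hsmul : ∀ (g : H) (V : Set H), V ∈ comps → g • V ∈ comps := by
    intro g V hV
    refine ⟨hirr g V hV.1, fun W hW hVW => ?_⟩
    have h1 : V ⊆ g⁻¹ • W := by rwa [Set.subset_smul_set_iff, inv_inv]
    have h2 := hV.2 (hirr g⁻¹ W hW) h1
    have h3 : g⁻¹ • W ⊆ V := h2
    rwa [Set.smul_set_subset_iff_subset_inv_smul_set, inv_inv] at h3
  let N : Subgroup H := ⨅ V : comps, MulAction.stabilizer H V.1
  have hmem : ∀ n, n ∈ N ↔ ∀ V ∈ comps, n • V = V := by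
    intro n; simp [N, Subgroup.mem_iInf, MulAction.mem_stabilizer_iff]
  have hcl : ∀ V ∈ comps, IsZClosed V := fun V hV =>
    (isClosed_zariski H).mp (isClosed_of_mem_irreducibleComponents V hV)
  have hNormal : N.Normal := by
    refine ⟨fun n hn g => (hmem _).mpr fun V hV => ?_⟩
    rw [mul_smul, mul_smul, (hmem n).mp hn _ (hsmul g⁻¹ V hV), smul_inv_smul]
  have hFI : N.FiniteIndex := by
    have : Finite comps := hfin
    refine Subgroup.finiteIndex_iInf fun V => ⟨?_⟩
    rw [MulAction.index_stabilizer]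
    have hsub : MulAction.orbit H V.1 ⊆ comps := by
      rintro _ ⟨g, rfl⟩; exact hsmul g _ V.2
    exact ((Set.ncard_pos (hfin.subset hsub)).mpr ⟨V.1, MulAction.mem_orbit_self _⟩).ne'
  have hNcl : IsZClosed (N : Set H) := by
    have : (N : Set H) = ⋂ V : comps, ⋂ v : V.1,
        ({x | x * v.1 ∈ V.1} ∩ {x | x⁻¹ * v.1 ∈ V.1}) := by
      ext x
      simp only [SetLike.mem_coe, hmem, Set.mem_iInter, Set.mem_inter_iff, Set.mem_ofPred_eq]
      constructor
      · intro h V v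
        have h' : x⁻¹ • V.1 = V.1 := by rw [inv_smul_eq_iff, h V.1 V.2]
        exact ⟨by simpa [h V.1 V.2] using Set.smul_mem_smul_set (a := x) v.2,
          by simpa [h'] using Set.smul_mem_smul_set (a := x⁻¹) v.2⟩
      · intro h V hV
        apply Set.Subset.antisymm
        · rintro _ ⟨v, hv, rfl⟩; exact (h ⟨V, hV⟩ ⟨v, hv⟩).1
        · intro v hv
          rw [Set.mem_smul_set_iff_inv_smul_mem]
          exact (h ⟨V, hV⟩ ⟨v, hv⟩).2
    rw [this]
    refine isZClosed_iInter fun V => isZClosed_iInter fun v => ?_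
    exact ((hcl _ V.2).preimage (isReg_id.mul (isReg_const v.1))).inter
      ((hcl _ V.2).preimage (isReg_id.inv.mul (isReg_const v.1)))
  refine ⟨N, hNormal, hFI, hNcl, isDomain_ofClosed hNcl ?_⟩
  obtain ⟨V, hV, h1V⟩ := exists_mem_irreducibleComponents_subset_of_isIrreducible
    ({1} : Set H) isIrreducible_singleton
  have h1V : (1 : H) ∈ V := h1V rfl
  have hNV : (N : Set H) ⊆ V := fun n hn => by
    have := Set.smul_mem_smul_set (a := n) h1V
    rwa [(hmem n).mp hn V hV, smul_eq_mul, mul_one] at this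
  have hVN : V ⊆ N := by
    have : Finite (H ⧸ N) := Subgroup.finite_quotient_of_finiteIndex
    have := Fintype.ofFinite (H ⧸ N)
    classical
    obtain ⟨z, hz, hVz⟩ := isIrreducible_iff_sUnion_isClosed.mp hV.1
      (Finset.univ.image (fun c : H ⧸ N => {x : H | (x : H ⧸ N) = c})) (by
        intro z hz
        obtain ⟨c, -, rfl⟩ := Finset.mem_image.mp hz
        obtain ⟨g, rfl⟩ := QuotientGroup.mk_surjective c
        rw [isClosed_zariski]
        convert hNcl.preimage ((isReg_const g⁻¹).mul (isReg_id (X := H))) using 1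
        ext x
        exact eq_comm.trans QuotientGroup.eq)
      (fun x _ => ⟨_, Finset.mem_coe.mpr (Finset.mem_image_of_mem _ (Finset.mem_univ (x : H ⧸ N))),
        rfl⟩)
    obtain ⟨c, -, rfl⟩ := Finset.mem_image.mp hz
    intro x hx
    have hxc : (x : H ⧸ N) = c := hVz hx
    have h1c : ((1 : H) : H ⧸ N) = c := hVz h1V
    have := hxc.trans h1c.symm
    exact (QuotientGroup.eq_one_iff x).mp this
  rw [hNV.antisymm hVN]
  exact hV.1

lemma isZClosed_compl_subgroup {H : Type} [Group H] [AffGrp H] {N : Subgroup H} [N.FiniteIndex]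
    (hN : IsZClosed (N : Set H)) : IsZClosed ((N : Set H)ᶜ) := by
  have : Finite (H ⧸ N) := Subgroup.finite_quotient_of_finiteIndex
  have key : ∀ s : Set (H ⧸ N), IsZClosed {x : H | (x : H ⧸ N) ∈ s} := by
    intro s
    induction s, s.toFinite using Set.Finite.induction_on with
    | empty => exact isZClosed_of_finite (by simp)
    | @insert c s _ _ ih =>
      have : {x : H | (x : H ⧸ N) ∈ insert c s} =
        {x : H | (x : H ⧸ N) = c} ∪ {x : H | (x : H ⧸ N) ∈ s} := by ext; simp
      rw [this]
      refine IsZClosed.union ?_ ih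
      obtain ⟨g, rfl⟩ := QuotientGroup.mk_surjective c
      convert hN.preimage ((isReg_const g⁻¹).mul (isReg_id (X := H))) using 1
      ext x
      exact eq_comm.trans QuotientGroup.eq
  convert key {((1 : H) : H ⧸ N)}ᶜ using 1
  ext x
  simp only [Set.mem_compl_iff, SetLike.mem_coe, Set.mem_singleton_iff, Set.mem_ofPred_eq]
  rw [eq_comm (a := (x : H ⧸ N)), QuotientGroup.eq]; simp

/-- A connected affine algebraic group is irreducible. -/
theorem isDomain_of_connected {H : Type} [Group H] [AffGrp H]
    (h : ∀ C D : Set H, IsZClosed C → IsZClosed D → C ∪ D = Set.univ → C ∩ D = ∅ →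
      C = Set.univ ∨ D = Set.univ) : IsDomain (reg H) := by
  obtain ⟨N, _, _, hN, hdom⟩ := exists_identityComponent H
  have hNtop : (N : Set H) = Set.univ := by
    rcases h _ _ hN (isZClosed_compl_subgroup hN) (Set.union_compl_self _)
      (Set.inter_compl_self _) with h | h
    · exact h
    · exact absurd (h ▸ trivial : (1 : H) ∈ (N : Set H)ᶜ) (by simp [one_mem])
  let _ := ofClosed hN
  exact isDomain_of_surjective (isReg_val hN)
    (fun x => ⟨⟨x, hNtop ▸ trivial⟩, rfl⟩)

end zariski

end AffVar

/-! ### Dominant maps, the power map, and countable avoidance -/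

namespace AffVar

section power

variable {H : Type} [Group H] [AffGrp H]

/-- The comorphism of the `m`-th power map. -/
def powComap (H : Type) [Group H] [AffGrp H] (m : ℕ) : reg H →ₐ[ℂ] reg H :=
  ((isReg_id (X := H)).pow m).comap

lemma powComap_apply (m : ℕ) (p : reg H) (x : H) : (powComap H m p).1 x = p.1 (x ^ m) := rfl

lemma powComap_sub_mem (m : ℕ) (p : reg H) (hp : p ∈ RingHom.ker (ev (1 : H))) :
    powComap H m p - (m : reg H) * p ∈ (RingHom.ker (ev (1 : H))) ^ 2 := by
  have hp1 : p.1 1 = 0 := hp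
  obtain ⟨n, a, b, hab⟩ := exists_sum_of_mem_prod (AffGrp.mul_reg p.1 p.2)
  dsimp only at hab
  induction m with
  | zero =>
    have : powComap H 0 p - ((0 : ℕ) : reg H) * p = 0 := by
      apply Subtype.ext; funext x
      simp [powComap_apply, hp1]
    rw [this]; exact zero_mem _
  | succ m ih =>
    let a' : Fin n → reg H := fun i => powComap H m (a i) - algebraMap ℂ _ ((a i).1 1)
    let b' : Fin n → reg H := fun i => b i - algebraMap ℂ _ ((b i).1 1)
    have key : powComap H (m + 1) p - ((m + 1 : ℕ) : reg H) * p
        = (powComap H m p - (m : reg H) * p) + ∑ i, a' i * b' i := by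
      apply Subtype.ext; funext x
      have h1 : p.1 (x ^ (m + 1)) = ∑ i, (a i).1 (x ^ m) * (b i).1 x := by rw [pow_succ, hab]
      have h2 : p.1 (x ^ m) = ∑ i, (a i).1 (x ^ m) * (b i).1 1 := by rw [← hab, mul_one]
      have h3 : p.1 x = ∑ i, (a i).1 1 * (b i).1 x := by rw [← hab, one_mul]
      have h4 : (0 : ℂ) = ∑ i, (a i).1 1 * (b i).1 1 := by rw [← hab, one_mul, hp1]
      have h5 : (∑ i, a' i * b' i : reg H).1 x =
          ∑ i, ((a i).1 (x ^ m) - (a i).1 1) * ((b i).1 x - (b i).1 1) := by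
        have := map_sum (ev x) (fun i => a' i * b' i) Finset.univ
        simp only [ev_apply] at this
        rw [this]; rfl
      have h6 : (∑ i, a' i * b' i : reg H).1 x = p.1 (x ^ (m + 1)) - p.1 (x ^ m) - p.1 x := by
        rw [h5, h1, h2, h3, ← sub_zero (_ - _ - _), ← neg_zero, h4, sub_neg_eq_add,
          ← Finset.sum_sub_distrib, ← Finset.sum_sub_distrib, ← Finset.sum_add_distrib]
        exact Finset.sum_congr rfl fun i _ => by ring
      have h7 : ∀ k : ℕ, ((k : reg H) * p).1 x = k * p.1 x := fun k => by
        simp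
      change p.1 (x ^ (m + 1)) - (((m + 1 : ℕ) : reg H) * p).1 x =
        (p.1 (x ^ m) - ((m : reg H) * p).1 x) + (∑ i, a' i * b' i : reg H).1 x
      rw [h6, h7, h7]
      push_cast; ring
    rw [key]
    refine add_mem ih (sum_mem fun i _ => ?_)
    rw [pow_two]
    refine Ideal.mul_mem_mul ?_ ?_
    · change (a i).1 (1 ^ m) - (a i).1 1 = 0
      simp
    · change (b i).1 1 - (b i).1 1 = 0
      simp

lemma powComap_mem_pow (m i : ℕ) (p : reg H) (hp : p ∈ (RingHom.ker (ev (1 : H))) ^ i) :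
    powComap H m p ∈ (RingHom.ker (ev (1 : H))) ^ i := by
  have h : (RingHom.ker (ev (1 : H))).map (powComap H m) ≤ RingHom.ker (ev (1 : H)) := by
    rw [Ideal.map_le_iff_le_comap]
    intro p hp
    change p.1 (1 ^ m) = 0
    rw [one_pow]; exact hp
  have h2 := Ideal.mem_map_of_mem (powComap H m) hp
  rw [Ideal.map_pow] at h2
  exact Ideal.pow_right_mono h i h2

lemma powComap_sub_mem_pow (m i : ℕ) (p : reg H) (hp : p ∈ (RingHom.ker (ev (1 : H))) ^ i) :
    powComap H m p - (m : reg H) ^ i * p ∈ (RingHom.ker (ev (1 : H))) ^ (i + 1) := by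
  induction i generalizing p with
  | zero =>
    simp only [pow_zero, one_mul, zero_add, pow_one]
    change p.1 (1 ^ m) - p.1 1 = 0
    simp
  | succ i ih =>
    rw [pow_succ] at hp
    refine Submodule.mul_induction_on hp (fun a ha b hb => ?_) (fun a b ha hb => ?_)
    · have h1 := Ideal.mul_mem_mul (powComap_mem_pow m i a ha) (powComap_sub_mem m b hb)
      rw [← pow_add] at h1
      have h2 := Ideal.mul_mem_mul (ih a ha) hb
      rw [← pow_succ] at h2
      have h3 := add_mem h1 (Ideal.mul_mem_left _ (m : reg H) h2)
      convert h3 using 1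
      rw [map_mul]; ring
    · convert add_mem ha hb using 1
      rw [map_add]; ring

/-- In a connected group the `m`-th powers are dense. -/
theorem eq_zero_of_pow [IsDomain (reg H)] {m : ℕ} (hm : m ≠ 0) {p : H → ℂ} (hp : p ∈ reg H)
    (h : ∀ x, p (x ^ m) = 0) : p = 0 := by
  have h0 : powComap H m ⟨p, hp⟩ = 0 := Subtype.ext (funext h)
  have hmem : ∀ i, (⟨p, hp⟩ : reg H) ∈ (RingHom.ker (ev (1 : H))) ^ i := by
    intro i
    induction i with
    | zero => simp
    | succ i ih =>
      have h1 := powComap_sub_mem_pow m i _ ih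
      rw [h0, zero_sub, neg_mem_iff] at h1
      have h2 := Ideal.mul_mem_left _ (algebraMap ℂ (reg H) ((m : ℂ) ^ i)⁻¹) h1
      have h3 : (m : reg H) = algebraMap ℂ (reg H) (m : ℂ) := by simp
      rw [h3, ← map_pow, ← mul_assoc, ← map_mul, inv_mul_cancel₀ (by positivity), map_one,
        one_mul] at h2
      exact h2
  have hbot := Ideal.iInf_pow_eq_bot_of_isDomain (RingHom.ker (ev (1 : H))) (RingHom.ker_ne_top _)
  have : (⟨p, hp⟩ : reg H) ∈ (⊥ : Ideal (reg H)) := by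
    rw [← hbot]; exact (Ideal.mem_iInf).mpr hmem
  exact congrArg Subtype.val ((Submodule.mem_bot _).mp this)

end power

section dominant

/-- The image of a dominant regular map contains a nonempty principal open set. -/
theorem exists_open_subset_range {X Y : Type} [AffVar X] [AffVar Y] [IsDomain (reg X)]
    [IsDomain (reg Y)] {f : X → Y} (hf : IsReg f) (hdom : ∀ p ∈ reg Y, (∀ x, p (f x) = 0) → p = 0) :
    ∃ r ∈ reg Y, r ≠ 0 ∧ ∀ y, r y ≠ 0 → ∃ x, f x = y := by
  let φ : reg Y →+* reg X := hf.comap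
  have hinj : Function.Injective φ := by
    refine (injective_iff_map_eq_zero φ).mpr fun p hp => Subtype.ext (hdom p.1 p.2 fun x => ?_)
    exact congrFun (congrArg Subtype.val hp) x
  have hft : φ.FiniteType := by
    have h : (hf.comap.comp (Algebra.ofId ℂ (reg Y))).FiniteType := by
      rw [Subsingleton.elim (hf.comap.comp (Algebra.ofId ℂ (reg Y))) (Algebra.ofId ℂ (reg X))]
      exact (RingHom.finiteType_algebraMap (A := ℂ) (B := reg X)).mpr inferInstance
    exact AlgHom.FiniteType.of_comp_finiteType h
  have hfp : φ.FinitePresentation := RingHom.FinitePresentation.of_finiteType.mp hft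
  obtain ⟨S, hS⟩ := PrimeSpectrum.exists_constructibleSetData_iff.mpr
    (PrimeSpectrum.isConstructible_range_comap hfp)
  have hbot : (⊥ : PrimeSpectrum (reg Y)) ∈ S.toSet := by
    rw [hS]
    refine ⟨⊥, PrimeSpectrum.ext ?_⟩
    change Ideal.comap φ ⊥ = ⊥
    rw [← RingHom.ker_eq_comap_bot]
    exact (RingHom.injective_iff_ker_eq_bot φ).mp hinj
  simp only [PrimeSpectrum.ConstructibleSetData.toSet, Set.mem_iUnion] at hbot
  obtain ⟨C, hCS, hC1, hC2⟩ := hbot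
  have hg : ∀ i, C.g i = 0 := fun i => by
    have : C.g i ∈ (⊥ : Ideal (reg Y)) := hC1 ⟨i, rfl⟩
    exact (Submodule.mem_bot _).mp this
  have hf0 : C.f ≠ 0 := fun h => hC2 (by
    rw [PrimeSpectrum.mem_zeroLocus]; simp [h])
  refine ⟨C.f.1, C.f.2, fun h => hf0 (Subtype.ext h), fun y hy => ?_⟩
  have hmem : (⟨RingHom.ker (ev y), RingHom.ker_isPrime _⟩ : PrimeSpectrum (reg Y)) ∈ S.toSet := by
    refine Set.mem_iUnion₂.mpr ⟨C, hCS, ?_, ?_⟩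
    · rintro _ ⟨i, rfl⟩
      rw [hg]; exact zero_mem _
    · intro h
      exact hy (h rfl)
  rw [hS] at hmem
  obtain ⟨P, hP⟩ := hmem
  obtain ⟨M, hM, hPM⟩ := Ideal.exists_le_maximal P.asIdeal P.2.ne_top
  obtain ⟨ψ, hψ⟩ := exists_algHom_ker_eq M
  obtain ⟨x, hx⟩ := AffVar.point ψ
  refine ⟨x, sep _ _ fun p hp => ?_⟩
  have h1 : (⟨p, hp⟩ - algebraMap ℂ _ (p y) : reg Y) ∈ (P.comap φ).asIdeal := by
    rw [hP]
    change p y - p y = 0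
    simp
  have h2 : φ (⟨p, hp⟩ - algebraMap ℂ _ (p y)) ∈ M := hPM h1
  have h3 := (hx _).symm.trans ((hψ _).mpr h2)
  exact sub_eq_zero.mp h3

/-- A dominant regular map to a group generates the group in two steps. -/
theorem exists_mul_of_dominant {X H : Type} [AffVar X] [Group H] [AffGrp H] [IsDomain (reg X)]
    [IsDomain (reg H)] {f : X → H} (hf : IsReg f)
    (hdom : ∀ p ∈ reg H, (∀ x, p (f x) = 0) → p = 0) (y : H) : ∃ x x', y = f x * (f x')⁻¹ := by
  obtain ⟨r, hr, hr0, hr'⟩ := exists_open_subset_range hf hdom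
  obtain ⟨z, hz⟩ := Function.ne_iff.mp hr0
  obtain ⟨w, hw, hw'⟩ := exists_ne_zero_and_ne_zero hr
    (((isReg_const y⁻¹).mul (isReg_id (X := H))) r hr) hr0
    (Function.ne_iff.mpr ⟨y * z, by simpa using hz⟩)
  have hr2 : ∃ w, r w ≠ 0 ∧ r (y * w) ≠ 0 := by
    exact ⟨y⁻¹ * w, hw', by simpa using hw⟩
  obtain ⟨w, hw, hw'⟩ := hr2
  obtain ⟨x, hx⟩ := hr' _ hw'
  obtain ⟨x', hx'⟩ := hr' _ hw
  exact ⟨x, x', by rw [hx, hx', mul_inv_cancel_right]⟩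

/-- A homomorphism to a connected group whose image contains all `m`-th powers is onto. -/
theorem surjective_of_pow_mem_range {B C : Type} [Group B] [AffGrp B] [Group C] [AffGrp C]
    [IsDomain (reg B)] [IsDomain (reg C)] (f : B →* C) (hf : IsReg f) {m : ℕ} (hm : m ≠ 0)
    (h : ∀ c, c ^ m ∈ f.range) : Function.Surjective f := by
  intro y
  obtain ⟨x, x', hx⟩ := exists_mul_of_dominant hf (fun p hp hp0 => eq_zero_of_pow hm hp fun c => by
    obtain ⟨b, hb⟩ := h c
    rw [← hb]; exact hp0 b) y
  exact ⟨x * x'⁻¹, by simp [hx]⟩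

end dominant

section avoidance

/-- A `ℂ`-algebra of countable dimension which is a field is `ℂ`. -/
lemma algebraMap_bijective_of_countable {σ K : Type} [Countable σ] [Field K] [Algebra ℂ K]
    (φ : MvPolynomial σ ℂ →ₐ[ℂ] K) (hφ : Function.Surjective φ) :
    Function.Bijective (algebraMap ℂ K) := by
  have halg : Algebra.IsAlgebraic ℂ K := by
    refine ⟨fun x => ?_⟩
    by_contra hx
    have h1 := (Transcendental.linearIndependent_sub_inv hx).cardinal_le_rank
    have h2 := LinearMap.rank_le_of_surjective φ.toLinearMap hφ
    rw [MvPolynomial.rank_eq] at h2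
    have h3 : Cardinal.mk (σ →₀ ℕ) ≤ Cardinal.aleph0 := Cardinal.mk_le_aleph0_iff.mpr inferInstance
    have h4 := (h1.trans h2).trans h3
    rw [Cardinal.mk_complex] at h4
    exact absurd h4 (not_le.mpr Cardinal.aleph0_lt_continuum)
  exact IsAlgClosed.algebraMap_bijective_of_isIntegral

/-- The Nullstellensatz for countably generated `ℂ`-algebras. -/
lemma exists_algHom_of_countable {σ B : Type} [Countable σ] [CommRing B] [Nontrivial B]
    [Algebra ℂ B] (φ : MvPolynomial σ ℂ →ₐ[ℂ] B) (hφ : Function.Surjective φ) :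
    Nonempty (B →ₐ[ℂ] ℂ) := by
  obtain ⟨M, hM⟩ := Ideal.exists_maximal B
  let : Field (B ⧸ M) := Ideal.Quotient.field M
  have hbij := algebraMap_bijective_of_countable ((Ideal.Quotient.mkₐ ℂ M).comp φ)
    ((Ideal.Quotient.mkₐ_surjective ℂ M).comp hφ)
  let e : ℂ ≃ₐ[ℂ] (B ⧸ M) := AlgEquiv.ofBijective (Algebra.ofId ℂ _) hbij
  exact ⟨(e.symm : (B ⧸ M) →ₐ[ℂ] ℂ).comp (Ideal.Quotient.mkₐ ℂ M)⟩

/-- An irreducible complex variety is not a countable union of proper closed subsets. -/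
theorem exists_forall_ne_zero {X : Type} [AffVar X] [IsDomain (reg X)] (p : ℕ → X → ℂ)
    (hp : ∀ i, p i ∈ reg X) (hp0 : ∀ i, p i ≠ 0) : ∃ x, ∀ i, p i x ≠ 0 := by
  obtain ⟨s, hs⟩ := AffVar.fg (X := X)
  let K := FractionRing (reg X)
  have hsmem : ∀ a : s, a.1 ∈ reg X := fun a => by
    have := Algebra.subset_adjoin (R := ℂ) a.2
    rwa [hs] at this
  let φ : MvPolynomial (s ⊕ ℕ) ℂ →ₐ[ℂ] K := aeval (Sum.elim
    (fun a => algebraMap (reg X) K ⟨a.1, hsmem a⟩) (fun i => (algebraMap (reg X) K ⟨p i, hp i⟩)⁻¹))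
  have hrange : ∀ a : reg X, algebraMap (reg X) K a ∈ φ.range := by
    rintro ⟨a, ha⟩
    have ha' := ha
    change a ∈ AffVar.functions at ha'
    rw [← hs] at ha'
    induction ha' using Algebra.adjoin_induction with
    | mem x hx => exact ⟨MvPolynomial.X (Sum.inl ⟨x, hx⟩), by simp [φ]⟩
    | algebraMap c => exact φ.range.algebraMap_mem c
    | add x y hx hy ihx ihy =>
      rw [hs] at hx hy
      have := add_mem (ihx hx) (ihy hy)
      rw [← map_add] at this
      exact this
    | mul x y hx hy ihx ihy =>
      rw [hs] at hx hy
      have := mul_mem (ihx hx) (ihy hy)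
      rw [← map_mul] at this
      exact this
  obtain ⟨ε⟩ := exists_algHom_of_countable φ.rangeRestrict φ.rangeRestrict_surjective
  let ι : reg X →ₐ[ℂ] φ.range := (IsScalarTower.toAlgHom ℂ (reg X) K).codRestrict φ.range hrange
  let ψ : reg X →ₐ[ℂ] ℂ := ε.comp ι
  obtain ⟨x, hx⟩ := AffVar.point ψ
  refine ⟨x, fun i h0 => ?_⟩
  let inv : φ.range :=
    ⟨(algebraMap (reg X) K ⟨p i, hp i⟩)⁻¹, ⟨MvPolynomial.X (Sum.inr i), by simp [φ]⟩⟩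
  have hinv : ι ⟨p i, hp i⟩ * inv = 1 := by
    apply Subtype.ext
    change algebraMap (reg X) K ⟨p i, hp i⟩ * (algebraMap (reg X) K ⟨p i, hp i⟩)⁻¹ = 1
    refine mul_inv_cancel₀ fun h => hp0 i ?_
    have := (FaithfulSMul.algebraMap_injective (reg X) K) (h.trans (map_zero _).symm)
    exact congrArg Subtype.val this
  have h1 : ψ ⟨p i, hp i⟩ = 0 := (hx _).trans h0
  have h2 := congrArg ε hinv
  rw [map_mul, map_one] at h2
  change ψ ⟨p i, hp i⟩ * _ = 1 at h2
  rw [h1, zero_mul] at h2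
  exact zero_ne_one h2

end avoidance

end AffVar

/-! ### Exponential polynomials -/

section exponentialPolynomial

open Polynomial fwdDiff

/-- The shift operator on sequences. -/
def seqShift : Module.End ℂ (ℕ → ℂ) := LinearMap.funLeft ℂ ℂ Nat.succ

lemma seqShift_sub_pow (μ : ℂ) (k : ℕ) (F : ℕ → ℂ) :
    ((seqShift - μ • (1 : Module.End ℂ (ℕ → ℂ))) ^ k) (fun n => μ ^ n * F n) =
      fun n => μ ^ (n + k) * ((Δ_[1])^[k] F) n := by
  induction k generalizing F with
  | zero => rfl
  | succ k ih =>
    rw [pow_succ, Module.End.mul_apply]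
    have : (seqShift - μ • (1 : Module.End ℂ (ℕ → ℂ))) (fun n => μ ^ n * F n) =
        fun n => μ ^ n * (μ * Δ_[1] F n) := by
      funext n
      simp only [seqShift, LinearMap.sub_apply, LinearMap.smul_apply, Module.End.one_apply,
        Pi.sub_apply, LinearMap.funLeft_apply, Pi.smul_apply, smul_eq_mul, fwdDiff,
        Nat.succ_eq_add_one]
      ring
    rw [this, ih]
    funext n
    have h2 : (fun n => μ * Δ_[1] F n) = μ • Δ_[1] F := rfl
    rw [h2, fwdDiff_iter_const_smul, Function.iterate_succ_apply, Pi.smul_apply, smul_eq_mul]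
    ring

lemma fwdDiff_iter_natCast (f : ℂ → ℂ) (k : ℕ) :
    ((Δ_[1])^[k] (fun n : ℕ => f n)) = fun n : ℕ => ((Δ_[(1 : ℂ)])^[k] f) n := by
  induction k generalizing f with
  | zero => rfl
  | succ k ih =>
    rw [Function.iterate_succ_apply, Function.iterate_succ_apply, ← ih]
    congr 1
    funext n
    simp [fwdDiff]

lemma expPoly_mem_maxGenEigenspace (μ : ℂ) (Q : ℂ[X]) :
    (fun n : ℕ => μ ^ n * Q.eval (n : ℂ)) ∈ seqShift.maxGenEigenspace μ := by
  rw [Module.End.mem_maxGenEigenspace]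
  refine ⟨Q.natDegree + 1, ?_⟩
  rw [seqShift_sub_pow, fwdDiff_iter_natCast (fun x => Q.eval x)]
  funext n
  rw [Polynomial.fwdDiff_iter_eq_zero_of_degree_lt (Nat.lt_succ_self _)]
  simp

/-- Exponential polynomials with distinct frequencies are linearly independent. -/
lemma expPoly_eq_zero {ι : Type*} (s : Finset ι) (μ : ι → ℂ) (hμ : Function.Injective μ)
    (hμ0 : ∀ i, μ i ≠ 0) (Q : ι → ℂ[X])
    (h : ∀ n : ℕ, ∑ i ∈ s, μ i ^ n * (Q i).eval (n : ℂ) = 0) : ∀ i ∈ s, Q i = 0 := by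
  have hind := (Module.End.independent_maxGenEigenspace seqShift).comp hμ
  intro i hi
  have hsum : ∑ i ∈ s, (fun n : ℕ => μ i ^ n * (Q i).eval (n : ℂ)) = 0 := by
    funext n
    simpa using h n
  have := (iSupIndep_iff_finsetSum_eq_zero_imp_eq_zero _).mp hind s _
    (fun i _ => expPoly_mem_maxGenEigenspace (μ i) (Q i)) hsum i hi
  refine Polynomial.eq_zero_of_infinite_isRoot _
    (Set.Infinite.mono ?_ (Set.infinite_range_of_injective (Nat.cast_injective (R := ℂ))))
  rintro _ ⟨n, rfl⟩
  have := congrFun this n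
  simpa [hμ0 i] using this

lemma exists_expPoly {V : Type*} [AddCommGroup V] [Module ℂ V] (R : Module.End ℂ V) {μ : ℂ}
    (hμ : μ ≠ 0) {p : V} (hp : p ∈ R.maxGenEigenspace μ) (φ : V →ₗ[ℂ] ℂ) :
    ∃ Q : ℂ[X], ∀ n : ℕ, φ ((R ^ n) p) = μ ^ n * Q.eval (n : ℂ) := by
  obtain ⟨k, hk⟩ := (Module.End.mem_maxGenEigenspace _ _ _).mp hp
  set D := R - μ • (1 : Module.End ℂ V) with hD
  refine ⟨∑ j ∈ Finset.range k, Polynomial.C ((μ ^ j)⁻¹ * φ ((D ^ j) p) * ((j.factorial : ℂ))⁻¹) *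
    descPochhammer ℂ j, fun n => ?_⟩
  have hR : R = D + μ • (1 : Module.End ℂ V) := by rw [hD]; abel
  have hcomm : Commute D (μ • (1 : Module.End ℂ V)) :=
    (Commute.one_right D).smul_right μ
  have hDz : ∀ j, k ≤ j → (D ^ j) p = 0 := fun j hj => by
    rw [← Nat.sub_add_cancel hj, pow_add, Module.End.mul_apply, hk, map_zero]
  have h1 : φ ((R ^ n) p) =
      ∑ j ∈ Finset.range (n + 1), μ ^ (n - j) * n.choose j * φ ((D ^ j) p) := by
    rw [hR, hcomm.add_pow, LinearMap.sum_apply, map_sum]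
    refine Finset.sum_congr rfl fun j _ => ?_
    rw [_root_.smul_pow, one_pow, Module.End.mul_apply, Module.End.mul_apply]
    have : ((n.choose j : ℕ) : Module.End ℂ V) p = (n.choose j : ℂ) • p := by
      rw [Module.End.natCast_apply, Nat.cast_smul_eq_nsmul]
    rw [this]
    simp
    ring
  have h2 : ∀ j ∈ Finset.range (n + 1), μ ^ (n - j) * n.choose j * φ ((D ^ j) p) =
      μ ^ n * ((μ ^ j)⁻¹ * φ ((D ^ j) p) * n.choose j) := by
    intro j hj
    rw [pow_sub₀ _ hμ (Finset.mem_range_succ_iff.mp hj)]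
    ring
  rw [h1, Finset.sum_congr rfl h2, ← Finset.mul_sum, Polynomial.eval_finsetSum]
  congr 1
  have h3 : ∀ j, (μ ^ j)⁻¹ * φ ((D ^ j) p) * (n.choose j : ℂ) =
      (Polynomial.C ((μ ^ j)⁻¹ * φ ((D ^ j) p) * ((j.factorial : ℂ))⁻¹) *
        descPochhammer ℂ j).eval (n : ℂ) := by
    intro j
    rw [Polynomial.eval_mul, Polynomial.eval_C, descPochhammer_eval_eq_descFactorial,
      Nat.descFactorial_eq_factorial_mul_choose]
    have := Nat.cast_ne_zero (R := ℂ).mpr j.factorial_ne_zero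
    push_cast
    field_simp
  simp_rw [← h3]
  have h4 : ∀ N, n + 1 ≤ N →
      ∑ j ∈ Finset.range (n + 1), (μ ^ j)⁻¹ * φ ((D ^ j) p) * (n.choose j : ℂ)
      = ∑ j ∈ Finset.range N, (μ ^ j)⁻¹ * φ ((D ^ j) p) * (n.choose j : ℂ) := fun N hN =>
    Finset.sum_subset (Finset.range_mono hN) fun j _ hj => by
      rw [Nat.choose_eq_zero_of_lt (by simpa using hj)]; simp
  have h5 : ∀ N, k ≤ N → ∑ j ∈ Finset.range k, (μ ^ j)⁻¹ * φ ((D ^ j) p) * (n.choose j : ℂ)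
      = ∑ j ∈ Finset.range N, (μ ^ j)⁻¹ * φ ((D ^ j) p) * (n.choose j : ℂ) := fun N hN =>
    Finset.sum_subset (Finset.range_mono hN) fun j _ hj => by
      rw [hDz j (by simpa using hj)]; simp
  rw [h4 _ (le_max_left (n + 1) k), h5 _ (le_max_right (n + 1) k)]

/-- A finite family of units becomes free after raising to a power. -/
lemma exists_independent_units {ι : Type*} [Fintype ι] (lam : ι → ℂˣ) :
    ∃ (m : ℕ) (_ : m ≠ 0) (a : ℕ) (β : Fin a → ℂˣ) (e : ι → Fin a → ℤ),
      (∀ x : Fin a → ℤ, ∏ j, β j ^ x j = 1 → x = 0) ∧ ∀ i, lam i ^ m = ∏ j, β j ^ e i j := by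
  let N : Submodule ℤ (Additive ℂˣ) := Submodule.span ℤ (Set.range fun i => Additive.ofMul (lam i))
  have : Module.Finite ℤ N := Module.Finite.span_of_finite ℤ (Set.finite_range _)
  let b := Module.finBasis ℤ (N ⧸ Submodule.torsion ℤ N)
  choose β hβ using fun j => Submodule.Quotient.mk_surjective (Submodule.torsion ℤ N) (b j)
  let l : ι → N := fun i => ⟨Additive.ofMul (lam i), Submodule.subset_span ⟨i, rfl⟩⟩
  let c : ι → _ → ℤ := fun i => b.repr (Submodule.Quotient.mk (l i))
  have hc : ∀ i, l i - ∑ j, c i j • β j ∈ Submodule.torsion ℤ N := fun i => by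
    rw [← Submodule.Quotient.mk_eq_zero, Submodule.Quotient.mk_sub, sub_eq_zero]
    have h1 := (b.sum_repr (Submodule.Quotient.mk (l i))).symm
    rw [h1]
    have h2 := map_sum (Submodule.mkQ (Submodule.torsion ℤ N)) (fun j => c i j • β j) Finset.univ
    simp only [map_smul, Submodule.mkQ_apply, hβ] at h2
    exact h2.symm
  choose t ht using hc
  let m : ℤ := ∏ i, (t i : ℤ)
  have hm0 : m ≠ 0 := Finset.prod_ne_zero_iff.mpr fun i _ => nonZeroDivisors.ne_zero (t i).2
  have hm : ∀ i, m • l i = ∑ j, (m * c i j) • β j := fun i => by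
    obtain ⟨d, hd⟩ : (t i : ℤ) ∣ m := Finset.dvd_prod_of_mem _ (Finset.mem_univ i)
    have h1 : m • (l i - ∑ j, c i j • β j) = 0 := by
      rw [hd, mul_comm, mul_smul]
      have := ht i
      rw [Submonoid.smul_def] at this
      rw [this, smul_zero]
    rw [smul_sub, sub_eq_zero, Finset.smul_sum] at h1
    simpa only [mul_smul] using h1
  refine ⟨m.natAbs, Int.natAbs_ne_zero.mpr hm0, _, fun j => (β j).1.toMul,
    fun i j => m.sign * (m * c i j), ?_, fun i => ?_⟩
  · intro x hx
    have h1 : ∑ j, x j • β j = 0 := by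
      apply Subtype.ext
      apply Additive.toMul.injective
      simpa using hx
    have h2 : ∑ j, x j • b j = 0 := by
      have := map_sum (Submodule.mkQ (Submodule.torsion ℤ N)) (fun j => x j • β j) Finset.univ
      simp only [map_smul, Submodule.mkQ_apply, hβ] at this
      rw [← this, h1]; rfl
    funext j
    exact Fintype.linearIndependent_iff.mp b.linearIndependent x h2 j
  · have h1 : (m.sign * m) • l i = ∑ j, (m.sign * (m * c i j)) • β j := by
      rw [mul_smul, hm, Finset.smul_sum]
      simp only [mul_smul]
    rw [Int.sign_mul_self_eq_abs, Int.abs_eq_natAbs] at h1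
    rw [natCast_zsmul] at h1
    have h2 := congrArg (fun z : N => z.1.toMul) h1
    change lam i ^ m.natAbs = _ at h2
    simpa using h2

end exponentialPolynomial

namespace AffVar

/-! ### Translations -/

section translation

variable {H : Type} [Group H] [AffGrp H]

/-- Right translation of regular functions. -/
def rTrans (g : H) : reg H →ₐ[ℂ] reg H := ((isReg_id (X := H)).mul (isReg_const g)).comap

@[simp] lemma rTrans_apply (g : H) (p : reg H) (x : H) : (rTrans g p).1 x = p.1 (x * g) := rfl

lemma rTrans_mul (g h : H) (p : reg H) : rTrans (g * h) p = rTrans g (rTrans h p) :=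
  Subtype.ext (funext fun x => by simp [mul_assoc])

lemma rTrans_one (p : reg H) : rTrans (1 : H) p = p := Subtype.ext (funext fun x => by simp)

lemma rTrans_pow_apply (g : H) (n : ℕ) (p : reg H) :
    ((rTrans g).toLinearMap ^ n) p = rTrans (g ^ n) p := by
  induction n with
  | zero => simp [rTrans_one]
  | succ n ih => rw [pow_succ', Module.End.mul_apply, ih, pow_succ', rTrans_mul]; rfl

/-- The span of the right translates of a regular function. -/
def translates (p : reg H) : Submodule ℂ (reg H) := Submodule.span ℂ (Set.range fun g => rTrans g p)

lemma mem_translates (p : reg H) : p ∈ translates p :=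
  Submodule.subset_span ⟨1, rTrans_one p⟩

lemma rTrans_mem_translates (p : reg H) (g : H) {w : reg H} (hw : w ∈ translates p) :
    rTrans g w ∈ translates p := by
  induction hw using Submodule.span_induction with
  | mem x hx =>
    obtain ⟨h, rfl⟩ := hx
    exact Submodule.subset_span ⟨g * h, rTrans_mul g h p⟩
  | zero => rw [map_zero]; exact zero_mem _
  | add x y _ _ hx hy => rw [map_add]; exact add_mem hx hy
  | smul c x _ hx => rw [map_smul]; exact Submodule.smul_mem _ c hx

instance (p : reg H) : FiniteDimensional ℂ (translates p) := by
  obtain ⟨n, a, b, hab⟩ := exists_sum_of_mem_prod (AffGrp.mul_reg p.1 p.2)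
  have hle : translates p ≤ Submodule.span ℂ (Set.range a) := by
    refine Submodule.span_le.mpr ?_
    rintro _ ⟨g, rfl⟩
    have : rTrans g p = ∑ i, (b i).1 g • a i := by
      apply Subtype.ext; funext x
      have h1 := map_sum (ev x) (fun i => (b i).1 g • a i) Finset.univ
      simp only [ev_apply] at h1
      rw [h1]
      exact (hab x g).trans (Finset.sum_congr rfl fun i _ => mul_comm _ _)
    change rTrans g p ∈ _
    rw [this]
    exact sum_mem fun i _ => Submodule.smul_mem _ _ (Submodule.subset_span ⟨i, rfl⟩)
  have : FiniteDimensional ℂ (Submodule.span ℂ (Set.range a)) :=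
    FiniteDimensional.span_of_finite ℂ (Set.finite_range a)
  exact Submodule.finiteDimensional_of_le hle

lemma iSup_maxGenEigenspace_rTrans (g : H) :
    ⨆ μ, Module.End.maxGenEigenspace (rTrans g).toLinearMap μ = ⊤ := by
  rw [eq_top_iff]
  intro p _
  let R : Module.End ℂ (reg H) := (rTrans g).toLinearMap
  have hR : ∀ w ∈ translates p, R w ∈ translates p := fun w hw => rTrans_mem_translates p g hw
  let R' : Module.End ℂ (translates p) := LinearMap.restrict R hR
  have htop := Module.End.iSup_maxGenEigenspace_eq_top (K := ℂ) (V := translates p) R'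
  have hp : (⟨p, mem_translates p⟩ : translates p) ∈
      ⨆ μ, Module.End.maxGenEigenspace R' μ := htop ▸ Submodule.mem_top
  have h2 := Submodule.mem_map_of_mem (f := (translates p).subtype) hp
  rw [Submodule.map_iSup] at h2
  refine SetLike.le_def.mp (iSup_mono fun μ => ?_) h2
  rw [Submodule.map_le_iff_le_comap]
  exact (Module.End.genEigenspace_restrict R _ ⊤ μ hR).le

lemma exists_expPoly_pow (g : H) (p : reg H) :
    ∃ (r : ℕ) (μ : Fin r → ℂˣ) (Q : Fin r → Polynomial ℂ),
      ∀ n : ℕ, p.1 (g ^ n) = ∑ i, (μ i : ℂ) ^ n * (Q i).eval (n : ℂ) := by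
  have hp : p ∈ ⨆ μ, Module.End.maxGenEigenspace (rTrans g).toLinearMap μ :=
    iSup_maxGenEigenspace_rTrans g ▸ Submodule.mem_top
  refine Submodule.iSup_induction _ (motive := fun p : reg H => ∃ (r : ℕ) (μ : Fin r → ℂˣ)
    (Q : Fin r → Polynomial ℂ), ∀ n : ℕ, p.1 (g ^ n) = ∑ i, (μ i : ℂ) ^ n * (Q i).eval (n : ℂ))
    hp ?_ ⟨0, Fin.elim0, Fin.elim0, fun n => by simp⟩ ?_
  · intro μ q hq
    by_cases hμ : μ = 0
    · have : q = 0 := by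
        subst hμ
        obtain ⟨k, hk⟩ := (Module.End.mem_maxGenEigenspace _ _ _).mp hq
        have hsub : (rTrans g).toLinearMap - (0 : ℂ) • (1 : Module.End ℂ (reg H)) =
            (rTrans g).toLinearMap := by
          rw [zero_smul]; exact sub_zero (G := Module.End ℂ (reg H)) _
        rw [hsub, rTrans_pow_apply] at hk
        have h2 := congrArg (rTrans (g ^ k)⁻¹) hk
        rwa [← rTrans_mul, inv_mul_cancel, rTrans_one, map_zero] at h2
      exact ⟨0, Fin.elim0, Fin.elim0, fun n => by simp [this]⟩
    · obtain ⟨Q, hQ⟩ := exists_expPoly _ hμ hq (ev (1 : H)).toLinearMap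
      refine ⟨1, fun _ => Units.mk0 μ hμ, fun _ => Q, fun n => ?_⟩
      have := hQ n
      rw [rTrans_pow_apply] at this
      simpa using this
  · rintro q q' ⟨r, μ, Q, h⟩ ⟨r', μ', Q', h'⟩
    refine ⟨r + r', Fin.append μ μ', Fin.append Q Q', fun n => ?_⟩
    rw [Fin.sum_univ_add]
    simp only [Fin.append_left, Fin.append_right, ← h, ← h']
    rfl

end translation

/-! ### The line and tori -/

section torus

instance : AffVar ℂ where
  functions := Algebra.adjoin ℂ {fun z => z}
  fg := ⟨{fun z => z}, by simp⟩
  sep x y h := h _ (Algebra.subset_adjoin rfl)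
  point ψ := by
    refine ⟨ψ ⟨fun z => z, Algebra.subset_adjoin rfl⟩, fun p => ?_⟩
    have : ψ = (Pi.evalAlgHom ℂ (fun _ : ℂ => ℂ) _).comp (Subalgebra.val _) :=
      AlgHom.adjoin_ext (φ₂ := (Pi.evalAlgHom ℂ (fun _ : ℂ => ℂ)
        (ψ ⟨fun z => z, Algebra.subset_adjoin rfl⟩)).comp (Subalgebra.val _)) (by
        rintro x rfl; rfl)
    exact DFunLike.congr_fun this p

lemma id_mem_reg : (fun z : ℂ => z) ∈ reg ℂ := Algebra.subset_adjoin rfl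

lemma polynomial_mem_reg (Q : Polynomial ℂ) : (fun z : ℂ => Q.eval z) ∈ reg ℂ := by
  have : (fun z : ℂ => Q.eval z) = Polynomial.aeval (fun z : ℂ => z) Q := by
    funext z
    simp [Polynomial.aeval_def]
  rw [this]
  exact Polynomial.aeval_mem_adjoin_singleton ℂ _

lemma exists_polynomial_of_mem_reg {p : ℂ → ℂ} (hp : p ∈ reg ℂ) :
    ∃ Q : Polynomial ℂ, ∀ z, p z = Q.eval z := by
  change p ∈ Algebra.adjoin ℂ {fun z : ℂ => z} at hp
  rw [Algebra.adjoin_singleton_eq_range_aeval] at hp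
  obtain ⟨Q, rfl⟩ := hp
  exact ⟨Q, fun z => by simp [Polynomial.aeval_def]⟩

/-- The monomial characters of a torus. -/
def monomialHom (a : ℕ) : Multiplicative (Fin a → ℤ) →* ((Fin a → ℂˣ) → ℂ) where
  toFun e u := ((∏ j, u j ^ (e.toAdd j) : ℂˣ) : ℂ)
  map_one' := by funext u; simp
  map_mul' e e' := by
    funext u
    simp [zpow_add, Finset.prod_mul_distrib]

lemma monomialHom_single {a : ℕ} (j : Fin a) (u : Fin a → ℂˣ) :
    monomialHom a (.ofAdd (Pi.single j 1)) u = u j := by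
  simp only [monomialHom, MonoidHom.coe_mk, OneHom.coe_mk, toAdd_ofAdd]
  congr 1
  rw [Finset.prod_eq_single j]
  · simp
  · intro i _ hi; simp [hi]
  · simp

instance (a : ℕ) : AffVar (Fin a → ℂˣ) where
  functions := (AddMonoidAlgebra.lift ℂ ((Fin a → ℂˣ) → ℂ) (Fin a → ℤ) (monomialHom a)).range
  fg := by
    have : Algebra.FiniteType ℂ (AddMonoidAlgebra ℂ (Fin a → ℤ)) := inferInstance
    rw [Subalgebra.fg_iff_finiteType]
    exact Algebra.FiniteType.of_surjective (AlgHom.rangeRestrict _)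
      (AlgHom.rangeRestrict_surjective _)
  sep u v h := by
    funext j
    apply Units.ext
    rw [← monomialHom_single, ← monomialHom_single]
    exact h _ ⟨AddMonoidAlgebra.of ℂ _ (.ofAdd (Pi.single j 1)), by simp⟩
  point ψ := by
    let L := AddMonoidAlgebra.lift ℂ ((Fin a → ℂˣ) → ℂ) (Fin a → ℤ) (monomialHom a)
    let ψ' : AddMonoidAlgebra ℂ (Fin a → ℤ) →ₐ[ℂ] ℂ := ψ.comp L.rangeRestrict
    let χ : Multiplicative (Fin a → ℤ) →* ℂˣ :=
      ((ψ' : AddMonoidAlgebra ℂ (Fin a → ℤ) →* ℂ).comp (AddMonoidAlgebra.of ℂ _)).toHomUnits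
    let u : Fin a → ℂˣ := fun j => χ (.ofAdd (Pi.single j 1))
    have hχ : ∀ e : Fin a → ℤ, χ (.ofAdd e) = ∏ j, u j ^ e j := by
      intro e
      have he : e = ∑ j, e j • Pi.single j (1 : ℤ) := by
        funext i; simp [Finset.sum_apply, Pi.single_apply]
      conv_lhs => rw [he, ofAdd_sum, map_prod]
      exact Finset.prod_congr rfl fun j _ => by rw [ofAdd_zsmul, map_zpow]
    refine ⟨u, fun p => ?_⟩
    obtain ⟨P, hP⟩ := L.rangeRestrict_surjective p
    have key : ψ' = (Pi.evalAlgHom ℂ (fun _ : Fin a → ℂˣ => ℂ) u).comp L := by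
      refine AddMonoidAlgebra.algHom_ext (fun e => ?_) (Subsingleton.elim _ _)
      have h1 : ψ' (AddMonoidAlgebra.single e 1) = (χ (.ofAdd e) : ℂ) := rfl
      rw [h1, hχ]
      simp [L, monomialHom]
    rw [← hP]
    exact DFunLike.congr_fun key P

lemma monomial_mem_reg {a : ℕ} (e : Fin a → ℤ) :
    (fun u : Fin a → ℂˣ => ((∏ j, u j ^ e j : ℂˣ) : ℂ)) ∈ reg (Fin a → ℂˣ) := by
  refine ⟨AddMonoidAlgebra.of ℂ (Fin a → ℤ) (Multiplicative.ofAdd e), ?_⟩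
  ext u
  simp [monomialHom]

lemma exists_monomial_sum {a : ℕ} {p : (Fin a → ℂˣ) → ℂ} (hp : p ∈ reg (Fin a → ℂˣ)) :
    ∃ c : (Fin a → ℤ) →₀ ℂ, ∀ u, p u = c.sum fun e b => b * ((∏ j, u j ^ e j : ℂˣ) : ℂ) := by
  obtain ⟨P, rfl⟩ := hp
  refine ⟨P.coeff, fun u => ?_⟩
  change AddMonoidAlgebra.lift ℂ _ _ (monomialHom a) P u = _
  rw [AddMonoidAlgebra.lift_apply, Finsupp.sum, Finset.sum_apply]
  rfl

/-- Points `(β ^ n, n)` are dense in the product of a torus and the line. -/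
lemma eq_zero_of_forall_pow {a : ℕ} {β : Fin a → ℂˣ}
    (hβ : ∀ x : Fin a → ℤ, ∏ j, β j ^ x j = 1 → x = 0) {P : (Fin a → ℂˣ) × ℂ → ℂ}
    (hP : P ∈ reg ((Fin a → ℂˣ) × ℂ)) (h : ∀ n : ℕ, P (β ^ n, n) = 0) : P = 0 := by
  classical
  obtain ⟨N, A, B, hAB⟩ := exists_sum_of_mem_prod hP
  choose c hc using fun i => exists_monomial_sum (A i).2
  choose Q hQ using fun i => exists_polynomial_of_mem_reg (B i).2
  let S : Finset (Fin a → ℤ) := Finset.univ.biUnion fun i => (c i).support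
  let q : (Fin a → ℤ) → Polynomial ℂ := fun e => ∑ i, Polynomial.C (c i e) * Q i
  have hform : ∀ u t, P (u, t) = ∑ e ∈ S, ((∏ j, u j ^ e j : ℂˣ) : ℂ) * (q e).eval t := by
    intro u t
    rw [hAB]
    have h1 : ∀ i, (A i).1 u * (B i).1 t = ∑ e ∈ S, ((∏ j, u j ^ e j : ℂˣ) : ℂ) *
        (c i e * (Q i).eval t) := by
      intro i
      rw [hc, hQ, Finsupp.sum_of_support_subset (s := S), Finset.sum_mul]
      · exact Finset.sum_congr rfl fun e _ => by ring
      · exact fun e he => Finset.mem_biUnion.mpr ⟨i, Finset.mem_univ i, he⟩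
      · simp
    simp_rw [h1]
    rw [Finset.sum_comm]
    refine Finset.sum_congr rfl fun e _ => ?_
    rw [← Finset.mul_sum]
    simp [q, Polynomial.eval_finsetSum]
  have hinj : Function.Injective fun e : Fin a → ℤ => ((∏ j, β j ^ e j : ℂˣ) : ℂ) := by
    intro e e' hee
    have h1 : ∏ j, β j ^ e j = ∏ j, β j ^ e' j := Units.ext hee
    have h2 := hβ (e - e') (by simp [zpow_sub, Finset.prod_mul_distrib, h1])
    exact sub_eq_zero.mp h2
  have hq := expPoly_eq_zero S _ hinj (fun e => Units.ne_zero _) q fun n => by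
    rw [← h n, hform]
    refine Finset.sum_congr rfl fun e _ => ?_
    congr 1
    simp only [Pi.pow_apply, ← Units.val_pow_eq_pow_val]
    congr 1
    rw [← Finset.prod_pow]
    exact Finset.prod_congr rfl fun j _ => by rw [← zpow_natCast, ← zpow_natCast, zpow_comm]
  funext ⟨u, t⟩
  rw [hform]
  exact Finset.sum_eq_zero fun e he => by simp [hq e he]

end torus

/-- Some power of an element of an affine algebraic group lies on a regular image of a product of
a torus and a line through the identity. -/
theorem exists_torus_through_pow {H : Type} [Group H] [AffGrp H] (g : H) :
    ∃ (m : ℕ) (_ : m ≠ 0) (a : ℕ) (T : (Fin a → ℂˣ) × ℂ → H) (x₀ x₁ : (Fin a → ℂˣ) × ℂ),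
      IsReg T ∧ T x₀ = 1 ∧ T x₁ = g ^ m := by
  obtain ⟨s, hs⟩ := AffVar.fg (X := H)
  have hsmem : ∀ q : s, q.1 ∈ reg H := fun q => by
    have := Algebra.subset_adjoin (R := ℂ) q.2
    rwa [hs] at this
  choose r μ Q hQ using fun q : s => exists_expPoly_pow g ⟨q.1, hsmem q⟩
  obtain ⟨m, hm, a, β, e, hβ, he⟩ := exists_independent_units
    (fun i : (Σ q : s, Fin (r q)) => μ i.1 i.2)
  have hgen : ∀ p : reg H, ∃ P : reg ((Fin a → ℂˣ) × ℂ),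
      ∀ n : ℕ, p.1 ((g ^ m) ^ n) = P.1 (β ^ n, n) := by
    rintro ⟨p, hp⟩
    change p ∈ AffVar.functions at hp
    rw [← hs] at hp
    induction hp using Algebra.adjoin_induction with
    | mem x hx =>
      let P : (Fin a → ℂˣ) × ℂ → ℂ := fun z => ∑ i, ((∏ j, z.1 j ^ e ⟨⟨x, hx⟩, i⟩ j : ℂˣ) : ℂ) *
        ((Q ⟨x, hx⟩ i).comp (Polynomial.C (m : ℂ) * Polynomial.X)).eval z.2
      refine ⟨⟨P, sum_mem_reg _ fun i _ => mul_mem_reg (isReg_fst _ (monomial_mem_reg _))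
        (isReg_snd _ (polynomial_mem_reg _))⟩, fun n => ?_⟩
      have h1 := hQ ⟨x, hx⟩ (m * n)
      dsimp only at h1
      change x ((g ^ m) ^ n) = P (β ^ n, n)
      rw [← pow_mul, h1]
      refine Finset.sum_congr rfl fun i _ => ?_
      congr 1
      · rw [pow_mul, ← Units.val_pow_eq_pow_val, he ⟨⟨x, hx⟩, i⟩, ← Units.val_pow_eq_pow_val,
          ← Finset.prod_pow]
        congr 1
        exact Finset.prod_congr rfl fun j _ => by
          change _ = (β j ^ n) ^ _
          rw [← zpow_natCast, ← zpow_natCast, zpow_comm]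
      · simp
    | algebraMap c => exact ⟨algebraMap ℂ _ c, fun n => rfl⟩
    | add x y hx hy ihx ihy =>
      rw [hs] at hx hy
      obtain ⟨P, hP⟩ := ihx hx
      obtain ⟨P', hP'⟩ := ihy hy
      exact ⟨P + P', fun n => congrArg₂ (· + ·) (hP n) (hP' n)⟩
    | mul x y hx hy ihx ihy =>
      rw [hs] at hx hy
      obtain ⟨P, hP⟩ := ihx hx
      obtain ⟨P', hP'⟩ := ihy hy
      exact ⟨P * P', fun n => congrArg₂ (· * ·) (hP n) (hP' n)⟩
  choose F hF using hgen
  have huniq : ∀ P P' : reg ((Fin a → ℂˣ) × ℂ), (∀ n : ℕ, P.1 (β ^ n, n) = P'.1 (β ^ n, n)) →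
      P = P' := by
    intro P P' h
    refine sub_eq_zero.mp (Subtype.ext (eq_zero_of_forall_pow hβ (P - P').2 fun n => ?_))
    exact sub_eq_zero.mpr (h n)
  let ψ : reg H →ₐ[ℂ] reg ((Fin a → ℂˣ) × ℂ) :=
    { toFun := F
      map_one' := huniq _ _ fun n => (hF _ n).symm
      map_mul' := fun p q => huniq _ _ fun n =>
        (hF _ n).symm.trans (congrArg₂ (· * ·) (hF p n) (hF q n))
      map_zero' := huniq _ _ fun n => (hF _ n).symm
      map_add' := fun p q => huniq _ _ fun n =>
        (hF _ n).symm.trans (congrArg₂ (· + ·) (hF p n) (hF q n))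
      commutes' := fun c => huniq _ _ fun n => (hF _ n).symm }
  obtain ⟨T, hT, hTψ⟩ := exists_of_algHom ψ
  refine ⟨m, hm, a, T, (β ^ 0, ((0 : ℕ) : ℂ)), (β ^ 1, ((1 : ℕ) : ℂ)), hT, ?_, ?_⟩
  · refine sep _ _ fun p hp => ?_
    have h1 := hTψ ⟨p, hp⟩ (β ^ 0, ((0 : ℕ) : ℂ))
    have h2 := hF ⟨p, hp⟩ 0
    rw [pow_zero] at h2
    exact h1.trans h2.symm
  · refine sep _ _ fun p hp => ?_
    have h1 := hTψ ⟨p, hp⟩ (β ^ 1, ((1 : ℕ) : ℂ))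
    have h2 := hF ⟨p, hp⟩ 1
    rw [pow_one (g ^ m)] at h2
    exact h1.trans h2.symm

/-! ### Curve connectedness -/

section curves

variable {X Y : Type} [AffVar X] [AffVar Y]

/-- Any two points lie on a common entire curve. -/
def CurveConnected (X : Type) [AffVar X] : Prop :=
  ∀ x y : X, ∃ c : ℂ → X, c 0 = x ∧ c 1 = y ∧ ∀ p ∈ reg X, Differentiable ℂ fun t => p (c t)

lemma CurveConnected.prod (hX : CurveConnected X) (hY : CurveConnected Y) :
    CurveConnected (X × Y) := by
  rintro ⟨x, y⟩ ⟨x', y'⟩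
  obtain ⟨c, hc0, hc1, hc⟩ := hX x x'
  obtain ⟨d, hd0, hd1, hd⟩ := hY y y'
  refine ⟨fun t => (c t, d t), by simp [hc0, hd0], by simp [hc1, hd1], fun p hp => ?_⟩
  obtain ⟨n, a, b, hab⟩ := exists_sum_of_mem_prod hp
  simp only [hab]
  exact Differentiable.fun_sum fun i _ => (hc _ (a i).2).mul (hd _ (b i).2)

lemma curveConnected_line : CurveConnected ℂ := by
  intro x y
  refine ⟨fun t => x + t * (y - x), by simp, by simp, fun p hp => ?_⟩
  obtain ⟨Q, hQ⟩ := exists_polynomial_of_mem_reg hp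
  simp only [hQ]
  exact Q.differentiable.comp (by fun_prop)

lemma curveConnected_torus (a : ℕ) : CurveConnected (Fin a → ℂˣ) := by
  intro x y
  let l : Fin a → ℂ := fun j => Complex.log ((y j / x j : ℂˣ) : ℂ)
  have hl : ∀ j, Complex.exp (l j) = ((y j / x j : ℂˣ) : ℂ) := fun j =>
    Complex.exp_log (Units.ne_zero _)
  refine ⟨fun t j => x j * Units.mk0 (Complex.exp (t * l j)) (Complex.exp_ne_zero _), ?_, ?_,
    fun p hp => ?_⟩
  · funext j; apply Units.ext; simp
  · funext j; apply Units.ext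
    simp only [one_mul, Units.val_mul, Units.val_mk0, hl]
    rw [← Units.val_mul, mul_div_cancel]
  · obtain ⟨c, hc⟩ := exists_monomial_sum hp
    simp only [hc, Finsupp.sum]
    refine Differentiable.fun_sum fun e _ => Differentiable.const_mul ?_ _
    have : ∀ t : ℂ, ((∏ j, (x j * Units.mk0 (Complex.exp (t * l j)) (Complex.exp_ne_zero _)) ^ e j :
        ℂˣ) : ℂ) = ∏ j, ((x j : ℂ) ^ e j * Complex.exp (e j * (t * l j))) := by
      intro t
      rw [Units.coe_prod]
      refine Finset.prod_congr rfl fun j _ => ?_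
      rw [mul_zpow, Units.val_mul, Units.val_zpow_eq_zpow_val, Units.val_zpow_eq_zpow_val,
        Units.val_mk0, Complex.exp_int_mul]
    simp only [this]
    fun_prop

lemma CurveConnected.isDomain [Nonempty X] (hX : CurveConnected X) : IsDomain (reg X) := by
  refine isDomain_of_forall fun p hp q hq hp0 hq0 => ?_
  obtain ⟨x, hx⟩ := Function.ne_iff.mp hp0
  obtain ⟨y, hy⟩ := Function.ne_iff.mp hq0
  obtain ⟨c, hc0, hc1, hc⟩ := hX x y
  by_contra! h
  have han : ∀ r ∈ reg X, AnalyticOnNhd ℂ (fun t => r (c t)) Set.univ := fun r hr =>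
    (hc r hr).differentiableOn.analyticOnNhd isOpen_univ
  have hz := AnalyticOnNhd.eq_zero_or_eq_zero_of_mul_eq_zero (han p hp) (han q hq) (fun t _ => by
    by_cases hpt : p (c t) = 0
    · simp [hpt]
    · simp [h _ hpt]) isPreconnected_univ
  rcases hz with hz | hz
  · exact hx (by simpa [hc0] using hz 0 trivial)
  · exact hy (by simpa [hc1] using hz 1 trivial)

end curves

/-- Irreducible affine algebraic groups are connected by entire curves. -/
theorem curveConnected_of_isDomain {H : Type} [Group H] [AffGrp H] [IsDomain (reg H)] :
    CurveConnected H := by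
  let S : Set (Ideal (reg H)) := {I | ∃ (X : Type) (_ : AffVar X) (f : X → H) (hf : IsReg f)
    (x₀ : X), CurveConnected X ∧ f x₀ = 1 ∧ I = RingHom.ker hf.comap}
  have hne : S.Nonempty := ⟨_, ℂ, inferInstance, fun _ => 1, isReg_const 1, 0,
    curveConnected_line, rfl, rfl⟩
  have hprime : ∀ I ∈ S, I.IsPrime := by
    rintro I ⟨X, _, f, hf, x₀, hX, -, rfl⟩
    have : Nonempty X := ⟨x₀⟩
    have := hX.isDomain
    exact RingHom.ker_isPrime _
  obtain ⟨I, hI, hmin⟩ := (InvImage.wf (Ideal.height (R := reg H)) wellFounded_lt).has_min S hne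
  have hmin' : ∀ J ∈ S, J ≤ I → J = I := by
    intro J hJ hle
    by_contra hJI
    have hlt := lt_of_le_of_ne hle hJI
    have := hprime I hI
    have := hprime J hJ
    have h1 := Ideal.height_add_one_le_of_lt_of_isPrime hlt
    refine hmin J hJ (lt_of_lt_of_le ?_ h1)
    exact ENat.lt_add_one_iff (Ideal.height_ne_top this.ne_top) |>.mpr le_rfl
  obtain ⟨X, _, f, hf, x₀, hX, hx₀, rfl⟩ := hI
  have hker : ∀ p : reg H, (∀ x, p.1 (f x) = 0) → p = 0 := by
    intro p hp
    have hpow : ∀ g : H, ∃ m : ℕ, p.1 (g ^ (m + 1)) = 0 := by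
      intro g
      obtain ⟨m, hm, a, T, y₀, y₁, hT, hT0, hT1⟩ := exists_torus_through_pow g
      have hf' : IsReg fun z : X × ((Fin a → ℂˣ) × ℂ) => f z.1 * T z.2 :=
        (hf.comp isReg_fst).mul (hT.comp isReg_snd)
      have hJ := hmin' (RingHom.ker hf'.comap) ⟨_, _, _, hf', (x₀, y₀),
        hX.prod ((curveConnected_torus a).prod curveConnected_line), by simp [hx₀, hT0], rfl⟩ (by
          intro q hq
          have hq' := Subtype.ext_iff.mp (RingHom.mem_ker.mp hq)
          refine RingHom.mem_ker.mpr (Subtype.ext (funext fun x => ?_))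
          have := congrFun hq' (x, y₀)
          simpa [hT0] using this)
      have hpI : p ∈ RingHom.ker hf.comap :=
        RingHom.mem_ker.mpr (Subtype.ext (funext fun x => hp x))
      rw [← hJ] at hpI
      have := congrFun (Subtype.ext_iff.mp (RingHom.mem_ker.mp hpI)) (x₀, y₁)
      refine ⟨m - 1, ?_⟩
      rw [Nat.sub_add_cancel (Nat.one_le_iff_ne_zero.mpr hm)]
      simpa [hx₀, hT1] using this
    by_contra hp0
    obtain ⟨x, hx⟩ := exists_forall_ne_zero (fun n x => p.1 (x ^ (n + 1)))
      (fun n => (isReg_id.pow (n + 1)) _ p.2) (fun n h0 => hp0 (Subtype.ext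
        (eq_zero_of_pow (Nat.succ_ne_zero n) p.2 fun x => congrFun h0 x)))
    obtain ⟨m, hm⟩ := hpow x
    exact hx m hm
  have hone : ∀ y : H, ∃ c : ℂ → H, c 0 = 1 ∧ c 1 = y ∧
      ∀ p ∈ reg H, Differentiable ℂ fun t => p (c t) := by
    intro y
    have : Nonempty X := ⟨x₀⟩
    have := hX.isDomain
    obtain ⟨x, x', rfl⟩ := exists_mul_of_dominant hf
      (fun p hp h => Subtype.ext_iff.mp (hker ⟨p, hp⟩ h)) y
    obtain ⟨c, hc0, hc1, hc⟩ := hX x' x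
    refine ⟨fun t => f (c t) * (f x')⁻¹, by simp [hc0], by simp [hc1], fun p hp => ?_⟩
    exact hc (fun z => p (f z * (f x')⁻¹)) ((hf.mul (isReg_const _)) p hp)
  intro x y
  obtain ⟨c, hc0, hc1, hc⟩ := hone (x⁻¹ * y)
  refine ⟨fun t => x * c t, by simp [hc0], by simp [hc1], fun p hp => ?_⟩
  exact hc (fun z => p (x * z)) (((isReg_const x).mul isReg_id) p hp)

/-! ### The Euclidean topology -/

section euclid

variable {X Y : Type} [AffVar X] [AffVar Y]

/-- The coarsest topology for which all regular functions are continuous. -/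
@[reducible] def euclid (X : Type) [AffVar X] : TopologicalSpace X :=
  TopologicalSpace.induced (fun x (p : reg X) => p.1 x) inferInstance

/-- The topology is the one induced by the regular functions. -/
class IsEuclid (X : Type) [AffVar X] [TopologicalSpace X] : Prop where
  inducing : Topology.IsInducing fun (x : X) (p : reg X) => p.1 x

lemma isEuclid_euclid : @IsEuclid X _ (euclid X) :=
  @IsEuclid.mk X _ (euclid X) (@Topology.IsInducing.mk X _ (euclid X) _ _ rfl)

variable [TopologicalSpace X] [IsEuclid X] [TopologicalSpace Y] [IsEuclid Y]

lemma continuous_iff_reg {T : Type*} [TopologicalSpace T] {f : T → X} :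
    Continuous f ↔ ∀ p ∈ reg X, Continuous fun t => p (f t) := by
  rw [IsEuclid.inducing.continuous_iff, continuous_pi_iff]
  exact ⟨fun h p hp => h ⟨p, hp⟩, fun h p => h p.1 p.2⟩

lemma continuous_of_mem_reg {p : X → ℂ} (hp : p ∈ reg X) : Continuous p :=
  continuous_iff_reg.mp continuous_id p hp

lemma IsReg.continuous {f : X → Y} (hf : IsReg f) : Continuous f :=
  continuous_iff_reg.mpr fun p hp => continuous_of_mem_reg (hf p hp)

lemma continuous_of_prod_mem_reg {p : X × Y → ℂ} (hp : p ∈ reg (X × Y)) : Continuous p := by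
  obtain ⟨n, a, b, hab⟩ := exists_sum_of_mem_prod hp
  have : p = fun z => ∑ i, (a i).1 z.1 * (b i).1 z.2 := funext fun z => hab z.1 z.2
  rw [this]
  exact continuous_finsetSum _ fun i _ => ((continuous_of_mem_reg (a i).2).comp continuous_fst).mul
    ((continuous_of_mem_reg (b i).2).comp continuous_snd)

instance isTopologicalGroup {H : Type} [Group H] [AffGrp H] [TopologicalSpace H] [IsEuclid H] :
    IsTopologicalGroup H where
  continuous_mul := continuous_iff_reg.mpr fun p hp =>
    continuous_of_prod_mem_reg (AffGrp.mul_reg p hp)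
  continuous_inv := IsReg.continuous AffGrp.inv_reg

variable (X) in
lemma exists_isClosedEmbedding : ∃ (n : ℕ) (g : X → Fin n → ℂ), Topology.IsClosedEmbedding g := by
  obtain ⟨s, hs⟩ := AffVar.fg (X := X)
  have hsmem : ∀ q : s, q.1 ∈ reg X := fun q => by
    have := Algebra.subset_adjoin (R := ℂ) q.2
    rwa [hs] at this
  let e := s.equivFin
  let g : X → Fin s.card → ℂ := fun x i => (e.symm i).1 x
  let F : MvPolynomial (Fin s.card) ℂ →ₐ[ℂ] reg X :=
    aeval fun i => ⟨(e.symm i).1, hsmem _⟩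
  have hFx : ∀ P x, (F P).1 x = eval (g x) P := by
    intro P x
    have : (ev x).comp F = aeval (g x) := by
      ext i; simp [F, g]
    rw [← coe_aeval_eq_eval]
    exact DFunLike.congr_fun this P
  have hFs : Function.Surjective F := by
    rintro ⟨p, hp⟩
    change p ∈ AffVar.functions at hp
    have hp' := hp
    rw [← hs] at hp'
    have hle : Algebra.adjoin ℂ (s : Set (X → ℂ)) ≤ ((reg X).val.comp F).range := by
      refine Algebra.adjoin_le fun q hq => ⟨MvPolynomial.X (e ⟨q, hq⟩), ?_⟩
      simp [F]
    obtain ⟨P, hP⟩ := hle hp'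
    exact ⟨P, Subtype.ext hP⟩
  refine ⟨s.card, g, ⟨⟨?_, ?_⟩, ?_⟩⟩
  · have hg : Continuous g := continuous_pi fun i => continuous_of_mem_reg (hsmem _)
    refine ⟨le_antisymm hg.le_induced ?_⟩
    rw [(IsEuclid.inducing (X := X)).eq_induced]
    let t : TopologicalSpace X := TopologicalSpace.induced g inferInstance
    refine continuous_iff_le_induced.mp (continuous_pi fun p => ?_)
    obtain ⟨P, rfl⟩ := hFs p
    simp only [hFx]
    exact (MvPolynomial.continuous_eval P).comp continuous_induced_dom
  · intro x y hxy
    refine sep _ _ fun p hp => ?_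
    obtain ⟨P, hP⟩ := hFs ⟨p, hp⟩
    have h1 := hFx P x
    rw [hxy, ← hFx P y, hP] at h1
    exact h1
  · have hrange : Set.range g = ⋂ P ∈ RingHom.ker F, {z | eval z P = 0} := by
      ext z
      simp only [Set.mem_iInter, Set.mem_ofPred_eq]
      constructor
      · rintro ⟨x, rfl⟩ P hP
        rw [← hFx, RingHom.mem_ker.mp hP]; rfl
      · intro hz
        have haev : ∀ P, (aeval z : _ →ₐ[ℂ] ℂ) P = eval z P := fun P =>
          DFunLike.congr_fun (coe_aeval_eq_eval z) P
        let ψ : reg X →ₐ[ℂ] ℂ := (Ideal.Quotient.liftₐ (RingHom.ker F) (aeval z : _ →ₐ[ℂ] ℂ)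
          (fun P hP => (haev P).trans (hz P hP))).comp
          (Ideal.quotientKerAlgEquivOfSurjective hFs).symm.toAlgHom
        have hψ : ∀ P, ψ (F P) = eval z P := by
          intro P
          have : (Ideal.quotientKerAlgEquivOfSurjective hFs).symm (F P) =
              Ideal.Quotient.mk _ P := by
            rw [AlgEquiv.symm_apply_eq]; rfl
          rw [AlgHom.comp_apply, AlgEquiv.coe_toAlgHom, this]
          exact haev P
        obtain ⟨x, hx⟩ := AffVar.point ψ
        refine ⟨x, funext fun i => ?_⟩
        have h1 := hx (F (MvPolynomial.X i))
        rw [hψ, eval_X, hFx, eval_X] at h1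
        exact h1.symm
    rw [hrange]
    exact isClosed_biInter fun P _ => isClosed_eq (MvPolynomial.continuous_eval P) continuous_const

instance t2Space : T2Space X := by
  obtain ⟨n, g, hg⟩ := exists_isClosedEmbedding X
  exact hg.toIsEmbedding.t2Space

instance locallyCompactSpace : LocallyCompactSpace X := by
  obtain ⟨n, g, hg⟩ := exists_isClosedEmbedding X
  exact hg.locallyCompactSpace

instance sigmaCompactSpace : SigmaCompactSpace X := by
  obtain ⟨n, g, hg⟩ := exists_isClosedEmbedding X
  exact hg.sigmaCompactSpace

end euclid

section simplyConnected

/-- An irreducible finite covering of a group with trivial fundamental group is injective. -/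
lemma injective_of_finite_ker {N D : Type} [Group N] [AffGrp N] [TopologicalSpace N] [IsEuclid N]
    [Group D] [AffGrp D] [IsDomain (reg D)] (hN : ∀ p : Path (1 : N) 1, p.Homotopic (Path.refl 1))
    (q : D →* N) (hq : IsReg q) (hs : Function.Surjective q) (hfin : (q.ker : Set D).Finite) :
    Function.Injective q := by
  let _ : TopologicalSpace D := euclid D
  have : IsEuclid D := isEuclid_euclid
  have hopen := q.isOpenMap_of_sigmaCompact hs hq.continuous
  have hquot : Topology.IsQuotientMap q := hopen.isQuotientMap hq.continuous hs
  have hdisc : IsDiscrete (q.ker : Set D) := hfin.isDiscrete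
  have hcov := (hquot.isQuotientCoveringMap_of_isDiscrete_ker_monoidHom hdisc).isCoveringMap
  rw [injective_iff_map_eq_one]
  intro d hd
  obtain ⟨c, hc0, hc1, hc⟩ := curveConnected_of_isDomain (1 : D) d
  have hcont : Continuous c := continuous_iff_reg.mpr fun p hp => (hc p hp).continuous
  let γ : Path (1 : D) d :=
    { toFun := fun t => c ((t : ℝ) : ℂ)
      continuous_toFun := hcont.comp (Complex.continuous_ofReal.comp continuous_subtype_val)
      source' := by simp [hc0]
      target' := by simp [hc1] }
  have hhom := hN ((γ.map hq.continuous).cast (map_one q).symm hd.symm)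
  have h1 := hcov.homotopicRel_iff_comp (f₀ := γ.toContinuousMap)
    (f₁ := (Path.refl (1 : D)).toContinuousMap) (S := {0, 1}) ⟨0, by simp, by simp⟩
  have h2 : γ.toContinuousMap.HomotopicRel (Path.refl (1 : D)).toContinuousMap {0, 1} := by
    rw [h1]
    have hγ : (⟨q, hcov.continuous⟩ : C(D, N)).comp γ.toContinuousMap =
        ((γ.map hq.continuous).cast (map_one q).symm hd.symm).toContinuousMap := rfl
    have hrefl : (⟨q, hcov.continuous⟩ : C(D, N)).comp (Path.refl (1 : D)).toContinuousMap =
        (Path.refl (1 : N)).toContinuousMap := by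
      ext t; simp
    rw [hγ, hrefl]
    exact hhom
  obtain ⟨F⟩ := h2
  have h3 := F.fst_eq_snd (x := 1) (by simp)
  simpa using h3

/-- Finite coverings of a simply connected group split. -/
theorem exists_section_of_simplyConnected {N D : Type} [Group N] [AffGrp N] [IsDomain (reg N)]
    [TopologicalSpace N] [IsEuclid N] [Group D] [AffGrp D]
    (hN : ∀ p : Path (1 : N) 1, p.Homotopic (Path.refl 1))
    (q : D →* N) (hq : IsReg q) (hs : Function.Surjective q) (hfin : (q.ker : Set D).Finite) :
    ∃ σ : N →* D, IsReg σ ∧ ∀ n, q (σ n) = n := by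
  obtain ⟨D₀, hnormal, hindex, hcl, hdom⟩ := exists_identityComponent D
  let _ : AffGrp D₀ := subgroupGrp hcl
  have hq₀ : IsReg (q.comp D₀.subtype) := hq.comp (isReg_val hcl)
  have hs₀ : Function.Surjective (q.comp D₀.subtype) := by
    refine surjective_of_pow_mem_range _ hq₀ (Subgroup.FiniteIndex.index_ne_zero (H := D₀)) ?_
    intro n
    obtain ⟨d, rfl⟩ := hs n
    exact ⟨⟨d ^ D₀.index, D₀.pow_index_mem d⟩, by simp⟩
  have hfin₀ : ((q.comp D₀.subtype).ker : Set D₀).Finite := by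
    refine Set.Finite.of_finite_image (f := Subtype.val) (hfin.subset ?_)
      Subtype.val_injective.injOn
    rintro _ ⟨x, hx, rfl⟩
    exact hx
  have hinj := injective_of_finite_ker hN _ hq₀ hs₀ hfin₀
  let e : D₀ ≃* N := MulEquiv.ofBijective (q.comp D₀.subtype) ⟨hinj, hs₀⟩
  refine ⟨D₀.subtype.comp e.symm.toMonoidHom, ?_, fun n => e.apply_symm_apply n⟩
  refine isReg_of_comp_surjective hq₀ hs₀ _ ?_
  have : (fun x : D₀ => (D₀.subtype.comp e.symm.toMonoidHom) (q.comp D₀.subtype x)) =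
      fun x => x.1 := funext fun x => congrArg Subtype.val (e.symm_apply_apply x)
  rw [this]
  exact isReg_val hcl

end simplyConnected

/-! ### Unipotent groups -/

section unipotent

/-- A faithful regular representation by upper triangular unipotent matrices. -/
structure UnipotentRep (U : Type) [Group U] [AffGrp U] where
  /-- the size of the matrices -/
  m : ℕ
  /-- the representation -/
  rep : U →* Matrix (Fin m) (Fin m) ℂ
  reg_rep : ∀ i j, (fun u => rep u i j) ∈ reg U
  inj : Function.Injective rep
  diag : ∀ u i, rep u i i = 1
  lower : ∀ u i j, j < i → rep u i j = 0

variable {U : Type} [Group U] [AffGrp U]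

lemma UnipotentRep.sub_one_pow (M : UnipotentRep U) (u : U) : (M.rep u - 1) ^ M.m = 0 := by
  have h1 : (M.rep u).BlockTriangular id := fun i j hij => M.lower u i j hij
  have h2 := Matrix.charpoly_of_isUpperTriangular _ h1
  have h3 := Matrix.aeval_self_charpoly (M.rep u)
  rw [h2] at h3
  simpa [M.diag] using h3

/-- Functions which are polynomial along all translated powers. -/
def polynomialFunctions (U : Type) [Group U] [AffGrp U] : Subalgebra ℂ (reg U) where
  carrier := {p | ∀ x u : U, ∃ Q : Polynomial ℂ, ∀ n : ℕ, p.1 (x * u ^ n) = Q.eval (n : ℂ)}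
  mul_mem' {p q} hp hq x u := by
    obtain ⟨P, hP⟩ := hp x u
    obtain ⟨Q, hQ⟩ := hq x u
    exact ⟨P * Q, fun n => by
      rw [Polynomial.eval_mul, ← hP, ← hQ]; rfl⟩
  add_mem' {p q} hp hq x u := by
    obtain ⟨P, hP⟩ := hp x u
    obtain ⟨Q, hQ⟩ := hq x u
    exact ⟨P + Q, fun n => by
      rw [Polynomial.eval_add, ← hP, ← hQ]; rfl⟩
  algebraMap_mem' c x u := ⟨Polynomial.C c, fun n => by rw [Polynomial.eval_C]; rfl⟩

lemma UnipotentRep.mem_polynomialFunctions (M : UnipotentRep U) (i j : Fin M.m) :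
    (⟨_, M.reg_rep i j⟩ : reg U) ∈ polynomialFunctions U := by
  intro x u
  let V := Matrix (Fin M.m) (Fin M.m) ℂ
  let R : Module.End ℂ V := LinearMap.mulRight ℂ (M.rep u)
  have hR : ∀ (n : ℕ) (v : V), (R ^ n) v = v * M.rep u ^ n := by
    intro n
    induction n with
    | zero => intro v; simp
    | succ n ih =>
      intro v
      rw [pow_succ', Module.End.mul_apply, ih, pow_succ, ← mul_assoc]
      rfl
  have hR1 : ∀ (n : ℕ) (v : V), ((R - (1 : ℂ) • (1 : Module.End ℂ V)) ^ n) v =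
      v * (M.rep u - 1) ^ n := by
    intro n
    induction n with
    | zero => intro v; simp
    | succ n ih =>
      intro v
      rw [pow_succ', Module.End.mul_apply, ih, pow_succ, ← mul_assoc, mul_sub, mul_one, one_smul]
      rfl
  obtain ⟨Q, hQ⟩ := exists_expPoly R one_ne_zero (p := M.rep x)
    ((Module.End.mem_maxGenEigenspace _ _ _).mpr ⟨M.m, by rw [hR1, M.sub_one_pow, mul_zero]⟩)
    (Matrix.entryLinearMap ℂ ℂ i j)
  refine ⟨Q, fun n => ?_⟩
  have := hQ n
  rw [hR, ← map_pow, ← map_mul, one_pow, one_mul] at this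
  exact this

lemma fwdDiff_iter_pow (u : U) (k : ℕ) (q : reg U) :
    (fwdDiff 1)^[k] (fun n : ℕ => q.1 (u ^ n)) = fun n =>
      ((((rTrans u).toLinearMap - (1 : ℂ) • (1 : Module.End ℂ (reg U)) :
        Module.End ℂ (reg U)) ^ k) q).1 (u ^ n) := by
  induction k generalizing q with
  | zero => rfl
  | succ k ih =>
    rw [Function.iterate_succ_apply, pow_succ, Module.End.mul_apply, ← ih]
    congr 1
    funext n
    rw [fwdDiff, pow_succ, one_smul]
    rfl

variable [IsDomain (reg U)]

lemma UnipotentRep.maxGenEigenspace_eq_top (M : UnipotentRep U) (u : U) :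
    Module.End.maxGenEigenspace (rTrans u).toLinearMap 1 = ⊤ := by
  rw [eq_top_iff, ← iSup_maxGenEigenspace_rTrans u]
  refine iSup_le fun μ => ?_
  by_cases hμ : μ = 1
  · rw [hμ]
  by_cases hbot : Module.End.maxGenEigenspace (rTrans u).toLinearMap μ = ⊥
  · rw [hbot]; exact bot_le
  exfalso
  have hev : Module.End.HasEigenvalue (rTrans u).toLinearMap μ := by
    exact Module.End.HasUnifEigenvalue.lt zero_lt_one hbot
  obtain ⟨w, hw⟩ := hev.exists_hasEigenvector
  have hwx : ∀ x, w.1 (x * u) = μ * w.1 x := fun x =>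
    congrFun (congrArg Subtype.val hw.apply_eq_smul) x
  have hwn : ∀ (n : ℕ) x, w.1 (x * u ^ n) = μ ^ n * w.1 x := by
    intro n
    induction n with
    | zero => intro x; simp
    | succ n ih => intro x; rw [pow_succ, ← mul_assoc, hwx, ih, pow_succ']; ring
  have hμ0 : μ ≠ 0 := by
    rintro rfl
    refine hw.2 (Subtype.ext (funext fun x => ?_))
    have := hwx (x * u⁻¹)
    rwa [inv_mul_cancel_right, zero_mul] at this
  obtain ⟨r, hr, hr0, hrw⟩ := exists_mul_mem_of_forall_algHom (polynomialFunctions U) w (by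
    intro ψ₁ ψ₂ h
    obtain ⟨x₁, h₁⟩ := AffVar.point ψ₁
    obtain ⟨x₂, h₂⟩ := AffVar.point ψ₂
    have : x₁ = x₂ := by
      apply M.inj
      ext i j
      have := h _ (M.mem_polynomialFunctions i j)
      rwa [h₁, h₂] at this
    rw [h₁, h₂, this])
  obtain ⟨x, hx⟩ := Function.ne_iff.mp fun h0 : (r * w).1 = 0 =>
    mul_ne_zero hr0 hw.2 (Subtype.ext h0)
  obtain ⟨P, hP⟩ := hr x u
  obtain ⟨Q, hQ⟩ := hrw x u
  have hz := expPoly_eq_zero Finset.univ (fun b : Bool => if b then μ else 1)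
    (by intro a b; cases a <;> cases b <;> simp [hμ, Ne.symm hμ])
    (by intro b; cases b <;> simp [hμ0]) (fun b => if b then -Polynomial.C (w.1 x) * P else Q) (by
      intro n
      have h1 : r.1 (x * u ^ n) * w.1 (x * u ^ n) = Q.eval (n : ℂ) := hQ n
      rw [hP, hwn] at h1
      simp [← h1]
      ring)
  have hz1 := hz true (Finset.mem_univ _)
  have hP0 : r.1 x = P.eval 0 := by simpa using hP 0
  have := congrArg (Polynomial.eval 0) hz1
  apply hx
  change r.1 x * w.1 x = 0
  rw [hP0]
  simpa [mul_comm, or_comm] using this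

lemma UnipotentRep.exists_sub_one_pow_eq_zero (M : UnipotentRep U) (p : reg U) :
    ∃ K : ℕ, ∀ u, (((rTrans u).toLinearMap - (1 : ℂ) • (1 : Module.End ℂ (reg U)) :
      Module.End ℂ (reg U)) ^ K) p = 0 := by
  refine ⟨Module.finrank ℂ (translates p), fun u => ?_⟩
  let R : Module.End ℂ (reg U) := (rTrans u).toLinearMap
  have hR : ∀ w ∈ translates p, R w ∈ translates p := fun w hw => rTrans_mem_translates p u hw
  have h1 := Module.End.genEigenspace_restrict R (translates p) ⊤ 1 hR
  have h2 := Module.End.genEigenspace_restrict R (translates p)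
    (Module.finrank ℂ (translates p) : ℕ∞) 1 hR
  have h3 := Module.End.maxGenEigenspace_eq_genEigenspace_finrank (K := ℂ) (V := translates p)
    (LinearMap.restrict R hR) 1
  have h4 : (⟨p, mem_translates p⟩ : translates p) ∈
      Submodule.comap (translates p).subtype (Module.End.genEigenspace R 1 ⊤) :=
    (M.maxGenEigenspace_eq_top u).ge Submodule.mem_top
  rw [← h1] at h4
  have h5 := h3.le h4
  rw [h2] at h5
  exact LinearMap.mem_ker.mp (Module.End.mem_genEigenspace_nat.mp h5)

/-- Powers `u ^ n` extend to complex exponents on a unipotent group. -/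
lemma UnipotentRep.exists_cpow (M : UnipotentRep U) :
    ∃ c : U × ℂ → U, IsReg c ∧ ∀ u (n : ℕ), c (u, n) = u ^ n := by
  have hext : ∀ p : reg U, ∃ P : reg (U × ℂ), ∀ u (n : ℕ), P.1 (u, n) = p.1 (u ^ n) := by
    intro p
    obtain ⟨K, hK⟩ := M.exists_sub_one_pow_eq_zero p
    let P : U × ℂ → ℂ := fun z => ∑ k ∈ Finset.range K,
      (∑ j ∈ Finset.range (k + 1), (((-1 : ℤ) ^ (k - j) * k.choose j : ℤ) : ℂ) * p.1 (z.1 ^ j)) *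
        (Polynomial.C ((k.factorial : ℂ)⁻¹) * descPochhammer ℂ k).eval z.2
    refine ⟨⟨P, sum_mem_reg _ fun k _ => mul_mem_reg (sum_mem_reg _ fun j _ =>
      mul_mem_reg (const_mem _) ((isReg_fst.pow j) _ p.2))
      (isReg_snd _ (polynomial_mem_reg _))⟩, fun u n => ?_⟩
    change ∑ k ∈ Finset.range K, _ = _
    let F : ℕ → ℂ := fun n => p.1 (u ^ n)
    have hF : ∀ k, (fwdDiff 1)^[k] F 0 = ∑ j ∈ Finset.range (k + 1),
        (((-1 : ℤ) ^ (k - j) * k.choose j : ℤ) : ℂ) * p.1 (u ^ j) := by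
      intro k
      rw [fwdDiff_iter_eq_sum_shift]
      exact Finset.sum_congr rfl fun j _ => by
        rw [zsmul_eq_mul, zero_add, smul_eq_mul, mul_one]
    have hF0 : ∀ k, K ≤ k → (fwdDiff 1)^[k] F 0 = 0 := by
      intro k hk
      obtain ⟨d, rfl⟩ := Nat.exists_eq_add_of_le' hk
      rw [fwdDiff_iter_pow u (d + K) p, pow_add, Module.End.mul_apply, hK, map_zero]
      rfl
    have hch : ∀ k : ℕ, (Polynomial.C ((k.factorial : ℂ)⁻¹) * descPochhammer ℂ k).eval (n : ℂ) =
        n.choose k := by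
      intro k
      rw [Polynomial.eval_mul, Polynomial.eval_C, descPochhammer_eval_eq_descFactorial,
        Nat.descFactorial_eq_factorial_mul_choose]
      have := Nat.cast_ne_zero (R := ℂ).mpr k.factorial_ne_zero
      push_cast
      field_simp
    have hnewton := shift_eq_sum_fwdDiff_iter 1 F n 0
    rw [zero_add, smul_eq_mul, mul_one] at hnewton
    simp only [hch, ← hF]
    refine Eq.trans ?_ hnewton.symm
    have hL : ∑ k ∈ Finset.range K, (fwdDiff 1)^[k] F 0 * (n.choose k : ℂ) =
        ∑ k ∈ Finset.range (K + (n + 1)), (fwdDiff 1)^[k] F 0 * (n.choose k : ℂ) := by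
      refine Finset.sum_subset (Finset.range_subset_range.mpr (by omega)) fun k _ hk => ?_
      rw [hF0 k (by simpa using hk), zero_mul]
    rw [hL]
    symm
    simp only [nsmul_eq_mul, mul_comm]
    refine Finset.sum_subset (Finset.range_subset_range.mpr (by omega)) fun k _ hk => ?_
    rw [Nat.choose_eq_zero_of_lt (by simpa using hk), Nat.cast_zero, zero_mul]
  have huniq : ∀ P P' : reg (U × ℂ), (∀ u (n : ℕ), P.1 (u, n) = P'.1 (u, n)) → P = P' := by
    intro P P' h
    refine Subtype.ext (funext fun ⟨u, t⟩ => ?_)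
    have hreg : IsReg fun t : ℂ => (u, t) := (isReg_const u).prodMk isReg_id
    obtain ⟨Q, hQ⟩ := exists_polynomial_of_mem_reg (hreg _ P.2)
    obtain ⟨Q', hQ'⟩ := exists_polynomial_of_mem_reg (hreg _ P'.2)
    have : Q = Q' := by
      refine Polynomial.eq_of_infinite_eval_eq _ _
        ((Set.infinite_range_of_injective (Nat.cast_injective (R := ℂ))).mono ?_)
      rintro _ ⟨n, rfl⟩
      rw [Set.mem_ofPred_eq, ← hQ, ← hQ']
      exact h u n
    exact (hQ t).trans (this ▸ (hQ' t).symm)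
  choose F hF using hext
  let ψ : reg U →ₐ[ℂ] reg (U × ℂ) :=
    { toFun := F
      map_one' := huniq _ _ fun u n => hF _ u n
      map_mul' := fun p q => huniq _ _ fun u n =>
        (hF _ u n).trans (congrArg₂ (· * ·) (hF p u n).symm (hF q u n).symm)
      map_zero' := huniq _ _ fun u n => hF _ u n
      map_add' := fun p q => huniq _ _ fun u n =>
        (hF _ u n).trans (congrArg₂ (· + ·) (hF p u n).symm (hF q u n).symm)
      commutes' := fun c => huniq _ _ fun u n => hF _ u n }
  obtain ⟨c, hc, hcψ⟩ := exists_of_algHom ψ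
  exact ⟨c, hc, fun u n => sep _ _ fun p hp => (hcψ ⟨p, hp⟩ (u, n)).trans (hF ⟨p, hp⟩ u n)⟩

instance : IsEuclid ℂ where
  inducing := by
    refine ⟨le_antisymm (Continuous.le_induced (continuous_pi fun p => ?_)) ?_⟩
    · obtain ⟨Q, hQ⟩ := exists_polynomial_of_mem_reg p.2
      simp only [hQ]
      exact Q.continuous
    · have h : Continuous fun f : reg ℂ → ℂ => f ⟨_, id_mem_reg⟩ := continuous_apply _
      refine (induced_mono h.le_induced).trans ?_
      rw [induced_compose]
      exact induced_id.le

/-- Connected unipotent groups are simply connected. -/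
theorem UnipotentRep.homotopic_refl (M : UnipotentRep U) [TopologicalSpace U] [IsEuclid U]
    (γ : Path (1 : U) 1) : γ.Homotopic (Path.refl 1) := by
  obtain ⟨c, hc, hcn⟩ := M.exists_cpow
  have hcont : Continuous c := continuous_iff_reg.mpr fun p hp =>
    continuous_of_prod_mem_reg (hc p hp)
  have hc1 : ∀ t, c (1, t) = 1 := by
    intro t
    refine sep _ _ fun p hp => ?_
    have hreg : IsReg fun t : ℂ => c ((1 : U), t) := hc.comp ((isReg_const 1).prodMk isReg_id)
    obtain ⟨Q, hQ⟩ := exists_polynomial_of_mem_reg (hreg _ hp)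
    have : Q = Polynomial.C (p 1) := by
      refine Polynomial.eq_of_infinite_eval_eq _ _
        ((Set.infinite_range_of_injective (Nat.cast_injective (R := ℂ))).mono ?_)
      rintro _ ⟨n, rfl⟩
      rw [Set.mem_ofPred_eq, ← hQ]
      change p (c (1, (n : ℂ))) = _
      rw [hcn, one_pow, Polynomial.eval_C]
    exact (hQ t).trans (by rw [this, Polynomial.eval_C])
  refine ⟨⟨⟨⟨fun z => c (γ z.2, ((1 - (z.1 : ℝ) : ℝ) : ℂ)), ?_⟩, fun t => ?_, fun t => ?_⟩, ?_⟩⟩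
  · exact hcont.comp ((γ.continuous.comp continuous_snd).prodMk (Complex.continuous_ofReal.comp
      (continuous_const.sub (continuous_subtype_val.comp continuous_fst))))
  · have := hcn (γ t) 1
    simpa using this
  · have := hcn (γ t) 0
    simpa using this
  · rintro s t (rfl | rfl) <;> simp [hc1]

end unipotent

/-! ### Characters -/

section characters

lemma isReg_torus {X : Type} [AffVar X] {k : ℕ} {χ : X → Fin k → ℂˣ}
    (h : ∀ j, (fun x => (χ x j : ℂ)) ∈ reg X)
    (h' : ∀ j, (fun x => (((χ x j)⁻¹ : ℂˣ) : ℂ)) ∈ reg X) : IsReg χ := by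
  intro p hp
  obtain ⟨c, hc⟩ := exists_monomial_sum hp
  simp only [hc, Finsupp.sum]
  refine sum_mem_reg _ fun e _ => mul_mem_reg (const_mem _) ?_
  simp only [Units.coe_prod]
  refine prod_mem_reg _ fun j _ => ?_
  cases e j with
  | ofNat n =>
    simp only [Int.ofNat_eq_natCast, zpow_natCast, Units.val_pow_eq_pow_val]
    exact (reg X).pow_mem (h j) n
  | negSucc n =>
    simp only [zpow_negSucc, ← inv_pow, Units.val_pow_eq_pow_val]
    exact (reg X).pow_mem (h' j) (n + 1)

lemma coord_mem_reg {k : ℕ} (j : Fin k) :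
    (fun u : Fin k → ℂˣ => (u j : ℂ)) ∈ reg (Fin k → ℂˣ) := by
  have := monomial_mem_reg (a := k) (Pi.single j 1)
  have h2 : ∀ u : Fin k → ℂˣ, _ = (u j : ℂ) := monomialHom_single j
  simp only [← h2]
  exact this

lemma coord_inv_mem_reg {k : ℕ} (j : Fin k) :
    (fun u : Fin k → ℂˣ => (((u j)⁻¹ : ℂˣ) : ℂ)) ∈ reg (Fin k → ℂˣ) := by
  have := monomial_mem_reg (a := k) (-Pi.single j 1)
  have h2 : ∀ u : Fin k → ℂˣ, _ = (((u j)⁻¹ : ℂˣ) : ℂ) := fun u => monomialHom_single j u⁻¹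
  simp only [← h2]
  convert this using 4
  simp [monomialHom]

instance (k : ℕ) : AffGrp (Fin k → ℂˣ) where
  inv_reg := isReg_torus (fun j => coord_inv_mem_reg j) fun j => by
    simpa using coord_mem_reg j
  mul_reg := by
    refine isReg_torus (fun j => ?_) fun j => ?_
    · simp only [Pi.mul_apply, Units.val_mul]
      exact mul_mem_reg (isReg_fst _ (coord_mem_reg j)) (isReg_snd _ (coord_mem_reg j))
    · simp only [Pi.mul_apply, mul_inv, Units.val_mul]
      exact mul_mem_reg (isReg_fst _ (coord_inv_mem_reg j)) (isReg_snd _ (coord_inv_mem_reg j))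

instance (k : ℕ) : IsDomain (reg (Fin k → ℂˣ)) := (curveConnected_torus k).isDomain

lemma monomial_coeff_eq {k : ℕ} {S : Finset (Fin k → ℤ)} {c c' : (Fin k → ℤ) → ℂ}
    (h : ∀ u : Fin k → ℂˣ, ∑ e ∈ S, c e * ((∏ j, u j ^ e j : ℂˣ) : ℂ) =
      ∑ e ∈ S, c' e * ((∏ j, u j ^ e j : ℂˣ) : ℂ)) : ∀ e ∈ S, c e = c' e := by
  let χ : (Fin k → ℤ) → ((Fin k → ℂˣ) →* ℂ) := fun e =>
    { toFun := fun u => ((∏ j, u j ^ e j : ℂˣ) : ℂ)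
      map_one' := by simp
      map_mul' := fun u v => by simp [mul_zpow, Finset.prod_mul_distrib] }
  have hχ : Function.Injective χ := by
    intro e e' hee
    funext j
    have h1 := DFunLike.congr_fun hee (Pi.mulSingle j (Units.mk0 2 two_ne_zero))
    have h2 : ∀ e : Fin k → ℤ, χ e (Pi.mulSingle j (Units.mk0 2 two_ne_zero)) = (2 : ℂ) ^ e j := by
      intro e
      change ((∏ i, _ : ℂˣ) : ℂ) = _
      rw [Finset.prod_eq_single j]
      · simp
      · intro i _ hi; simp [hi]
      · simp
    rw [h2, h2] at h1
    have h3 : ((2 : ℝ) : ℂ) ^ e j = ((2 : ℝ) : ℂ) ^ e' j := by simpa using h1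
    rw [← Complex.ofReal_zpow, ← Complex.ofReal_zpow, Complex.ofReal_inj] at h3
    exact zpow_right_injective₀ (by norm_num) (by norm_num) h3
  have hli := (linearIndependent_monoidHom (Fin k → ℂˣ) ℂ).comp χ hχ
  intro e he
  refine sub_eq_zero.mp (linearIndependent_iff'.mp hli S (fun e => c e - c' e) ?_ e he)
  funext u
  simp only [Function.comp_apply, Finset.sum_apply, Pi.smul_apply, smul_eq_mul, sub_mul,
    Finset.sum_sub_distrib, Pi.zero_apply]
  exact sub_eq_zero.mpr (h u)

variable {E : Type} [Group E] [AffGrp E]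

/-- The component of given weight of a regular function on a group containing a torus. -/
lemma exists_weight {k : ℕ} (τ : (Fin k → ℂˣ) →* E) (hτ : IsReg τ) (j : Fin k) {p : E → ℂ}
    (hp : p ∈ reg E) (hpτ : ∀ u, p (τ u) = u j) :
    ∃ φ : reg E, φ.1 1 = 1 ∧ ∀ x u, φ.1 (x * τ u) = u j * φ.1 x := by
  classical
  have hreg : IsReg fun z : E × (Fin k → ℂˣ) => z.1 * τ z.2 := isReg_fst.mul (hτ.comp isReg_snd)
  obtain ⟨n, a, b, hab⟩ := exists_sum_of_mem_prod (hreg p hp)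
  choose c hc using fun i => exists_monomial_sum (b i).2
  let e₀ : Fin k → ℤ := Pi.single j 1
  have he₀ : ∀ u : Fin k → ℂˣ, ((∏ i, u i ^ e₀ i : ℂˣ) : ℂ) = u j := monomialHom_single j
  let S : Finset (Fin k → ℤ) := insert e₀ (Finset.univ.biUnion fun i => (c i).support)
  let F : (Fin k → ℤ) → E → ℂ := fun e x => ∑ i, c i e * (a i).1 x
  have hform : ∀ x u, p (x * τ u) = ∑ e ∈ S, F e x * ((∏ j, u j ^ e j : ℂˣ) : ℂ) := by
    intro x u
    have h1 : ∀ i, (a i).1 x * (b i).1 u = ∑ e ∈ S, c i e * (a i).1 x *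
        ((∏ j, u j ^ e j : ℂˣ) : ℂ) := by
      intro i
      rw [hc, Finsupp.sum_of_support_subset (s := S), Finset.mul_sum]
      · exact Finset.sum_congr rfl fun e _ => by ring
      · exact fun e he => Finset.mem_insert_of_mem
          (Finset.mem_biUnion.mpr ⟨i, Finset.mem_univ i, he⟩)
      · simp
    refine (hab x u).trans ?_
    simp_rw [h1]
    rw [Finset.sum_comm]
    exact Finset.sum_congr rfl fun e _ => (Finset.sum_mul _ _ _).symm
  have hS : e₀ ∈ S := Finset.mem_insert_self _ _
  refine ⟨⟨F e₀, sum_mem_reg _ fun i _ => mul_mem_reg (const_mem _) (a i).2⟩, ?_, fun x v => ?_⟩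
  · have := monomial_coeff_eq (S := S) (c := fun e => F e 1)
      (c' := fun e => if e = e₀ then 1 else 0) (fun u => by
        rw [← hform, one_mul, hpτ]
        simp only [ite_mul, one_mul, zero_mul, Finset.sum_ite_eq', if_pos hS, he₀]) e₀ hS
    simpa using this
  · have := monomial_coeff_eq (S := S) (c := fun e => F e (x * τ v))
      (c' := fun e => ((∏ j, v j ^ e j : ℂˣ) : ℂ) * F e x) (fun u => by
        rw [← hform, mul_assoc, ← map_mul, hform]
        refine Finset.sum_congr rfl fun e _ => ?_
        simp only [Pi.mul_apply, mul_zpow, Finset.prod_mul_distrib, Units.val_mul]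
        ring) e₀ hS
    simpa [he₀] using this

instance (p : reg E) : Module.Free ℂ (translates p) :=
  Module.Free.of_divisionRing (K := ℂ) (V := translates p)

/-- The representation of the group on the translates of a regular function. -/
def translatesRep (p : reg E) : E →* Module.End ℂ (translates p) where
  toFun g := (rTrans g).toLinearMap.restrict fun _ hw => rTrans_mem_translates p g hw
  map_one' := LinearMap.ext fun w => Subtype.ext (rTrans_one w.1)
  map_mul' g h := LinearMap.ext fun w => Subtype.ext (rTrans_mul g h w.1)

lemma det_translatesRep_mem_reg (p : reg E) :
    (fun g => LinearMap.det (M := translates p) (translatesRep p g)) ∈ reg E := by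
  classical
  let b := Module.finBasis ℂ (translates p)
  simp only [← LinearMap.det_toMatrix (M := translates p) b, Matrix.det_apply']
  refine sum_mem_reg _ fun σ _ => mul_mem_reg (const_mem _) ?_
  refine prod_mem_reg _ fun i _ => ?_
  obtain ⟨l, hl⟩ := (b.coord (σ i)).exists_extend
  obtain ⟨n, a, c, hac⟩ := exists_sum_of_mem_prod (AffGrp.mul_reg (b i).1.1 (b i).1.2)
  have hsum : ∀ g, rTrans g (b i).1 = ∑ m, (c m).1 g • a m := by
    intro g
    apply Subtype.ext; funext x
    have h1 := map_sum (ev x) (fun m => (c m).1 g • a m) Finset.univ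
    simp only [ev_apply] at h1
    rw [h1]
    exact (hac x g).trans (Finset.sum_congr rfl fun m _ => mul_comm _ _)
  have hentry : ∀ g, LinearMap.toMatrix b b (translatesRep p g) (σ i) i =
      ∑ m, l (a m) * (c m).1 g := by
    intro g
    rw [LinearMap.toMatrix_apply]
    have h2 := DFunLike.congr_fun hl (translatesRep p g (b i))
    refine h2.symm.trans ?_
    change l (rTrans g (b i).1) = _
    rw [hsum, map_sum]
    exact Finset.sum_congr rfl fun m _ => by rw [map_smul, smul_eq_mul, mul_comm]
  simp only [hentry]
  exact sum_mem_reg _ fun m _ => mul_mem_reg (const_mem _) (c m).2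

/-- A central torus in `E` admits characters of `E` which are powers of the coordinates. -/
lemma exists_character {k : ℕ} (τ : (Fin k → ℂˣ) →* E) (hτ : IsReg τ) (hinj : Function.Injective τ)
    (hcl : IsZClosed (τ.range : Set E)) (hcent : ∀ u x, τ u * x = x * τ u) (j : Fin k) :
    ∃ (δ : E →* ℂ) (d : ℕ), d ≠ 0 ∧ (δ : E → ℂ) ∈ reg E ∧ ∀ u, δ (τ u) = (u j : ℂ) ^ d := by
  obtain ⟨p, hp, hpτ⟩ : ∃ p ∈ reg E, ∀ u, p (τ u) = u j := by
    let _ : AffGrp τ.range := subgroupGrp hcl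
    let σ : τ.range ≃* (Fin k → ℂˣ) := (MonoidHom.ofInjective hinj).symm
    have hσ : ∀ u, σ (τ.rangeRestrict u) = u := fun u => σ.symm.injective (by
      rw [MulEquiv.symm_apply_apply]; rfl)
    have hreg : IsReg σ.toMonoidHom := isReg_of_comp_surjective (f := τ.rangeRestrict)
      (isReg_codRestrict hcl hτ fun u => ⟨u, rfl⟩) τ.rangeRestrict_surjective σ.toMonoidHom
      (by
        have : (fun u => σ.toMonoidHom (τ.rangeRestrict u)) = fun u => u := funext hσ
        rw [this]; exact isReg_id)
    obtain ⟨p, hp, hpe⟩ := hreg _ (coord_mem_reg j)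
    refine ⟨p, hp, fun u => (congrFun hpe (τ.rangeRestrict u)).trans ?_⟩
    exact congrArg (fun v : Fin k → ℂˣ => (v j : ℂ)) (hσ u)
  obtain ⟨φ, hφ1, hφ⟩ := exists_weight τ hτ j hp hpτ
  have hW : ∀ w ∈ translates φ, ∀ x u, w.1 (x * τ u) = u j * w.1 x := by
    intro w hw
    induction hw using Submodule.span_induction with
    | mem w hw =>
      obtain ⟨g, rfl⟩ := hw
      intro x u
      change φ.1 (x * τ u * g) = _ * φ.1 (x * g)
      rw [mul_assoc, hcent, ← mul_assoc, hφ]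
    | zero => intro x u; exact (mul_zero _).symm
    | add v w _ _ hv hw =>
      intro x u
      change v.1 _ + w.1 _ = _ * (v.1 _ + w.1 _)
      rw [hv, hw, mul_add]
    | smul c w _ hw =>
      intro x u
      change c * w.1 _ = _ * (c * w.1 _)
      rw [hw]; ring
  refine ⟨(LinearMap.det (M := translates φ)).comp (translatesRep φ),
    Module.finrank ℂ (translates φ), ?_, det_translatesRep_mem_reg φ, fun u => ?_⟩
  · have : Nontrivial (translates φ) := ⟨⟨⟨φ, mem_translates φ⟩, 0, fun h => by
      have h0 : φ = 0 := congrArg Subtype.val h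
      rw [h0] at hφ1
      exact zero_ne_one hφ1⟩⟩
    exact (Module.finrank_pos (R := ℂ) (M := translates φ)).ne'
  · have : translatesRep φ (τ u) = (u j : ℂ) • LinearMap.id := by
      refine LinearMap.ext fun w => Subtype.ext (Subtype.ext (funext fun x => ?_))
      exact hW w.1 w.2 x u
    rw [MonoidHom.comp_apply, this, LinearMap.det_smul, LinearMap.det_id, mul_one]

/-- A group with a closed central torus has a closed subgroup which meets the torus in a finite
group and generates the group together with the torus. -/
theorem exists_almost_complement {k : ℕ} (τ : (Fin k → ℂˣ) →* E) (hτ : IsReg τ)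
    (hinj : Function.Injective τ) (hcl : IsZClosed (τ.range : Set E))
    (hcent : ∀ u x, τ u * x = x * τ u) :
    ∃ D : Subgroup E, IsZClosed (D : Set E) ∧ {u | τ u ∈ D}.Finite ∧ ∀ x, ∃ u, x * τ u ∈ D := by
  choose δ d hd hδ hδτ using exists_character τ hτ hinj hcl hcent
  have hD : ∀ x, x ∈ (⨅ j, (δ j).ker : Subgroup E) ↔ ∀ j, δ j x = 1 := fun x => by
    simp [Subgroup.mem_iInf, MonoidHom.mem_ker]
  refine ⟨⨅ j, (δ j).ker, ?_, ?_, fun x => ?_⟩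
  · have : ((⨅ j, (δ j).ker : Subgroup E) : Set E) = ⋂ j, {x | δ j x - 1 = 0} := by
      ext x
      simp [sub_eq_zero, MonoidHom.mem_ker]
    rw [this]
    exact isZClosed_iInter fun j => isZClosed_eq_zero ((reg E).sub_mem (hδ j) (const_mem 1))
  · have hsub : {u | τ u ∈ (⨅ j, (δ j).ker : Subgroup E)} ⊆
        Set.pi Set.univ fun j => {z : ℂˣ | z ^ d j = 1} := by
      intro u hu j _
      have := (hD _).mp hu j
      rw [hδτ] at this
      exact Units.ext (by simpa using this)
    refine Set.Finite.subset (Set.Finite.pi' fun j => ?_) (fun u hu j => hsub hu j trivial)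
    have : NeZero (d j) := ⟨hd j⟩
    exact Set.finite_coe_iff.mp (inferInstanceAs (Finite (rootsOfUnity (d j) ℂ)))
  · have hne : ∀ j, δ j x ≠ 0 := fun j h0 => by
      have : δ j x * δ j x⁻¹ = 1 := by rw [← map_mul, mul_inv_cancel, map_one]
      rw [h0, zero_mul] at this
      exact zero_ne_one this
    choose v hv using fun j => IsAlgClosed.exists_pow_nat_eq (δ j x)⁻¹ (Nat.pos_of_ne_zero (hd j))
    have hv0 : ∀ j, v j ≠ 0 := fun j h0 => by
      have := hv j
      rw [h0, zero_pow (hd j)] at this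
      exact inv_ne_zero (hne j) this.symm
    refine ⟨fun j => Units.mk0 (v j) (hv0 j), (hD _).mpr fun j => ?_⟩
    rw [map_mul, hδτ]
    change _ * v j ^ d j = 1
    rw [hv, mul_inv_cancel₀ (hne j)]

lemma exists_interpolation {X : Type} [AffVar X] (S : Finset X) (v : X → ℂ) :
    ∃ q ∈ reg X, ∀ x ∈ S, q x = v x := by
  classical
  have h : ∀ x y : X, ∃ p ∈ reg X, p x = 1 ∧ (x ≠ y → p y = 0) := by
    intro x y
    by_cases hxy : x = y
    · exact ⟨_, const_mem 1, rfl, fun h => absurd hxy h⟩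
    obtain ⟨p, hp, hne⟩ : ∃ p ∈ reg X, p x ≠ p y := by
      by_contra! hall
      exact hxy (sep _ _ hall)
    refine ⟨fun z => (p x - p y)⁻¹ * (p z - p y), mul_mem_reg (const_mem _)
      ((reg X).sub_mem hp (const_mem _)), inv_mul_cancel₀ (sub_ne_zero.mpr hne), fun _ => ?_⟩
    simp
  choose p hp hp1 hp0 using h
  refine ⟨fun z => ∑ x ∈ S, v x * ∏ y ∈ S.erase x, p x y z, sum_mem_reg _ fun x _ =>
    mul_mem_reg (const_mem _) (prod_mem_reg _ fun y _ => hp x y), fun z hz => ?_⟩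
  change ∑ x ∈ S, v x * ∏ y ∈ S.erase x, p x y z = v z
  rw [Finset.sum_eq_single z]
  · rw [Finset.prod_eq_one fun y _ => hp1 z y, mul_one]
  · intro x _ hxz
    rw [Finset.prod_eq_zero (f := fun y => p x y z) (Finset.mem_erase.mpr ⟨hxz.symm, hz⟩)
      (hp0 x z hxz), mul_zero]
  · exact fun h => absurd hz h

/-- A finite dimensional space of regular functions stable under translations by a commutative
group contains a common eigenvector. -/
lemma exists_common_eigenvector (hcomm : ∀ x y : E, x * y = y * x) (p : reg E) (hp : p ≠ 0) :
    ∃ φ ∈ translates p, φ ≠ 0 ∧ ∀ g, ∃ μ : ℂ, rTrans g φ = μ • φ := by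
  let P : ℕ → Prop := fun n => ∃ W : Submodule ℂ (reg E), W ≤ translates p ∧ W ≠ ⊥ ∧
    (∀ g, ∀ w ∈ W, rTrans g w ∈ W) ∧ Module.finrank ℂ W = n
  have hP : ∃ n, P n := ⟨_, translates p, le_rfl, fun h => hp (by
    have := mem_translates p
    rwa [h, Submodule.mem_bot] at this), fun g w hw => rTrans_mem_translates p g hw, rfl⟩
  classical
  obtain ⟨W, hWle, hW0, hWst, hWn⟩ := Nat.find_spec hP
  obtain ⟨φ, hφW, hφ0⟩ := W.exists_mem_ne_zero_of_ne_bot hW0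
  refine ⟨φ, hWle hφW, hφ0, fun g => ?_⟩
  have hfin : FiniteDimensional ℂ W := Submodule.finiteDimensional_of_le hWle
  have hnt : Nontrivial W := Submodule.nontrivial_iff_ne_bot.mpr hW0
  let R : Module.End ℂ W := (rTrans g).toLinearMap.restrict (hWst g)
  obtain ⟨μ, hμ⟩ := Module.End.exists_eigenvalue (K := ℂ) (V := W) R
  obtain ⟨w, hw⟩ := hμ.exists_hasEigenvector
  let W' : Submodule ℂ (reg E) := W ⊓ LinearMap.ker
    ((rTrans g).toLinearMap - μ • (LinearMap.id : reg E →ₗ[ℂ] reg E))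
  have hmem : ∀ v, v ∈ W' ↔ v ∈ W ∧ rTrans g v = μ • v := fun v => by
    refine and_congr Iff.rfl (LinearMap.mem_ker.trans ?_)
    exact sub_eq_zero
  have hle : W' ≤ W := inf_le_left
  have hW'P : P (Module.finrank ℂ W') := by
    refine ⟨W', hle.trans hWle, ?_, fun h v hv => ?_, rfl⟩
    · rw [Submodule.ne_bot_iff]
      exact ⟨w.1, (hmem _).mpr ⟨w.2, congrArg Subtype.val hw.apply_eq_smul⟩,
        fun h => hw.2 (Subtype.ext h)⟩
    · obtain ⟨h1, h2⟩ := (hmem v).mp hv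
      refine (hmem _).mpr ⟨hWst h v h1, ?_⟩
      rw [← rTrans_mul, hcomm, rTrans_mul, h2, map_smul]
  have hfr : Module.finrank ℂ W ≤ Module.finrank ℂ W' := by
    rw [hWn]; exact Nat.find_min' hP hW'P
  have heq : W' = W := Submodule.eq_of_le_of_finrank_le hle hfr
  exact ⟨μ, ((hmem φ).mp (heq ▸ hφW)).2⟩

/-- Characters of finite subgroups of a commutative group extend. -/
lemma exists_character_extension (hcomm : ∀ x y : E, x * y = y * x) (F : Subgroup E) [Finite F]
    (χ : F →* ℂˣ) : ∃ θ : E →* ℂˣ, (fun x => (θ x : ℂ)) ∈ reg E ∧ ∀ f : F, θ f = χ f := by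
  classical
  have := Fintype.ofFinite F
  obtain ⟨q, hq, hqF⟩ := exists_interpolation (Finset.univ.image fun f : F => (f : E))
    (fun x => if hx : x ∈ F then (χ ⟨x, hx⟩ : ℂ) else 0)
  have hqF' : ∀ f : F, q f = χ f := fun f => by
    rw [hqF _ (Finset.mem_image_of_mem _ (Finset.mem_univ f)), dif_pos f.2]
  let p₀ : reg E := ∑ f : F, ((χ f⁻¹ : ℂˣ) : ℂ) • rTrans (f : E) ⟨q, hq⟩
  have hp₀ : ∀ x, p₀.1 x = ∑ f : F, ((χ f⁻¹ : ℂˣ) : ℂ) * q (x * f) := fun x => by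
    have h1 := map_sum (ev x) (fun f : F => ((χ f⁻¹ : ℂˣ) : ℂ) • rTrans (f : E) ⟨q, hq⟩) Finset.univ
    simp only [ev_apply] at h1
    exact h1
  have hp₀1 : p₀.1 1 = Fintype.card F := by
    rw [hp₀]
    simp only [one_mul, hqF', map_inv, Units.inv_mul]
    simp
  have hp₀ne : p₀ ≠ 0 := fun h => by
    rw [h] at hp₀1
    exact Nat.cast_ne_zero.mpr Fintype.card_ne_zero hp₀1.symm
  have hp₀F : ∀ f : F, rTrans (f : E) p₀ = (χ f : ℂ) • p₀ := by
    intro f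
    refine Subtype.ext (funext fun x => ?_)
    change p₀.1 (x * f) = χ f * p₀.1 x
    rw [hp₀, hp₀, Finset.mul_sum, ← Equiv.sum_comp (Equiv.mulLeft f)
      (fun g : F => (χ f : ℂ) * (((χ g⁻¹ : ℂˣ) : ℂ) * q (x * g)))]
    refine Finset.sum_congr rfl fun g _ => ?_
    simp only [Equiv.coe_mulLeft, mul_inv_rev, map_mul, map_inv, Units.val_mul, Subgroup.coe_mul]
    rw [mul_assoc x]
    have := (χ f).mul_inv
    linear_combination (-((χ g)⁻¹ : ℂˣ) * q (x * (f * g)) : ℂ) * this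
  obtain ⟨φ, hφt, hφ0, hφ⟩ := exists_common_eigenvector hcomm p₀ hp₀ne
  have hφF : ∀ f : F, rTrans (f : E) φ = (χ f : ℂ) • φ := by
    intro f
    clear hφ0 hφ
    induction hφt using Submodule.span_induction with
    | mem w hw =>
      obtain ⟨g, rfl⟩ := hw
      change rTrans (f : E) (rTrans g p₀) = _ • rTrans g p₀
      rw [← rTrans_mul, hcomm, rTrans_mul, hp₀F, map_smul]
    | zero => simp
    | add v w _ _ hv hw => rw [map_add, hv, hw, smul_add]
    | smul c w _ hw => rw [map_smul, hw, smul_comm]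
  choose μ hμ using hφ
  have hμinj : ∀ a b : ℂ, a • φ = b • φ → a = b := fun a b h => smul_left_injective ℂ hφ0 h
  let θ : E →* ℂ :=
    { toFun := μ
      map_one' := hμinj _ _ (by rw [← hμ, rTrans_one, one_smul])
      map_mul' := fun x y => hμinj _ _ (by
        rw [← hμ, rTrans_mul, hμ y, map_smul, hμ x, smul_smul, mul_comm]) }
  obtain ⟨x₀, hx₀⟩ := Function.ne_iff.mp fun h0 : φ.1 = 0 => hφ0 (Subtype.ext h0)
  refine ⟨θ.toHomUnits, ?_, fun f => Units.ext (hμinj _ _ ((hμ f).symm.trans (hφF f)))⟩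
  have hθ : ∀ x, ((θ.toHomUnits x : ℂˣ) : ℂ) = φ.1 (x₀ * x) * (φ.1 x₀)⁻¹ := by
    intro x
    have : φ.1 (x₀ * x) = μ x * φ.1 x₀ := congrFun (congrArg Subtype.val (hμ x)) x₀
    rw [this, mul_inv_cancel_right₀ hx₀]
    rfl
  simp only [hθ]
  exact mul_mem_reg (((isReg_const x₀).mul isReg_id) _ φ.2) (const_mem _)

/-- Homomorphisms from finite subgroups of a commutative group to a torus extend. -/
theorem exists_torus_extension (hcomm : ∀ x y : E, x * y = y * x) (F : Subgroup E) [Finite F]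
    {k : ℕ} (χ : F →* (Fin k → ℂˣ)) : ∃ θ : E →* (Fin k → ℂˣ), IsReg θ ∧ ∀ f : F, θ f = χ f := by
  choose θ hθ hθF using fun j => exists_character_extension hcomm F
    ((Pi.evalMonoidHom (fun _ : Fin k => ℂˣ) j).comp χ)
  refine ⟨MonoidHom.pi θ, isReg_torus hθ fun j => ?_, fun f => funext fun j => hθF j f⟩
  have : ∀ x, (((MonoidHom.pi θ x j)⁻¹ : ℂˣ) : ℂ) = θ j x⁻¹ := fun x => by rw [map_inv]; rfl
  simp only [this]
  exact isReg_id.inv _ (hθ j)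

end characters

/-! ### Quotients by finite normal subgroups -/

section finiteQuotient

variable {B : Type} [Group B] [AffGrp B] (Γ : Subgroup B)

/-- The functions on the quotient which are regular upstairs. -/
def quotReg : Subalgebra ℂ (B ⧸ Γ → ℂ) := (reg B).comap (pull (QuotientGroup.mk : B → B ⧸ Γ))

/-- Pullback of functions from the quotient. -/
def quotPull : quotReg Γ →ₐ[ℂ] reg B :=
  ((pull (QuotientGroup.mk : B → B ⧸ Γ)).comp (quotReg Γ).val).codRestrict _ fun p => p.2

lemma quotPull_injective : Function.Injective (quotPull Γ) := fun p q h =>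
  Subtype.ext (funext fun z => by
    obtain ⟨x, rfl⟩ := QuotientGroup.mk_surjective z
    exact congrFun (congrArg Subtype.val h) x)

lemma exists_quotPull_eq (p : reg B) (h : ∀ γ : Γ, rTrans (γ : B) p = p) :
    ∃ q, quotPull Γ q = p := by
  have hp : ∀ x y : B, (QuotientGroup.leftRel Γ).r x y → p.1 x = p.1 y := by
    intro x y hxy
    have h1 := congrFun (congrArg Subtype.val (h ⟨x⁻¹ * y, QuotientGroup.leftRel_apply.mp hxy⟩)) x
    rw [rTrans_apply, mul_inv_cancel_left] at h1
    exact h1.symm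
  exact ⟨⟨fun z => Quotient.lift p.1 hp z, p.2⟩, rfl⟩

/-- The action of a subgroup on regular functions by translations. -/
@[reducible] def transAction : MulSemiringAction Γ (reg B) where
  smul γ p := rTrans (γ : B) p
  one_smul p := rTrans_one p
  mul_smul g h p := rTrans_mul (g : B) h p
  smul_zero γ := map_zero (rTrans (γ : B))
  smul_add γ := map_add (rTrans (γ : B))
  smul_one γ := map_one (rTrans (γ : B))
  smul_mul γ := map_mul (rTrans (γ : B))

variable [Finite Γ]

lemma isIntegral_quotPull : (quotPull Γ).toRingHom.IsIntegral := by
  let _ := transAction Γ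
  let _ : Algebra (quotReg Γ) (reg B) := (quotPull Γ).toRingHom.toAlgebra
  have : Algebra.IsInvariant (quotReg Γ) (reg B) Γ := ⟨fun p h => exists_quotPull_eq Γ p h⟩
  exact (Algebra.IsInvariant.isIntegral (quotReg Γ) (reg B) Γ).isIntegral

lemma quotReg_fg : (quotReg Γ).FG := by
  let _ : Algebra (quotReg Γ) (reg B) := (quotPull Γ).toRingHom.toAlgebra
  have : IsScalarTower ℂ (quotReg Γ) (reg B) := IsScalarTower.of_algebraMap_eq fun _ => rfl
  have : Algebra.IsIntegral (quotReg Γ) (reg B) := ⟨isIntegral_quotPull Γ⟩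
  have : Algebra.FiniteType (quotReg Γ) (reg B) :=
    Algebra.FiniteType.of_restrictScalars_finiteType ℂ _ _
  have hfin : Module.Finite (quotReg Γ) (reg B) := Algebra.IsIntegral.finite
  rw [← Subalgebra.fg_top]
  exact fg_of_fg_of_fg ℂ (quotReg Γ) (reg B) Algebra.FiniteType.out hfin.fg_top
    (quotPull_injective Γ)

lemma exists_average (p : reg B) : ∃ q : quotReg Γ, ∀ x : B,
    q.1 (x : B ⧸ Γ) = (Nat.card Γ : ℂ)⁻¹ * ∑ᶠ γ : Γ, p.1 (x * γ) := by
  have := Fintype.ofFinite Γ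
  let s : reg B := (Nat.card Γ : ℂ)⁻¹ • ∑ γ : Γ, rTrans (γ : B) p
  have hs : ∀ x, s.1 x = (Nat.card Γ : ℂ)⁻¹ * ∑ᶠ γ : Γ, p.1 (x * γ) := by
    intro x
    have h1 := map_sum (ev x) (fun γ : Γ => rTrans (γ : B) p) Finset.univ
    rw [finsum_eq_sum_of_fintype]
    exact congrArg ((Nat.card Γ : ℂ)⁻¹ * ·) h1
  obtain ⟨q, hq⟩ := exists_quotPull_eq Γ s fun γ => by
    refine (map_smul _ _ _).trans (congrArg _ ?_)
    rw [map_sum]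
    refine Fintype.sum_equiv (Equiv.mulLeft γ) _ _ fun g => ?_
    rw [← rTrans_mul]; rfl
  exact ⟨q, fun x => by rw [← hs, ← hq]; rfl⟩

lemma exists_quotReg_ne {x y : B} (h : (x : B ⧸ Γ) ≠ y) :
    ∃ q : quotReg Γ, q.1 (x : B ⧸ Γ) ≠ q.1 y := by
  classical
  have := Fintype.ofFinite Γ
  obtain ⟨p, hp, hpv⟩ := exists_interpolation (Finset.univ.image (fun γ : Γ => x * γ) ∪
    Finset.univ.image (fun γ : Γ => y * γ)) (fun z => if (z : B ⧸ Γ) = x then 1 else 0)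
  obtain ⟨q, hq⟩ := exists_average Γ ⟨p, hp⟩
  refine ⟨q, ?_⟩
  have hx : ∀ γ : Γ, p (x * γ) = 1 := fun γ => by
    rw [hpv _ (Finset.mem_union_left _ (Finset.mem_image_of_mem _ (Finset.mem_univ γ))), if_pos]
    exact QuotientGroup.mk_mul_of_mem x γ.2
  have hy : ∀ γ : Γ, p (y * γ) = 0 := fun γ => by
    rw [hpv _ (Finset.mem_union_right _ (Finset.mem_image_of_mem _ (Finset.mem_univ γ))), if_neg]
    rw [QuotientGroup.mk_mul_of_mem y γ.2]
    exact h.symm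
  rw [hq, hq]
  simp [hx, hy, finsum_eq_sum_of_fintype]

lemma exists_quotReg_point (ψ : quotReg Γ →ₐ[ℂ] ℂ) :
    ∃ z : B ⧸ Γ, ∀ p, ψ p = p.1 z := by
  let _ : Algebra (quotReg Γ) (reg B) := (quotPull Γ).toRingHom.toAlgebra
  have : Algebra.IsIntegral (quotReg Γ) (reg B) := ⟨isIntegral_quotPull Γ⟩
  have hmax : (RingHom.ker ψ).IsMaximal := RingHom.ker_isMaximal_of_surjective ψ fun c =>
    ⟨algebraMap ℂ _ c, ψ.commutes c⟩
  obtain ⟨Q, hQ, hQc⟩ := Ideal.exists_ideal_over_maximal_of_isIntegral (S := reg B)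
    (RingHom.ker ψ) (by
      rw [(RingHom.injective_iff_ker_eq_bot (algebraMap (quotReg Γ) (reg B))).mp
        (quotPull_injective Γ)]
      exact bot_le)
  obtain ⟨φ, hφ⟩ := exists_algHom_ker_eq Q
  obtain ⟨x, hx⟩ := AffVar.point φ
  refine ⟨x, fun p => ?_⟩
  have h1 : p - algebraMap ℂ _ (ψ p) ∈ RingHom.ker ψ := by
    rw [RingHom.mem_ker, map_sub, AlgHom.commutes]
    exact sub_self _
  rw [← hQc, Ideal.mem_comap, ← hφ, hx] at h1
  exact (sub_eq_zero.mp h1).symm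

/-- The quotient of an affine algebraic group by a finite normal subgroup. -/
@[reducible] def quotVar : AffVar (B ⧸ Γ) where
  functions := quotReg Γ
  fg := quotReg_fg Γ
  sep := by
    intro x y h
    obtain ⟨x, rfl⟩ := QuotientGroup.mk_surjective x
    obtain ⟨y, rfl⟩ := QuotientGroup.mk_surjective y
    by_contra hne
    obtain ⟨q, hq⟩ := exists_quotReg_ne Γ hne
    exact hq (h _ q.2)
  point := exists_quotReg_point Γ

lemma isReg_quotMk : let _ := quotVar Γ; IsReg (QuotientGroup.mk : B → B ⧸ Γ) := fun _ hp => hp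

lemma isReg_quotLift {K : Type} [AffVar K] {f : B ⧸ Γ → K} (hf : IsReg fun x : B => f x) :
    let _ := quotVar Γ; IsReg f := fun p hp => hf p hp

variable [Γ.Normal]

/-- The quotient of an affine algebraic group by a finite normal subgroup is an affine algebraic
group. -/
@[reducible] def quotGrp : AffGrp (B ⧸ Γ) :=
  let _ : AffVar (B ⧸ Γ) := quotVar Γ
  { toAffVar := quotVar Γ
    inv_reg := fun p hp => isReg_id.inv _ hp
    mul_reg := by
      intro p hp
      have hp' : p ∈ quotReg Γ := hp
      obtain ⟨n, a, b, hab⟩ := exists_sum_of_mem_prod (AffGrp.mul_reg _ hp')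
      choose a' ha' using fun i => exists_average Γ (a i)
      choose b' hb' using fun i => exists_average Γ (b i)
      have := Fintype.ofFinite Γ
      have hform : (fun z : (B ⧸ Γ) × (B ⧸ Γ) => p (z.1 * z.2)) =
          fun z => ∑ i, (a' i).1 z.1 * (b' i).1 z.2 := by
        funext ⟨x, y⟩
        obtain ⟨x, rfl⟩ := QuotientGroup.mk_surjective x
        obtain ⟨y, rfl⟩ := QuotientGroup.mk_surjective y
        have h1 : ∀ γ γ' : Γ, ∑ i, (a i).1 (x * γ) * (b i).1 (y * γ') =
            p ((x : B ⧸ Γ) * (y : B ⧸ Γ)) := by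
          intro γ γ'
          rw [← hab]
          change p ((x * γ : B) * (y * γ' : B)) = _
          rw [QuotientGroup.mk_mul_of_mem x γ.2, QuotientGroup.mk_mul_of_mem y γ'.2]
        have h2 : ∑ γ : Γ, ∑ γ' : Γ, ∑ i, (a i).1 (x * γ) * (b i).1 (y * γ') =
            (Nat.card Γ : ℂ) * ((Nat.card Γ : ℂ) * p ((x : B ⧸ Γ) * (y : B ⧸ Γ))) := by
          simp [h1]
        have hc : (Nat.card Γ : ℂ) ≠ 0 := Nat.cast_ne_zero.mpr Nat.card_pos.ne'
        simp only [ha', hb', finsum_eq_sum_of_fintype]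
        have h3 : ∀ i, (Nat.card Γ : ℂ)⁻¹ * (∑ γ : Γ, (a i).1 (x * γ)) *
            ((Nat.card Γ : ℂ)⁻¹ * ∑ γ : Γ, (b i).1 (y * γ)) = (Nat.card Γ : ℂ)⁻¹ *
            ((Nat.card Γ : ℂ)⁻¹ * ∑ γ : Γ, ∑ γ' : Γ, (a i).1 (x * γ) * (b i).1 (y * γ')) := by
          intro i
          rw [← Finset.sum_mul_sum]; ring
        have h4 : ∑ i, ∑ γ : Γ, ∑ γ' : Γ, (a i).1 (x * γ) * (b i).1 (y * γ') =
            ∑ γ : Γ, ∑ γ' : Γ, ∑ i, (a i).1 (x * γ) * (b i).1 (y * γ') := by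
          rw [Finset.sum_comm]
          exact Finset.sum_congr rfl fun γ _ => Finset.sum_comm
        rw [Finset.sum_congr rfl fun i _ => h3 i, ← Finset.mul_sum, ← Finset.mul_sum, h4, h2,
          inv_mul_cancel_left₀ hc, inv_mul_cancel_left₀ hc]
      rw [hform]
      exact sum_mem_reg _ fun i _ => mul_mem_reg (isReg_fst _ (a' i).2) (isReg_snd _ (b' i).2) }

end finiteQuotient

end AffVar

/-! ### Affine algebraic groups in coordinates -/

namespace AffVar

lemma add_mem_reg {X : Type} [AffVar X] {p q : X → ℂ} (hp : p ∈ reg X) (hq : q ∈ reg X) :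
    (fun x => p x + q x) ∈ reg X := add_mem hp hq

lemma eval_mem_reg {X : Type} [AffVar X] {n : ℕ} {f : X → Pt n}
    (hf : ∀ i, (fun x => f x i) ∈ reg X) (P : MvPolynomial (Fin n) ℂ) :
    (fun x => eval (f x) P) ∈ reg X := by
  induction P using MvPolynomial.induction_on with
  | C c => simpa using const_mem c
  | add P Q hP hQ => simpa using add_mem_reg hP hQ
  | mul_X P i hP => simpa using mul_mem_reg hP (hf i)

end AffVar

open AffVar

namespace AffAlgGroup

variable (G : AffAlgGroup)

/-- Restriction of polynomials to an affine algebraic group. -/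
def restrictPoly : MvPolynomial (Fin G.n) ℂ →ₐ[ℂ] (G.Gp → ℂ) := aeval fun i (x : G.Gp) => x.1 i

@[simp] lemma restrictPoly_apply (P : MvPolynomial (Fin G.n) ℂ) (x : G.Gp) :
    G.restrictPoly P x = eval x.1 P := by
  induction P using MvPolynomial.induction_on with
  | C c => simp [restrictPoly]
  | add P Q hP hQ => simp [hP, hQ]
  | mul_X P i hP => simp [hP]; simp [restrictPoly]

instance : AffVar G.Gp where
  functions := G.restrictPoly.range
  fg := by
    rw [← Algebra.map_top]
    exact Algebra.FiniteType.out.map _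
  sep x y h := Subtype.ext <| funext fun i => by simpa using h _ ⟨X i, rfl⟩
  point ψ := by
    let φ : MvPolynomial (Fin G.n) ℂ →ₐ[ℂ] ℂ := ψ.comp G.restrictPoly.rangeRestrict
    have hφ : ∀ P, φ P = eval (fun i => φ (X i)) P := by
      intro P
      rw [← MvPolynomial.coe_aeval_eq_eval]
      exact DFunLike.congr_fun (MvPolynomial.algHom_ext (by simp) : φ = aeval fun i => φ (X i)) P
    have hmem : (fun i => φ (X i)) ∈ G.carrier := by
      obtain ⟨S, hS⟩ := G.isAlgebraic
      rw [hS]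
      intro P hP
      rw [← hφ]
      have : G.restrictPoly.rangeRestrict P = 0 := by
        refine Subtype.ext (funext fun x => ?_)
        have hx : x.1 ∈ {x | ∀ p ∈ S, eval x p = 0} := hS ▸ x.2
        exact (G.restrictPoly_apply P x).trans (hx P hP)
      simp [φ, this]
    refine ⟨⟨_, hmem⟩, ?_⟩
    rintro ⟨_, P, rfl⟩
    exact (hφ P).trans (G.restrictPoly_apply P ⟨_, hmem⟩).symm

variable {G}

lemma mem_reg_iff {p : G.Gp → ℂ} :
    p ∈ reg G.Gp ↔ ∃ P : MvPolynomial (Fin G.n) ℂ, ∀ x : G.Gp, p x = eval x.1 P := by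
  constructor
  · rintro ⟨P, rfl⟩; exact ⟨P, G.restrictPoly_apply P⟩
  · rintro ⟨P, hP⟩; exact ⟨P, funext fun x => by rw [hP]; exact G.restrictPoly_apply P x⟩

lemma coord_mem (i : Fin G.n) : (fun x : G.Gp => x.1 i) ∈ reg G.Gp :=
  mem_reg_iff.mpr ⟨X i, by simp⟩

lemma isReg_of_coord {Y : Type} [AffVar Y] {f : Y → G.Gp}
    (h : ∀ i, (fun y => (f y).1 i) ∈ reg Y) : IsReg f := by
  intro p hp
  obtain ⟨P, hP⟩ := mem_reg_iff.mp hp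
  simp only [hP]
  exact eval_mem_reg h P

lemma append_mem_reg {Y : Type} [AffVar Y] {a b : ℕ} {f : Y → Pt a} {g : Y → Pt b}
    (hf : ∀ i, (fun y => f y i) ∈ reg Y) (hg : ∀ i, (fun y => g y i) ∈ reg Y) (i : Fin (a + b)) :
    (fun y => (Fin.append (f y) (g y) : Pt (a + b)) i) ∈ reg Y := by
  induction i using Fin.addCases with
  | left i => simpa using hf i
  | right i => simpa using hg i

@[simp] lemma _root_.Pt.left_append {a b : ℕ} (x : Pt a) (y : Pt b) :
    Pt.left (Fin.append x y : Pt (a + b)) = x := by funext i; simp [Pt.left]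

@[simp] lemma _root_.Pt.right_append {a b : ℕ} (x : Pt a) (y : Pt b) :
    Pt.right (Fin.append x y : Pt (a + b)) = y := by funext i; simp [Pt.right]

lemma _root_.Pt.append_left_right {a b : ℕ} (z : Pt (a + b)) :
    (Fin.append (Pt.left z) (Pt.right z) : Pt (a + b)) = z := by
  funext i
  induction i using Fin.addCases with
  | left i => simp [Pt.left]
  | right i => simp [Pt.right]

instance : AffGrp G.Gp where
  inv_reg := isReg_of_coord fun i => by
    obtain ⟨P, hP⟩ := G.inv_regular
    exact mem_reg_iff.mpr ⟨P i, fun x => hP x.1 x.2 i⟩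
  mul_reg := isReg_of_coord fun i => by
    obtain ⟨P, hP⟩ := G.mul_regular
    have : (fun z : G.Gp × G.Gp => (z.1 * z.2).1 i) =
        fun z => eval (Fin.append z.1.1 z.2.1 : Pt (G.n + G.n)) (P i) := by
      funext z
      have := hP (Fin.append z.1.1 z.2.1) (by simpa using ⟨z.1.2, z.2.2⟩) i
      simp only [Pt.left_append, Pt.right_append] at this
      exact this
    rw [this]
    exact eval_mem_reg (append_mem_reg (fun i => isReg_fst _ (coord_mem i))
      (fun i => isReg_snd _ (coord_mem i))) _

instance : IsEuclid G.Gp where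
  inducing := by
    refine ⟨le_antisymm ?_ ?_⟩
    · rw [← continuous_iff_le_induced]
      refine continuous_pi fun p => ?_
      obtain ⟨P, hP⟩ := mem_reg_iff.mp p.2
      rw [show p.1 = fun x : G.Gp => eval x.1 P from funext hP]
      exact (MvPolynomial.continuous_eval P).comp continuous_subtype_val
    · let _ : TopologicalSpace G.Gp := .induced (fun x (p : reg G.Gp) => p.1 x) inferInstance
      have h0 : Continuous fun (x : G.Gp) (p : reg G.Gp) => p.1 x := continuous_induced_dom
      have h : Continuous fun x : G.Gp => x.1 := continuous_pi fun i =>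
        (continuous_apply (⟨_, coord_mem i⟩ : reg G.Gp)).comp h0
      exact continuous_iff_le_induced.mp h

lemma exists_isAlgebraicSet {C : Set G.Gp} (hC : IsZClosed C) :
    ∃ V : Set (Pt G.n), IsAlgebraicSet V ∧ ∀ x : Pt G.n, x ∈ V ↔ ∃ h : x ∈ G.carrier,
      (⟨x, h⟩ : G.Gp) ∈ C := by
  obtain ⟨S, hS, rfl⟩ := hC
  obtain ⟨T, hT⟩ := G.isAlgebraic
  refine ⟨_, ⟨T ∪ {P | G.restrictPoly P ∈ S}, rfl⟩, fun x => ?_⟩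
  simp only [Set.mem_union, Set.mem_ofPred_eq, or_imp, forall_and]
  have hx : x ∈ G.carrier ↔ ∀ P ∈ T, eval x P = 0 := by rw [hT]; rfl
  rw [← hx]
  constructor
  · rintro ⟨h, h'⟩
    refine ⟨h, fun p hp => ?_⟩
    obtain ⟨P, rfl⟩ := hS hp
    exact (G.restrictPoly_apply P ⟨x, h⟩).trans (h' P hp)
  · rintro ⟨h, h'⟩
    exact ⟨h, fun P hP => (G.restrictPoly_apply P ⟨x, h⟩).symm.trans (h' _ hP)⟩

lemma IsConnected.isDomain (hG : G.IsConnected) : IsDomain (reg G.Gp) := by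
  refine isDomain_of_connected fun C D hC hD hu hi => ?_
  obtain ⟨V, hV, hV'⟩ := exists_isAlgebraicSet hC
  obtain ⟨W, hW, hW'⟩ := exists_isAlgebraicSet hD
  have key := hG V W hV hW ?_ ?_
  · refine key.imp (fun h => ?_) fun h => ?_
    · exact Set.eq_univ_of_forall fun x => ((hV' x.1).mp (h x.2)).2
    · exact Set.eq_univ_of_forall fun x => ((hW' x.1).mp (h x.2)).2
  · intro x hx
    have : (⟨x, hx⟩ : G.Gp) ∈ C ∪ D := hu ▸ Set.mem_univ _
    exact this.imp (fun h => (hV' x).mpr ⟨hx, h⟩) fun h => (hW' x).mpr ⟨hx, h⟩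
  · refine Set.eq_empty_of_forall_notMem ?_
    rintro x ⟨hx, h1, h2⟩
    have : (⟨x, hx⟩ : G.Gp) ∈ C ∩ D := ⟨((hV' x).mp h1).2, ((hW' x).mp h2).2⟩
    rw [hi] at this
    exact this

lemma IsTorus.exists_mulEquiv (hG : G.IsTorus) :
    ∃ (k : ℕ) (τ : (Fin k → ℂˣ) ≃* G.Gp), IsReg τ ∧ IsReg τ.symm := by
  obtain ⟨k, φ, hmem, hinj, hsurj, -, hmul, hP, hQ⟩ := hG
  let τ₀ : (Fin k → ℂˣ) →* G.Gp :=
    MonoidHom.mk' (fun u => ⟨φ u, hmem u⟩) fun u v => Subtype.ext (hmul u v)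
  let τ : (Fin k → ℂˣ) ≃* G.Gp := MulEquiv.ofBijective τ₀
    ⟨fun u v h => hinj (congrArg Subtype.val h), fun x => by
      obtain ⟨u, hu⟩ := hsurj x.1 x.2
      exact ⟨u, Subtype.ext hu⟩⟩
  have hτ : ∀ u, (τ u).1 = φ u := fun u => rfl
  have hcoord : ∀ j, (fun x => ((τ.symm x j : ℂˣ) : ℂ)) ∈ reg G.Gp := by
    intro j
    obtain ⟨Q, hQ⟩ := hQ j
    refine mem_reg_iff.mpr ⟨Q, fun x => ?_⟩
    rw [hQ, ← hτ, MulEquiv.apply_symm_apply]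
  refine ⟨k, τ, isReg_of_coord fun i => ?_, isReg_torus hcoord fun j => ?_⟩
  · obtain ⟨P, hP⟩ := hP i
    simp only [hτ, hP]
    clear hP
    induction P using MvPolynomial.induction_on with
    | C c => simpa using const_mem c
    | add P Q hP hQ => simpa using add_mem_reg hP hQ
    | mul_X P i hP =>
      simp only [map_mul, eval_X]
      refine mul_mem_reg hP ?_
      cases i with
      | inl j => exact coord_mem_reg j
      | inr j => exact coord_inv_mem_reg j
  · have : (fun x => (((τ.symm x j)⁻¹ : ℂˣ) : ℂ)) = fun x : G.Gp => ((τ.symm x⁻¹ j : ℂˣ) : ℂ) := by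
      funext x; rw [map_inv]; rfl
    have h := isReg_id.inv _ (hcoord j)
    rw [← this] at h
    simpa using h

lemma IsUnipotent.exists_rep (hG : G.IsUnipotent) : Nonempty (UnipotentRep G.Gp) := by
  obtain ⟨m, φ, ⟨P, hP⟩, hinj, htri, hmul⟩ := hG
  let M : G.Gp → Matrix (Fin m) (Fin m) ℂ := fun x => Matrix.of fun i j => matEntry (φ x.1) i j
  have hM : ∀ x y, M (x * y) = M x * M y := by
    intro x y
    ext i j
    change matEntry (φ (G.mul x.1 y.1)) i j = _
    rw [hmul x.1 x.2 y.1 y.2, Matrix.mul_apply]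
    simp [M, matEntry, matMulPt]
  have hdet : ∀ x, (M x).det = 1 := by
    intro x
    have ht : (M x).BlockTriangular id := fun i j hij => (htri x.1 x.2).2 i j hij
    rw [Matrix.det_of_isUpperTriangular ht]
    exact Finset.prod_eq_one fun i _ => (htri x.1 x.2).1 i
  have hone : M 1 = 1 := by
    have h : IsUnit (M 1) := (Matrix.isUnit_iff_isUnit_det _).mpr (by simp [hdet])
    have := hM 1 1
    rw [one_mul] at this
    exact h.mul_left_cancel (by rw [← this, mul_one])
  refine ⟨⟨m, { toFun := M, map_one' := hone, map_mul' := hM }, fun i j => ?_, ?_,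
    fun x => (htri x.1 x.2).1, fun x => (htri x.1 x.2).2⟩⟩
  · exact mem_reg_iff.mpr ⟨P (finProdFinEquiv (i, j)), fun x => hP x.1 x.2 _⟩
  · intro x y h
    refine Subtype.ext (hinj x.2 y.2 (funext fun k => ?_))
    obtain ⟨⟨i, j⟩, rfl⟩ := finProdFinEquiv.surjective k
    exact congrFun (congrFun h i) j

end AffAlgGroup

namespace AlgGroupHom

variable {G H : AffAlgGroup}

@[simp] lemma toGpHom_val (f : AlgGroupHom G H) (x : G.Gp) : (f.toGpHom x).1 = f.toFun x.1 := rfl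

lemma isReg (f : AlgGroupHom G H) : IsReg f.toGpHom := by
  obtain ⟨P, hP⟩ := f.regular
  exact AffAlgGroup.isReg_of_coord fun i =>
    AffAlgGroup.mem_reg_iff.mpr ⟨P i, fun x => hP x.1 x.2 i⟩

lemma exists_of_isReg (f : G.Gp →* H.Gp) (hf : IsReg f) :
    ∃ F : AlgGroupHom G H, F.toGpHom = f := by
  classical
  choose P hP using fun i => AffAlgGroup.mem_reg_iff.mp (hf _ (AffAlgGroup.coord_mem i))
  have key : ∀ x (hx : x ∈ G.carrier), (fun i => eval x (P i)) = (f ⟨x, hx⟩).1 :=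
    fun x hx => funext fun i => (hP i ⟨x, hx⟩).symm
  refine ⟨⟨fun x i => eval x (P i), fun {x} hx => ?_, fun {x y} hx hy => ?_,
    ⟨P, fun _ _ _ => rfl⟩⟩, ?_⟩
  · rw [key x hx]; exact (f ⟨x, hx⟩).2
  · rw [key x hx, key y hy, key _ (G.mul_mem hx hy)]
    exact congrArg Subtype.val (f.map_mul ⟨x, hx⟩ ⟨y, hy⟩)
  · ext1 x
    exact Subtype.ext (key x.1 x.2)

end AlgGroupHom

namespace AlgSubgroup

variable {G : AffAlgGroup} (H : AlgSubgroup G)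

lemma isReg_incl : IsReg H.incl :=
  AffAlgGroup.isReg_of_coord fun i => AffAlgGroup.coord_mem (G := H.toGrp) i

lemma incl_injective : Function.Injective H.incl := fun _ _ h =>
  Subtype.ext (congrArg (fun x : G.Gp => x.1) h)

variable {H}

lemma isReg_codRestrict {Y : Type} [AffVar Y] {f : Y → G.Gp} (hf : IsReg f)
    (h : ∀ y, (f y).1 ∈ H.carrier) : IsReg (Y := H.toGrp.Gp) fun y => ⟨(f y).1, h y⟩ :=
  AffAlgGroup.isReg_of_coord fun i =>
    hf (fun x => x.1 i) (AffAlgGroup.coord_mem (G := G) i)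

end AlgSubgroup

namespace AffVar

lemma exists_affAlgGroup (H : Type) [Group H] [AffGrp H] :
    ∃ (G : AffAlgGroup) (e : H ≃* G.Gp), IsReg e ∧ IsReg e.symm := by
  obtain ⟨n, ψ, hψ⟩ := Algebra.FiniteType.iff_quotient_mvPolynomial''.mp
    (inferInstance : Algebra.FiniteType ℂ (reg H))
  let c : H → Pt n := fun x i => (ψ (X i)).1 x
  have hc : ∀ P x, (ψ P).1 x = eval (c x) P := by
    intro P x
    induction P using MvPolynomial.induction_on with
    | C a => rw [← MvPolynomial.algebraMap_eq, AlgHom.commutes]; simp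
    | add P Q hP hQ => simp [hP, hQ]
    | mul_X P i hP => simp [hP, c]
  have hinj : Function.Injective c := fun x y h => sep x y fun p hp => by
    obtain ⟨P, hP⟩ := hψ ⟨p, hp⟩
    rw [← show (ψ P).1 = p from congrArg Subtype.val hP, hc, hc, h]
  have hinv := Function.leftInverse_invFun hinj
  have hr : ∀ {x}, x ∈ Set.range c → ∃ h, Function.invFun c x = h ∧ c h = x := by
    rintro _ ⟨h, rfl⟩; exact ⟨h, hinv h, rfl⟩
  have hpoly : ∀ p ∈ reg H, ∃ P, ∀ x, p x = eval (c x) P := fun p hp => by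
    obtain ⟨P, hP⟩ := hψ ⟨p, hp⟩
    exact ⟨P, fun x => by rw [← hc, hP]⟩
  let G : AffAlgGroup :=
    { n := n
      carrier := Set.range c
      isAlgebraic := by
        refine ⟨{P | ψ P = 0}, Set.Subset.antisymm ?_ fun x hx => ?_⟩
        · rintro _ ⟨h, rfl⟩ P hP
          rw [← hc, show ψ P = 0 from hP]; rfl
        · have hle : RingHom.ker ψ ≤ RingHom.ker (aeval (R := ℂ) x) := fun P hP => by
            simpa [RingHom.mem_ker, MvPolynomial.coe_aeval_eq_eval] using hx P hP
          let χ : reg H →ₐ[ℂ] ℂ := AlgHom.liftOfSurjective ψ hψ (aeval x) hle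
          have hχ : ∀ P, χ (ψ P) = aeval x P := fun P => AlgHom.liftOfSurjective_apply ..
          obtain ⟨h, hh⟩ := point χ
          refine ⟨h, funext fun i => ?_⟩
          rw [show c h i = (ψ (X i)).1 h from rfl, ← hh, hχ, aeval_X]
      one := c 1
      one_mem := ⟨1, rfl⟩
      mul := fun x y => c (Function.invFun c x * Function.invFun c y)
      inv := fun x => c (Function.invFun c x)⁻¹
      mul_mem := fun _ _ => ⟨_, rfl⟩
      inv_mem := fun _ => ⟨_, rfl⟩
      mul_assoc' := fun _ _ _ => by simp only [hinv _, mul_assoc]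
      one_mul' := fun {x} hx => by
        obtain ⟨h, h1, rfl⟩ := hr hx
        simp only [hinv _, one_mul]
      mul_one' := fun {x} hx => by
        obtain ⟨h, h1, rfl⟩ := hr hx
        simp only [hinv _, mul_one]
      inv_mul' := fun {x} hx => by
        simp only [hinv _, inv_mul_cancel]
      mul_regular := by
        have : ∀ i, ∃ P : MvPolynomial (Fin (n + n)) ℂ, ∀ x y,
            c (x * y) i = eval (Fin.append (c x) (c y) : Pt (n + n)) P := by
          intro i
          obtain ⟨m, a, b, hab⟩ := exists_sum_of_mem_prod (AffGrp.mul_reg _ (ψ (X i)).2)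
          choose A hA using fun j => hpoly _ (a j).2
          choose B hB using fun j => hpoly _ (b j).2
          refine ⟨∑ j, rename (Fin.castAdd n) (A j) * rename (Fin.natAdd n) (B j), fun x y => ?_⟩
          refine (hab x y).trans ?_
          simp only [map_sum, map_mul, eval_rename, hA, hB]
          refine Finset.sum_congr rfl fun j _ => ?_
          congr 3
          · funext i; exact (Fin.append_left ..).symm
          · funext i; exact (Fin.append_right ..).symm
        choose P hP using this
        refine ⟨P, ?_⟩
        rintro z ⟨⟨x, hx⟩, y, hy⟩ i
        rw [← Pt.append_left_right z, ← hx, ← hy]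
        simp only [Pt.left_append, Pt.right_append, hinv _]
        exact hP i x y
      inv_regular := by
        choose P hP using fun i => hpoly _ (AffGrp.inv_reg _ (ψ (X i)).2)
        refine ⟨P, ?_⟩
        rintro _ ⟨x, rfl⟩ i
        simp only [hinv _]
        exact hP i x }
  let e₀ : H →* G.Gp := MonoidHom.mk' (fun h => ⟨c h, h, rfl⟩) fun a b => Subtype.ext <| by
    change c (a * b) = c (Function.invFun c (c a) * Function.invFun c (c b))
    rw [hinv, hinv]
  let e : H ≃* G.Gp := MulEquiv.ofBijective e₀ ⟨fun a b h => hinj (congrArg Subtype.val h), by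
    rintro ⟨_, h, rfl⟩; exact ⟨h, rfl⟩⟩
  have he : ∀ h, (e h).1 = c h := fun _ => rfl
  refine ⟨G, e, AffAlgGroup.isReg_of_coord fun i => (ψ (X i)).2, fun p hp => ?_⟩
  obtain ⟨P, hP⟩ := hpoly p hp
  refine AffAlgGroup.mem_reg_iff.mpr ⟨P, fun x => ?_⟩
  rw [hP, ← he, MulEquiv.apply_symm_apply]

/-! ### Coverings and central extensions by tori -/

/-- Homomorphisms factor regularly through surjective regular homomorphisms. -/
lemma exists_regular_factor {X H K : Type} [Group X] [AffGrp X] [IsDomain (reg X)] [Group H]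
    [AffGrp H] [Group K] [AffGrp K] {f : X →* H} (hf : IsReg f) (hs : Function.Surjective f)
    {g : X →* K} (hg : IsReg g) (hker : ∀ x, f x = 1 → g x = 1) :
    ∃ σ : H →* K, IsReg σ ∧ ∀ x, σ (f x) = g x := by
  let σ : H →* K := f.liftOfSurjective hs ⟨g, fun x hx => hker x hx⟩
  have hσ : ∀ x, σ (f x) = g x := fun x => MonoidHom.liftOfRightInverse_comp_apply ..
  refine ⟨σ, isReg_of_comp_surjective hf hs σ ?_, hσ⟩
  simpa only [hσ] using hg

/-- A bijective regular homomorphism onto an irreducible group has irreducible source. -/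
lemma isDomain_of_bijective {B C : Type} [Group B] [AffGrp B] [Group C] [AffGrp C]
    [IsDomain (reg C)] (f : B →* C) (hf : IsReg f) (hb : Function.Bijective f) :
    IsDomain (reg B) := by
  obtain ⟨N, _, _, hN, hdom⟩ := exists_identityComponent B
  let _ : AffGrp N := subgroupGrp hN
  have hs : Function.Surjective (f.comp N.subtype) := by
    refine surjective_of_pow_mem_range _ (hf.comp (isReg_val hN))
      (Subgroup.FiniteIndex.index_ne_zero (H := N)) fun c => ?_
    obtain ⟨b, rfl⟩ := hb.2 c
    exact ⟨⟨b ^ N.index, N.pow_index_mem b⟩, map_pow f b _⟩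
  refine isDomain_of_surjective (isReg_val hN) fun b => ?_
  obtain ⟨n, hn⟩ := hs (f b)
  exact ⟨n, hb.1 hn⟩

/-- A group `H` decomposed as `U ⋊ (Z × S)`, with `Z` commutative, together with a surjection
onto `G` with finite central kernel, such that the elements of the kernel have trivial
component in `U`. -/
structure SplitCover (U Z S H G : Type) [Group U] [AffGrp U] [Group Z] [AffGrp Z] [Group S]
    [AffGrp S] [Group H] [AffGrp H] [Group G] [AffGrp G] where
  /-- the inclusion of `U` -/
  jU : U →* H
  /-- the inclusion of `Z` -/
  jZ : Z →* H
  /-- the inclusion of `S` -/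
  jS : S →* H
  jU_reg : IsReg jU
  jZ_reg : IsReg jZ
  jS_reg : IsReg jS
  jU_inj : Function.Injective jU
  jZ_inj : Function.Injective jZ
  jS_inj : Function.Injective jS
  /-- the action of `H` on `U` by conjugation -/
  conj : H → U → U
  conj_reg : IsReg fun z : H × U => conj z.1 z.2
  jU_conj : ∀ x u, jU (conj x u) = x * jU u * x⁻¹
  commute : ∀ z s, jZ z * jS s = jS s * jZ z
  Z_comm : ∀ z z' : Z, z * z' = z' * z
  inter_U : ∀ u z s, jU u = jZ z * jS s → jU u = 1
  inter_Z : ∀ z s, jZ z = jS s → jZ z = 1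
  decomp : ∀ x, ∃ u z s, x = jU u * (jZ z * jS s)
  /-- the covering map -/
  p : H →* G
  p_reg : IsReg p
  p_surj : Function.Surjective p
  ker_finite : (p.ker : Set H).Finite
  ker_central : ∀ x ∈ p.ker, ∀ y, x * y = y * x
  ker_U : ∀ u z s, jU u * (jZ z * jS s) ∈ p.ker → u = 1

/-- A central extension of `G` by the torus `(ℂ*)^k`. -/
structure TorusExt (k : ℕ) (E G : Type) [Group E] [AffGrp E] [Group G] [AffGrp G] where
  /-- the inclusion of the torus -/
  τ : (Fin k → ℂˣ) →* E
  /-- the projection -/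
  q : E →* G
  τ_reg : IsReg τ
  q_reg : IsReg q
  τ_inj : Function.Injective τ
  q_surj : Function.Surjective q
  exact : ∀ x, q x = 1 ↔ ∃ a, τ a = x
  central : ∀ a x, τ a * x = x * τ a

variable {U Z S H G : Type} [Group U] [AffGrp U] [Group Z] [AffGrp Z] [Group S]
    [AffGrp S] [Group H] [AffGrp H] [Group G] [AffGrp G]

namespace SplitCover

variable (c : SplitCover U Z S H G)

lemma decomp_unique {u u' : U} {z z' : Z} {s s' : S}
    (h : c.jU u * (c.jZ z * c.jS s) = c.jU u' * (c.jZ z' * c.jS s')) :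
    u = u' ∧ z = z' ∧ s = s' := by
  have h1 : c.jU (u'⁻¹ * u) = c.jZ (z' * z⁻¹) * c.jS (s' * s⁻¹) := by
    have h2 : c.jU u'⁻¹ * c.jU u = c.jZ z' * c.jS s' * (c.jS s)⁻¹ * (c.jZ z)⁻¹ := by
      have := congrArg (fun t => (c.jU u')⁻¹ * t * (c.jS s)⁻¹ * (c.jZ z)⁻¹) h
      simpa [mul_assoc] using this
    rw [map_mul, h2, mul_assoc (c.jZ z'), ← map_inv c.jS, ← map_mul c.jS, ← map_inv c.jZ,
      mul_assoc, ← c.commute, ← mul_assoc, ← map_mul]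
  have hu := c.inter_U _ _ _ h1
  rw [hu] at h1
  have h3 : c.jZ (z' * z⁻¹) = c.jS (s' * s⁻¹)⁻¹ := by
    rw [map_inv]; exact eq_inv_of_mul_eq_one_left h1.symm
  have hz := c.inter_Z _ _ h3
  have hs : c.jS (s' * s⁻¹) = 1 := by rwa [hz, one_mul, eq_comm] at h1
  refine ⟨?_, ?_, ?_⟩
  · exact (inv_mul_eq_one.mp (c.jU_inj (hu.trans (map_one _).symm))).symm
  · exact (mul_inv_eq_one.mp (c.jZ_inj (hz.trans (map_one _).symm))).symm
  · exact (mul_inv_eq_one.mp (c.jS_inj (hs.trans (map_one _).symm))).symm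

/-- The multiplication map `U × Z × S → H`. -/
def mulMap (t : U × Z × S) : H := c.jU t.1 * (c.jZ t.2.1 * c.jS t.2.2)

lemma isReg_mulMap : IsReg c.mulMap :=
  (c.jU_reg.comp isReg_fst).mul (((c.jZ_reg.comp isReg_fst).comp isReg_snd).mul
    ((c.jS_reg.comp isReg_snd).comp isReg_snd))

lemma mulMap_surjective : Function.Surjective c.mulMap := fun x => by
  obtain ⟨u, z, s, rfl⟩ := c.decomp x
  exact ⟨(u, z, s), rfl⟩

/-- Homomorphisms to a torus extend from subgroups of the kernel of the covering. -/
lemma exists_extension_ker {k : ℕ} (F : Subgroup H) (hF : F ≤ c.p.ker)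
    (f : F →* (Fin k → ℂˣ)) :
    ∃ γ : c.p.ker →* (Fin k → ℂˣ), γ.comp (Subgroup.inclusion hF) = f := by
  have hfin : Finite c.p.ker := c.ker_finite
  let _ : AffGrp c.p.ker := subgroupGrp (isZClosed_of_finite c.ker_finite)
  let e : F.subgroupOf c.p.ker ≃* F := Subgroup.subgroupOfEquivOfLe hF
  obtain ⟨γ, -, hγ⟩ := exists_torus_extension
    (fun x y : c.p.ker => Subtype.ext (c.ker_central x x.2 y)) (F.subgroupOf c.p.ker)
    (f.comp e.toMonoidHom)
  refine ⟨γ, MonoidHom.ext fun x => ?_⟩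
  have := hγ (e.symm x)
  rw [MonoidHom.comp_apply] at this
  exact this.trans (congrArg f (e.apply_symm_apply x))

variable [IsDomain (reg U)] [IsDomain (reg Z)] [IsDomain (reg S)]

lemma isDomain (c : SplitCover U Z S H G) : IsDomain (reg H) :=
  isDomain_of_surjective c.isReg_mulMap c.mulMap_surjective

/-- Compatible homomorphisms on the factors glue to a homomorphism on `H`. -/
lemma exists_hom {E : Type} [Group E] [AffGrp E] {hU : U →* E} {hZ : Z →* E} {hS : S →* E}
    (hU_reg : IsReg hU) (hZ_reg : IsReg hZ) (hS_reg : IsReg hS)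
    (hZU : ∀ z u, hZ z * hU u = hU (c.conj (c.jZ z) u) * hZ z)
    (hSU : ∀ s u, hS s * hU u = hU (c.conj (c.jS s) u) * hS s)
    (hZS : ∀ z s, hZ z * hS s = hS s * hZ z) :
    ∃ h : H →* E, IsReg h ∧ ∀ u z s, h (c.jU u * (c.jZ z * c.jS s)) = hU u * (hZ z * hS s) := by
  choose u z s hx using c.decomp
  have key : ∀ a b d, hU (u (c.jU a * (c.jZ b * c.jS d))) * (hZ (z (c.jU a * (c.jZ b * c.jS d))) *
      hS (s (c.jU a * (c.jZ b * c.jS d)))) = hU a * (hZ b * hS d) := by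
    intro a b d
    obtain ⟨h1, h2, h3⟩ := c.decomp_unique (hx (c.jU a * (c.jZ b * c.jS d)))
    rw [← h1, ← h2, ← h3]
  let h : H →* E := MonoidHom.mk' (fun x => hU (u x) * (hZ (z x) * hS (s x))) fun x y => by
    obtain ⟨a, b, d, rfl⟩ := c.decomp x
    obtain ⟨a', b', d', rfl⟩ := c.decomp y
    have hxy : c.jU a * (c.jZ b * c.jS d) * (c.jU a' * (c.jZ b' * c.jS d')) =
        c.jU (a * c.conj (c.jZ b) (c.conj (c.jS d) a')) * (c.jZ (b * b') * c.jS (d * d')) := by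
      have hcomm : ∀ t, c.jZ b' * (c.jS d * t) = c.jS d * (c.jZ b' * t) := fun t => by
        rw [← mul_assoc, c.commute, mul_assoc]
      simp [c.jU_conj, mul_assoc, hcomm]
    rw [hxy, key, key, key]
    simp only [map_mul]
    have e1 := hZU b (c.conj (c.jS d) a')
    have e2 := hSU d a'
    have e3 := hZS b' d
    calc hU a * hU (c.conj (c.jZ b) (c.conj (c.jS d) a')) * (hZ b * hZ b' * (hS d * hS d'))
        = hU a * (hU (c.conj (c.jZ b) (c.conj (c.jS d) a')) * hZ b) * (hZ b' * hS d) * hS d' := by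
          simp only [mul_assoc]
      _ = hU a * hZ b * (hU (c.conj (c.jS d) a') * hS d) * hZ b' * hS d' := by
          rw [← e1, e3]; simp only [mul_assoc]
      _ = hU a * (hZ b * hS d) * (hU a' * (hZ b' * hS d')) := by
          rw [← e2]; simp only [mul_assoc]
  have hh : ∀ a b d, h (c.jU a * (c.jZ b * c.jS d)) = hU a * (hZ b * hS d) := key
  refine ⟨h, isReg_of_comp_surjective c.isReg_mulMap c.mulMap_surjective h ?_, hh⟩
  have : (fun t => h (c.mulMap t)) = fun t => hU t.1 * (hZ t.2.1 * hS t.2.2) :=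
    funext fun t => hh t.1 t.2.1 t.2.2
  rw [this]
  exact (hU_reg.comp isReg_fst).mul (((hZ_reg.comp isReg_fst).comp isReg_snd).mul
    ((hS_reg.comp isReg_snd).comp isReg_snd))

/-- The projection of `H` onto its commutative factor. -/
lemma exists_projection : ∃ π : H →* Z, IsReg π ∧
    ∀ u z s, π (c.jU u * (c.jZ z * c.jS s)) = z := by
  obtain ⟨π, h1, h2⟩ := c.exists_hom (hU := 1) (hZ := MonoidHom.id Z) (hS := 1) (isReg_const 1)
    isReg_id (isReg_const 1) (by simp) (by simp) (by simp)
  exact ⟨π, h1, fun u z s => by rw [h2]; simp⟩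

/-- Homomorphisms from the kernel of the covering to a torus which are trivial on `S` extend. -/
lemma exists_extension {k : ℕ} (γ : c.p.ker →* (Fin k → ℂˣ))
    (hγ : ∀ x : c.p.ker, (∃ s, c.jS s = x) → γ x = 1) :
    ∃ χ : H →* (Fin k → ℂˣ), IsReg χ ∧ ∀ x : c.p.ker, χ x = γ x := by
  obtain ⟨π, hπ, hπ'⟩ := c.exists_projection
  have hfin : Finite c.p.ker := c.ker_finite
  let f : c.p.ker →* c.p.ker.map π := π.subgroupMap c.p.ker
  have hf : Function.Surjective f := π.subgroupMap_surjective _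
  have : Finite (c.p.ker.map π) := Finite.of_surjective f hf
  have hker : f.ker ≤ γ.ker := by
    intro x hx
    refine hγ x ?_
    have hx1 : π x = 1 := congrArg Subtype.val hx
    obtain ⟨u, z, s, hdec⟩ := c.decomp x
    have hu : u = 1 := c.ker_U u z s (hdec ▸ x.2)
    rw [hdec, hπ'] at hx1
    exact ⟨s, by rw [hdec, hu, hx1]; simp⟩
  let γ' : c.p.ker.map π →* (Fin k → ℂˣ) := f.liftOfSurjective hf ⟨γ, hker⟩
  have hγ' : ∀ x, γ' (f x) = γ x := fun x => MonoidHom.liftOfRightInverse_comp_apply ..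
  obtain ⟨θ, hθ, hθ'⟩ := exists_torus_extension c.Z_comm (c.p.ker.map π) γ'
  exact ⟨θ.comp π, hθ.comp hπ, fun x => (hθ' (f x)).trans (hγ' x)⟩

end SplitCover

variable {U Z S H G : Type} [Group U] [AffGrp U] [Group Z] [AffGrp Z] [Group S]
    [AffGrp S] [Group H] [AffGrp H] [Group G] [AffGrp G]

namespace TorusExt

variable {k : ℕ} {E : Type} [Group E] [AffGrp E] (e : TorusExt k E G)

lemma q_τ (a : Fin k → ℂˣ) : e.q (e.τ a) = 1 := (e.exact _).mpr ⟨a, rfl⟩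

lemma isZClosed_range : IsZClosed (e.τ.range : Set E) := by
  have : (e.τ.range : Set E) = {x | e.q x = 1} := by
    ext x; exact (e.exact x).symm
  rw [this]
  exact isZClosed_eq e.q_reg (isReg_const 1)

lemma exists_complement : ∃ D : Subgroup E, IsZClosed (D : Set E) ∧
    {x | x ∈ D ∧ e.q x = 1}.Finite ∧ ∀ g, ∃ x ∈ D, e.q x = g := by
  obtain ⟨D, h1, h2, h3⟩ := exists_almost_complement e.τ e.τ_reg e.τ_inj e.isZClosed_range e.central
  refine ⟨D, h1, (h2.image e.τ).subset ?_, fun g => ?_⟩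
  · rintro x ⟨hx, hx1⟩
    obtain ⟨a, rfl⟩ := (e.exact x).mp hx1
    exact ⟨a, hx, rfl⟩
  · obtain ⟨x, rfl⟩ := e.q_surj g
    obtain ⟨a, ha⟩ := h3 x
    exact ⟨_, ha, by rw [map_mul, e.q_τ, mul_one]⟩

/-- The fibre product of a subgroup of `E` with a group over `G`. -/
def fibre {N : Type} [Group N] (e : TorusExt k E G) (D : Subgroup E) (r : N →* G) :
    Subgroup (E × N) where
  carrier := {z | z.1 ∈ D ∧ e.q z.1 = r z.2}
  one_mem' := ⟨D.one_mem, by simp⟩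
  mul_mem' := fun ha hb => ⟨D.mul_mem ha.1 hb.1, by
    rw [Prod.fst_mul, Prod.snd_mul, map_mul, map_mul, ha.2, hb.2]⟩
  inv_mem' := fun ha => ⟨D.inv_mem ha.1, by rw [Prod.fst_inv, Prod.snd_inv, map_inv, map_inv, ha.2]⟩

variable {D : Subgroup E} {N : Type} [Group N] {r : N →* G}

lemma fibre_snd_surjective (hs : ∀ g, ∃ x ∈ D, e.q x = g) :
    Function.Surjective ((MonoidHom.snd E N).comp (e.fibre D r).subtype) := fun n => by
  obtain ⟨x, hx, hxn⟩ := hs (r n)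
  exact ⟨⟨(x, n), hx, hxn⟩, rfl⟩

lemma fibre_ker_finite (hfin : {x | x ∈ D ∧ e.q x = 1}.Finite) :
    (((MonoidHom.snd E N).comp (e.fibre D r).subtype).ker : Set (e.fibre D r)).Finite := by
  refine Set.Finite.of_finite_image (f := fun z => z.1.1) (hfin.subset ?_) ?_
  · rintro _ ⟨⟨⟨x, n⟩, hx, hxn⟩, hn, rfl⟩
    obtain rfl : n = 1 := hn
    exact ⟨hx, hxn.trans (map_one r)⟩
  · rintro ⟨⟨x, n⟩, hx⟩ hn ⟨⟨x', n'⟩, hx'⟩ hn' h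
    obtain rfl : n = 1 := hn
    obtain rfl : n' = 1 := hn'
    obtain rfl : x = x' := h
    rfl

variable [AffGrp N]

lemma isZClosed_fibre (hD : IsZClosed (D : Set E)) (hr : IsReg r) :
    IsZClosed (e.fibre D r : Set (E × N)) :=
  (hD.preimage isReg_fst).inter (isZClosed_eq (e.q_reg.comp isReg_fst) (hr.comp isReg_snd))

lemma exists_lift_of_simplyConnected [IsDomain (reg N)] [TopologicalSpace N] [IsEuclid N]
    (hN : ∀ p : Path (1 : N) 1, p.Homotopic (Path.refl 1)) (hr : IsReg r)
    (hD : IsZClosed (D : Set E)) (hfin : {x | x ∈ D ∧ e.q x = 1}.Finite)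
    (hs : ∀ g, ∃ x ∈ D, e.q x = g) :
    ∃ h : N →* E, IsReg h ∧ ∀ n, h n ∈ D ∧ e.q (h n) = r n := by
  have hcl := e.isZClosed_fibre hD hr
  let _ : AffGrp (e.fibre D r) := subgroupGrp hcl
  obtain ⟨σ, hσ, hσ'⟩ := exists_section_of_simplyConnected hN
    ((MonoidHom.snd E N).comp (e.fibre D r).subtype) (isReg_snd.comp (isReg_val hcl))
    (e.fibre_snd_surjective hs) (e.fibre_ker_finite hfin)
  refine ⟨(MonoidHom.fst E N).comp ((e.fibre D r).subtype.comp σ),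
    (isReg_fst.comp (isReg_val hcl)).comp hσ, fun n => ⟨(σ n).2.1, (σ n).2.2.trans ?_⟩⟩
  exact congrArg r (hσ' n)

/-- Regular maps with values in a finite set, from an irreducible variety, are constant. -/
lemma eq_one_of_mem {X : Type} [AffVar X] [IsDomain (reg X)] {f : X → E} (hf : IsReg f)
    (hfin : {x | x ∈ D ∧ e.q x = 1}.Finite) (hD : ∀ x, f x ∈ D) (hq : ∀ x, e.q (f x) = 1)
    {x₀ : X} (h0 : f x₀ = 1) (x : X) : f x = 1 := by
  rw [← h0]
  refine eq_of_finite_range hf (hfin.subset ?_) x x₀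
  rintro _ ⟨y, rfl⟩
  exact ⟨hD y, hq y⟩

/-- Lifting through a central extension by a torus, for commutative irreducible groups. -/
lemma exists_lift_of_commutative [IsDomain (reg N)] (hcomm : ∀ x y : N, x * y = y * x)
    (hr : IsReg r) (hD : IsZClosed (D : Set E)) (hfin : {x | x ∈ D ∧ e.q x = 1}.Finite)
    (hs : ∀ g, ∃ x ∈ D, e.q x = g) :
    ∃ (M : Type) (_ : Group M) (_ : AffGrp M) (d : M →* E) (π : M →* N) (h : N →* E),
      IsDomain (reg M) ∧ IsReg d ∧ IsReg π ∧ IsReg h ∧ Function.Surjective π ∧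
      (∀ m, d m ∈ D ∧ e.q (d m) = r (π m)) ∧ ∀ m, ∃ a, h (π m) = d m * e.τ a := by
  have hcl := e.isZClosed_fibre hD hr
  let _ : AffGrp (e.fibre D r) := subgroupGrp hcl
  obtain ⟨M, _, _, hM, hdom⟩ := exists_identityComponent (e.fibre D r)
  let _ : AffGrp M := subgroupGrp hM
  let ι : M →* E × N := (e.fibre D r).subtype.comp M.subtype
  have hι : IsReg ι := (isReg_val hcl).comp (isReg_val hM)
  let d : M →* E := (MonoidHom.fst E N).comp ι
  let π : M →* N := (MonoidHom.snd E N).comp ι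
  have hd : IsReg d := isReg_fst.comp hι
  have hπ : IsReg π := isReg_snd.comp hι
  have hdπ : ∀ m, d m ∈ D ∧ e.q (d m) = r (π m) := fun m => m.1.2
  have hinj : ∀ m, d m = 1 → π m = 1 → m = 1 := fun m h1 h2 =>
    Subtype.ext (Subtype.ext (Prod.ext h1 h2))
  have hsurj : Function.Surjective π := by
    refine surjective_of_pow_mem_range _ hπ (Subgroup.FiniteIndex.index_ne_zero (H := M)) ?_
    intro n
    obtain ⟨b, rfl⟩ := e.fibre_snd_surjective (r := r) hs n
    exact ⟨⟨b ^ M.index, M.pow_index_mem b⟩,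
      map_pow ((MonoidHom.snd E N).comp (e.fibre D r).subtype) b _⟩
  have hMcomm : ∀ x y : M, x * y = y * x := by
    intro x y
    rw [← mul_inv_eq_one]
    have h2 : ∀ x y : M, π (x * y * (y * x)⁻¹) = 1 := fun x y => by
      rw [map_mul, map_inv, map_mul, map_mul, hcomm (π x), mul_inv_cancel]
    refine hinj _ ?_ (h2 x y)
    refine e.eq_one_of_mem (X := M × M) (f := fun z => d (z.1 * z.2 * (z.2 * z.1)⁻¹)) ?_ hfin
      (fun z => (hdπ _).1) (fun z => ?_) (x₀ := (1, 1)) (by simp) (x, y)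
    · exact hd.comp ((isReg_fst.mul isReg_snd).mul (isReg_snd.mul isReg_fst).inv)
    · rw [(hdπ _).2, h2, map_one]
  have hF : Finite π.ker := by
    refine Set.Finite.of_finite_image (f := d) (hfin.subset ?_) ?_
    · rintro _ ⟨m, hm, rfl⟩
      refine ⟨(hdπ m).1, ?_⟩
      rw [(hdπ m).2, show π m = 1 from hm, map_one]
    · intro m hm m' hm' h
      rw [← mul_inv_eq_one]
      refine hinj _ ?_ ?_
      · rw [map_mul, map_inv, h, mul_inv_cancel]
      · rw [map_mul, map_inv, show π m = 1 from hm, show π m' = 1 from hm', mul_inv_cancel]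
  have hq1 : ∀ m : π.ker, e.q (d m) = 1 := fun m => by
    rw [(hdπ m).2, show π m = 1 from m.2, map_one]
  choose χ hχ using fun m : π.ker => (e.exact _).mp (hq1 m)
  let χ' : π.ker →* (Fin k → ℂˣ) := MonoidHom.mk' χ fun x y => e.τ_inj (by
    rw [map_mul, hχ, hχ, hχ, ← map_mul]; rfl)
  obtain ⟨θ, hθ, hθ'⟩ := exists_torus_extension hMcomm π.ker χ'
  let g : M →* E := MonoidHom.mk' (fun m => d m * e.τ (θ m)⁻¹) fun x y => by
    rw [map_mul, map_mul, mul_inv, map_mul, mul_assoc, mul_assoc, ← mul_assoc (d y),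
      ← e.central _ (d y), mul_assoc]
  have hg : ∀ m, g m = d m * e.τ (θ m)⁻¹ := fun m => rfl
  have hg' : IsReg g := hd.mul (e.τ_reg.comp hθ.inv)
  obtain ⟨h, hh, hhπ⟩ := exists_regular_factor hπ hsurj hg' fun m hm => by
    rw [hg, hθ' ⟨m, hm⟩, map_inv]
    exact mul_inv_eq_one.mpr (hχ ⟨m, hm⟩).symm
  exact ⟨M, inferInstance, inferInstance, d, π, h, hdom, hd, hπ, hh, hsurj, hdπ,
    fun m => ⟨(θ m)⁻¹, by rw [hhπ, hg]⟩⟩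

end TorusExt

variable (c : SplitCover U Z S H G) {k : ℕ} {E : Type} [Group E] [AffGrp E] (e : TorusExt k E G)

/-- The covering lifts to every central extension by a torus. -/
theorem SplitCover.exists_lift [IsDomain (reg U)] [IsDomain (reg Z)] [IsDomain (reg S)]
    [TopologicalSpace U] [IsEuclid U] [TopologicalSpace S] [IsEuclid S]
    (hU : ∀ p : Path (1 : U) 1, p.Homotopic (Path.refl 1))
    (hS : ∀ p : Path (1 : S) 1, p.Homotopic (Path.refl 1)) :
    ∃ h : H →* E, IsReg h ∧ ∀ x, e.q (h x) = c.p x := by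
  obtain ⟨D, hD, hfin, hs⟩ := e.exists_complement
  obtain ⟨hu, hu_reg, hu'⟩ := e.exists_lift_of_simplyConnected (r := c.p.comp c.jU) hU
    (c.p_reg.comp c.jU_reg) hD hfin hs
  obtain ⟨hσ, hσ_reg, hσ'⟩ := e.exists_lift_of_simplyConnected (r := c.p.comp c.jS) hS
    (c.p_reg.comp c.jS_reg) hD hfin hs
  obtain ⟨M, _, _, d, π, hz, hdom, hd, hπ, hz_reg, hπs, hdπ, hdz⟩ :=
    e.exists_lift_of_commutative (r := c.p.comp c.jZ) c.Z_comm (c.p_reg.comp c.jZ_reg) hD hfin hs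
  have conj_one : ∀ x, c.conj x 1 = 1 := fun x => c.jU_inj (by rw [c.jU_conj]; simp)
  have conj_lift : ∀ {Y : Type} [Group Y] [AffGrp Y] [IsDomain (reg Y)] (f : Y →* E) (j : Y →* H),
      IsReg f → IsReg j → (∀ y, f y ∈ D ∧ e.q (f y) = c.p (j y)) →
      ∀ y u, f y * hu u = hu (c.conj (j y) u) * f y := by
    intro Y _ _ _ f j hf hj hfj y u
    rw [← mul_inv_eq_one]
    refine e.eq_one_of_mem (X := Y × U)
      (f := fun z => f z.1 * hu z.2 * (hu (c.conj (j z.1) z.2) * f z.1)⁻¹) ?_ hfin ?_ ?_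
      (x₀ := (1, 1)) (by simp [conj_one]) (y, u)
    · exact ((hf.comp isReg_fst).mul (hu_reg.comp isReg_snd)).mul ((hu_reg.comp (c.conj_reg.comp
        ((hj.comp isReg_fst).prodMk isReg_snd))).mul (hf.comp isReg_fst)).inv
    · exact fun z => mul_mem (mul_mem (hfj _).1 (hu' _).1)
        (inv_mem (mul_mem (hu' _).1 (hfj _).1))
    · intro z
      simp only [map_mul, map_inv, (hfj _).2, (hu' _).2, MonoidHom.comp_apply, c.jU_conj]
      group
  have hds : ∀ m s, d m * hσ s = hσ s * d m := by
    intro m s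
    rw [← mul_inv_eq_one]
    refine e.eq_one_of_mem (X := M × S) (f := fun z => d z.1 * hσ z.2 * (hσ z.2 * d z.1)⁻¹) ?_ hfin
      ?_ ?_ (x₀ := (1, 1)) (by simp) (m, s)
    · exact ((hd.comp isReg_fst).mul (hσ_reg.comp isReg_snd)).mul
        ((hσ_reg.comp isReg_snd).mul (hd.comp isReg_fst)).inv
    · exact fun z => mul_mem (mul_mem (hdπ _).1 (hσ' _).1)
        (inv_mem (mul_mem (hσ' _).1 (hdπ _).1))
    · intro z
      simp only [map_mul, map_inv, (hdπ _).2, (hσ' _).2, MonoidHom.comp_apply]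
      rw [← map_mul, c.commute, map_mul, mul_inv_cancel]
  have hzu : ∀ z u, hz z * hu u = hu (c.conj (c.jZ z) u) * hz z := by
    intro z u
    obtain ⟨m, rfl⟩ := hπs z
    obtain ⟨a, ha⟩ := hdz m
    rw [ha, mul_assoc, e.central, ← mul_assoc, ← mul_assoc,
      conj_lift d (c.jZ.comp π) hd (c.jZ_reg.comp hπ) hdπ]
    rfl
  have hzs : ∀ z s, hz z * hσ s = hσ s * hz z := by
    intro z s
    obtain ⟨m, rfl⟩ := hπs z
    obtain ⟨a, ha⟩ := hdz m
    rw [ha, mul_assoc, e.central, ← mul_assoc, hds, mul_assoc]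
  obtain ⟨h, hh, hh'⟩ := c.exists_hom hu_reg hz_reg hσ_reg hzu
    (conj_lift hσ c.jS hσ_reg c.jS_reg hσ') hzs
  refine ⟨h, hh, fun x => ?_⟩
  obtain ⟨u, z, s, rfl⟩ := c.decomp x
  obtain ⟨m, rfl⟩ := hπs z
  obtain ⟨a, ha⟩ := hdz m
  rw [hh', ha]
  simp only [map_mul, (hu' _).2, (hσ' _).2, (hdπ _).2, e.q_τ, mul_one, MonoidHom.comp_apply]

/-- A homomorphism defined on the kernel of the covering and extending to a lift of the covering
to a split extension is trivial on the simply connected factor, provided this factor maps into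
every closed subgroup containing the commutators. -/
theorem SplitCover.eq_one_of_split [IsDomain (reg U)] [IsDomain (reg Z)] [IsDomain (reg S)]
    (hder : ∀ K : Subgroup G, IsZClosed (K : Set G) → (∀ x y, x * y * x⁻¹ * y⁻¹ ∈ K) →
      ∀ s, c.p (c.jS s) ∈ K)
    {h : H →* E} (hh : IsReg h) (hq : ∀ x, e.q (h x) = c.p x) {σ : G →* E} (hσ : IsReg σ)
    (hqσ : ∀ g, e.q (σ g) = g) (s : S) (hs : c.p (c.jS s) = 1) : h (c.jS s) = 1 := by
  have hdom := c.isDomain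
  have hκq : ∀ x, e.q (h x * (σ (c.p x))⁻¹) = 1 := fun x => by
    rw [map_mul, map_inv, hq, hqσ, mul_inv_cancel]
  choose κ hκ using fun x => (e.exact _).mp (hκq x)
  have hκh : ∀ x, h x = e.τ (κ x) * σ (c.p x) := fun x => by rw [hκ, inv_mul_cancel_right]
  let κ' : H →* (Fin k → ℂˣ) := MonoidHom.mk' κ fun x y => e.τ_inj (by
    have h1 : e.τ (κ (x * y)) = h x * h y * (σ (c.p x) * σ (c.p y))⁻¹ := by
      rw [hκ, map_mul, map_mul, map_mul]
    rw [h1, map_mul, hκh x, hκh y, mul_inv_rev, mul_assoc, mul_assoc (e.τ (κ x)),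
      mul_assoc (e.τ (κ y)), mul_inv_cancel_left, ← mul_assoc (σ (c.p x)), ← e.central]
    simp [mul_assoc])
  let m := Nat.card c.p.ker
  have hfin : Finite c.p.ker := c.ker_finite
  have hm : m ≠ 0 := Nat.card_pos.ne'
  have hτκ : IsReg fun x => e.τ (κ' x) := by
    have : (fun x => e.τ (κ' x)) = fun x => h x * (σ (c.p x))⁻¹ := funext hκ
    rw [this]
    exact hh.mul (hσ.comp c.p_reg).inv
  have hpow : IsReg (e.τ.comp (κ' ^ m)) := by
    have h1 : ((e.τ.comp (κ' ^ m) : H →* E) : H → E) = fun x => e.τ (κ' x) ^ m :=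
      funext fun x => map_pow e.τ (κ' x) m
    rw [h1]
    exact hτκ.pow m
  obtain ⟨φ, hφ, hφp⟩ := exists_regular_factor c.p_reg c.p_surj hpow fun x hx => by
    have h1 : x ^ m = 1 := congrArg Subtype.val (pow_card_eq_one' (x := (⟨x, hx⟩ : c.p.ker)))
    change e.τ (κ' x ^ m) = 1
    rw [← map_pow κ', h1, map_one, map_one]
  have htors : ∀ s, κ' (c.jS s) ^ m = 1 := fun s => by
    have hcl : IsZClosed (φ.ker : Set G) := isZClosed_eq hφ (isReg_const 1)
    refine e.τ_inj ((hφp _).symm.trans ((hder _ hcl (fun x y => ?_) s).trans (map_one _).symm))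
    obtain ⟨x, rfl⟩ := c.p_surj x
    obtain ⟨y, rfl⟩ := c.p_surj y
    rw [MonoidHom.mem_ker, ← map_inv, ← map_inv, ← map_mul, ← map_mul, ← map_mul, hφp,
      MonoidHom.comp_apply]
    have : (κ' ^ m) (x * y * x⁻¹ * y⁻¹) = 1 := by
      simp only [map_mul, map_inv]
      rw [mul_inv_cancel_comm, mul_inv_cancel]
    rw [this, map_one]
  have hroots : {a : Fin k → ℂˣ | a ^ m = 1}.Finite := by
    have : NeZero m := ⟨hm⟩
    refine (Set.Finite.pi' fun _ : Fin k => (inferInstance : Finite (rootsOfUnity m ℂ))).subset ?_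
    intro a ha j
    exact (mem_rootsOfUnity m _).mpr (congrFun ha j)
  have hconst := eq_of_finite_range (hτκ.comp c.jS_reg) ((hroots.image e.τ).subset (by
    rintro _ ⟨t, rfl⟩
    exact ⟨_, htors t, rfl⟩)) s 1
  rw [map_one, map_one, map_one] at hconst
  rw [hκh, show e.τ (κ (c.jS s)) = 1 from hconst, hs, map_one, mul_one]

/-! ### Pushouts of a covering along homomorphisms to a torus -/

variable {U Z S H G : Type} [Group U] [AffGrp U] [Group Z] [AffGrp Z] [Group S]
    [AffGrp S] [Group H] [AffGrp H] [Group G] [AffGrp G]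

namespace TorusExt

variable {k : ℕ} {E E₁ E₂ E₃ : Type} [Group E] [AffGrp E] [Group E₁] [AffGrp E₁] [Group E₂]
  [AffGrp E₂] [Group E₃] [AffGrp E₃] (e : TorusExt k E G) {e₁ : TorusExt k E₁ G}
  {e₂ : TorusExt k E₂ G} {e₃ : TorusExt k E₃ G}

/-- The product of a homomorphism with a homomorphism to the central torus. -/
def twist {X : Type} [Group X] (t : X →* (Fin k → ℂˣ)) (h : X →* E) : X →* E :=
  MonoidHom.mk' (fun x => e.τ (t x) * h x) fun x y => by
    rw [map_mul, map_mul, map_mul, mul_assoc, mul_assoc, ← mul_assoc (h x), ← e.central _ (h x),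
      mul_assoc]

lemma twist_apply {X : Type} [Group X] (t : X →* (Fin k → ℂˣ)) (h : X →* E) (x : X) :
    e.twist t h x = e.τ (t x) * h x := rfl

lemma isReg_twist {X : Type} [Group X] [AffGrp X] {t : X →* (Fin k → ℂˣ)} {h : X →* E}
    (ht : IsReg t) (hh : IsReg h) : IsReg (e.twist t h) := (e.τ_reg.comp ht).mul hh

lemma q_twist {X : Type} [Group X] (t : X →* (Fin k → ℂˣ)) (h : X →* E) (x : X) :
    e.q (e.twist t h x) = e.q (h x) := by
  rw [twist_apply, map_mul, e.q_τ, one_mul]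

lemma exists_τ_mul {x y : E} (h : e.q x = e.q y) : ∃ a, e.τ a * y = x := by
  obtain ⟨a, ha⟩ := (e.exact (x * y⁻¹)).mp (by rw [map_mul, map_inv, h, mul_inv_cancel])
  exact ⟨a, by rw [ha, inv_mul_cancel_right]⟩

/-- `e` is the pushout of the covering `c` along `γ`. -/
def IsPushout (c : SplitCover U Z S H G) (γ : c.p.ker →* (Fin k → ℂˣ)) : Prop :=
  ∃ h : H →* E, IsReg h ∧ (∀ x, e.q (h x) = c.p x) ∧ ∀ x : c.p.ker, h x = e.τ (γ x)

variable {e} {c : SplitCover U Z S H G} {γ γ₁ γ₂ : c.p.ker →* (Fin k → ℂˣ)}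

variable (e) in
/-- A lift of the covering determines a homomorphism on its kernel. -/
lemma exists_isPushout_of_lift {h : H →* E} (hh : IsReg h) (hq : ∀ x, e.q (h x) = c.p x) :
    ∃ γ, e.IsPushout c γ := by
  have h1 : ∀ x : c.p.ker, e.q (h x) = 1 := fun x => (hq x).trans x.2
  choose γ hγ using fun x => (e.exact _).mp (h1 x)
  refine ⟨MonoidHom.mk' γ fun x y => e.τ_inj ?_, h, hh, hq, fun x => (hγ x).symm⟩
  rw [map_mul, hγ, hγ, hγ, ← map_mul]
  rfl

section irreducible

variable [IsDomain (reg U)] [IsDomain (reg Z)] [IsDomain (reg S)]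

/-- Being a pushout along `γ` depends only on the restriction of `γ` to the factor `S`. -/
lemma IsPushout.of_eqOn (h : e.IsPushout c γ₁)
    (hγ : ∀ x : c.p.ker, (∃ s, c.jS s = x) → γ₁ x = γ₂ x) : e.IsPushout c γ₂ := by
  obtain ⟨h, hh, hq, hker⟩ := h
  obtain ⟨χ, hχ, hχ'⟩ := c.exists_extension (γ₂ * γ₁⁻¹) fun x hx => by
    rw [MonoidHom.mul_apply, MonoidHom.inv_apply, hγ x hx, mul_inv_cancel]
  refine ⟨e.twist χ h, e.isReg_twist hχ hh, fun x => (e.q_twist χ h x).trans (hq x), fun x => ?_⟩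
  rw [twist_apply, hker, hχ', ← map_mul, MonoidHom.mul_apply, MonoidHom.inv_apply,
    inv_mul_cancel_right]

/-- Pushouts along the same homomorphism are equivalent. -/
lemma IsPushout.exists_hom (h₁ : e₁.IsPushout c γ) (h₂ : e₂.IsPushout c γ) :
    ∃ f : E₁ →* E₂, IsReg f ∧ (∀ a, f (e₁.τ a) = e₂.τ a) ∧ ∀ x, e₂.q (f x) = e₁.q x := by
  have := c.isDomain
  obtain ⟨h₁, hh₁, hq₁, hk₁⟩ := h₁
  obtain ⟨h₂, hh₂, hq₂, hk₂⟩ := h₂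
  let t := MonoidHom.fst (Fin k → ℂˣ) H
  let r := MonoidHom.snd (Fin k → ℂˣ) H
  have ht : IsReg t := isReg_fst
  have hr : IsReg r := isReg_snd
  have hs : Function.Surjective (e₁.twist t (h₁.comp r)) := fun x => by
    obtain ⟨y, hy⟩ := c.p_surj (e₁.q x)
    obtain ⟨a, ha⟩ := e₁.exists_τ_mul ((hq₁ y).trans hy).symm
    exact ⟨(a, y), ha⟩
  obtain ⟨f, hf, hf'⟩ := exists_regular_factor
    (e₁.isReg_twist (h := h₁.comp r) ht (hh₁.comp hr)) hs
    (e₂.isReg_twist (h := h₂.comp r) ht (hh₂.comp hr)) (by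
      rintro ⟨a, x⟩ hx
      have hx1 : e₁.τ a * h₁ x = 1 := hx
      have hxp : x ∈ c.p.ker := by
        have := congrArg e₁.q hx1
        rwa [map_mul, e₁.q_τ, one_mul, map_one, hq₁] at this
      change e₂.τ a * h₂ x = 1
      rw [hk₁ ⟨x, hxp⟩, ← map_mul, ← map_one e₁.τ] at hx1
      rw [hk₂ ⟨x, hxp⟩, ← map_mul, e₁.τ_inj hx1, map_one])
  refine ⟨f, hf, fun a => ?_, fun x => ?_⟩
  · have := hf' (a, 1)
    rw [twist_apply, twist_apply] at this
    simpa [t, r] using this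
  · obtain ⟨⟨a, y⟩, rfl⟩ := hs x
    rw [hf', q_twist, q_twist]
    exact (hq₂ y).trans (hq₁ y).symm

/-- The pushout along a product is the Baer sum of the pushouts. -/
lemma IsPushout.exists_baer (h₁ : e₁.IsPushout c γ₁) (h₂ : e₂.IsPushout c γ₂)
    (h₃ : e₃.IsPushout c (γ₁ * γ₂)) :
    ∃ f : e₁.fibre ⊤ e₂.q →* E₃,
      (∀ p ∈ reg E₃, ∃ P ∈ reg (E₁ × E₂), ∀ z : e₁.fibre ⊤ e₂.q, p (f z) = P z) ∧
      (∀ z, e₃.q (f z) = e₁.q z.1.1) ∧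
      ∀ z a b, z.1 = (e₁.τ a, e₂.τ b) → f z = e₃.τ (a * b) := by
  have := c.isDomain
  obtain ⟨h₁, hh₁, hq₁, hk₁⟩ := h₁
  obtain ⟨h₂, hh₂, hq₂, hk₂⟩ := h₂
  obtain ⟨h₃, hh₃, hq₃, hk₃⟩ := h₃
  have hcl : IsZClosed (e₁.fibre ⊤ e₂.q : Set (E₁ × E₂)) :=
    e₁.isZClosed_fibre ⟨∅, by simp, by simp⟩ e₂.q_reg
  let _ : AffGrp (e₁.fibre ⊤ e₂.q) := subgroupGrp hcl
  let T := Fin k → ℂˣ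
  let t := MonoidHom.fst (T × T) H
  let r := MonoidHom.snd (T × T) H
  let t₁ := (MonoidHom.fst T T).comp t
  let t₂ := (MonoidHom.snd T T).comp t
  have ht₁ : IsReg t₁ := isReg_fst.comp isReg_fst
  have ht₂ : IsReg t₂ := isReg_snd.comp isReg_fst
  have hr : IsReg r := isReg_snd
  have hmem : ∀ x, ((e₁.twist t₁ (h₁.comp r)).prod (e₂.twist t₂ (h₂.comp r))) x ∈
      e₁.fibre ⊤ e₂.q := fun x => ⟨trivial, by
    rw [MonoidHom.prod_apply, q_twist, q_twist]
    exact (hq₁ _).trans (hq₂ _).symm⟩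
  let m := ((e₁.twist t₁ (h₁.comp r)).prod (e₂.twist t₂ (h₂.comp r))).codRestrict _ hmem
  have hm : IsReg m := isReg_codRestrict hcl
    ((e₁.isReg_twist ht₁ (hh₁.comp hr)).prodMk (e₂.isReg_twist ht₂ (hh₂.comp hr))) hmem
  have hs : Function.Surjective m := by
    rintro ⟨⟨x, x'⟩, hx⟩
    obtain ⟨y, hy⟩ := c.p_surj (e₁.q x)
    obtain ⟨a, ha⟩ := e₁.exists_τ_mul ((hq₁ y).trans hy).symm
    obtain ⟨b, hb⟩ := e₂.exists_τ_mul (((hq₂ y).trans hy).trans hx.2).symm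
    exact ⟨((a, b), y), Subtype.ext (Prod.ext ha hb)⟩
  obtain ⟨f, hf, hf'⟩ := exists_regular_factor hm hs
    (e₃.isReg_twist (t := t₁ * t₂) (h := h₃.comp r) (ht₁.mul ht₂) (hh₃.comp hr)) (by
      rintro ⟨⟨a, b⟩, x⟩ hx
      have hx1 : e₁.τ a * h₁ x = 1 := congrArg Prod.fst (congrArg Subtype.val hx)
      have hx2 : e₂.τ b * h₂ x = 1 := congrArg Prod.snd (congrArg Subtype.val hx)
      have hxp : x ∈ c.p.ker := by
        have := congrArg e₁.q hx1
        rwa [map_mul, e₁.q_τ, one_mul, map_one, hq₁] at this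
      change e₃.τ (a * b) * h₃ x = 1
      rw [hk₁ ⟨x, hxp⟩, ← map_mul, ← map_one e₁.τ] at hx1
      rw [hk₂ ⟨x, hxp⟩, ← map_mul, ← map_one e₂.τ] at hx2
      rw [hk₃ ⟨x, hxp⟩, ← map_mul, MonoidHom.mul_apply, mul_mul_mul_comm, e₁.τ_inj hx1,
        e₂.τ_inj hx2, one_mul, map_one])
  refine ⟨f, fun p hp => ?_, fun z => ?_, fun z a b hz => ?_⟩
  · obtain ⟨P, hP, hPf⟩ := hf p hp
    exact ⟨P, hP, fun z => (congrFun hPf z).symm⟩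
  · obtain ⟨⟨⟨a, b⟩, y⟩, rfl⟩ := hs z
    rw [hf', q_twist]
    refine (hq₃ y).trans ((hq₁ y).symm.trans ?_)
    exact (e₁.q_twist t₁ (h₁.comp r) ((a, b), y)).symm
  · have hz' : m ((a, b), 1) = z := by
      refine Subtype.ext (Eq.trans ?_ hz.symm)
      change (e₁.τ a * h₁ 1, e₂.τ b * h₂ 1) = _
      rw [map_one, map_one, mul_one, mul_one]
    rw [← hz', hf', twist_apply]
    change e₃.τ (a * b) * h₃ 1 = _
    rw [map_one, mul_one]

end irreducible

/-- The pushout of the covering along a homomorphism on its kernel exists. -/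
lemma exists_isPushout (c : SplitCover U Z S H G) (γ : c.p.ker →* (Fin k → ℂˣ)) :
    ∃ (E : Type) (_ : Group E) (_ : AffGrp E) (e : TorusExt k E G), e.IsPushout c γ := by
  have hfin : Finite c.p.ker := c.ker_finite
  let T := Fin k → ℂˣ
  let ι : c.p.ker →* T × H := (γ⁻¹).prod c.p.ker.subtype
  let Γ := ι.range
  have hΓ : Finite Γ := Finite.of_surjective ι.rangeRestrict ι.rangeRestrict_surjective
  have hΓn : Γ.Normal := by
    refine ⟨?_⟩
    rintro _ ⟨x, rfl⟩ ⟨a, y⟩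
    refine ⟨x, Prod.ext ?_ ?_⟩
    · exact (mul_inv_cancel_comm a _).symm
    · change (x : H) = y * x * y⁻¹
      rw [← c.ker_central x x.2 y, mul_inv_cancel_right]
  let _ : AffGrp ((T × H) ⧸ Γ) := quotGrp Γ
  have hmk : IsReg (QuotientGroup.mk' Γ) := isReg_quotMk Γ
  have hlift : ∀ z ∈ Γ, (c.p.comp (MonoidHom.snd T H)) z = 1 := by
    rintro _ ⟨x, rfl⟩
    exact x.2
  let e : TorusExt k ((T × H) ⧸ Γ) G :=
    { τ := (QuotientGroup.mk' Γ).comp (MonoidHom.inl T H)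
      q := QuotientGroup.lift Γ (c.p.comp (MonoidHom.snd T H)) hlift
      τ_reg := hmk.comp (isReg_id.prodMk (isReg_const 1))
      q_reg := isReg_quotLift Γ (c.p_reg.comp isReg_snd)
      τ_inj := by
        rw [injective_iff_map_eq_one]
        intro a ha
        obtain ⟨x, hx⟩ := (QuotientGroup.eq_one_iff _).mp ha
        have h1 : x = 1 := Subtype.ext (congrArg Prod.snd hx)
        have h2 : (γ x)⁻¹ = a := congrArg Prod.fst hx
        rw [← h2, h1, map_one, inv_one]
      q_surj := fun g => by
        obtain ⟨x, rfl⟩ := c.p_surj g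
        exact ⟨QuotientGroup.mk (1, x), rfl⟩
      exact := fun x => by
        obtain ⟨⟨a, x⟩, rfl⟩ := QuotientGroup.mk_surjective x
        constructor
        · intro hx
          have hx' : x ∈ c.p.ker := hx
          refine ⟨a * γ ⟨x, hx'⟩, QuotientGroup.eq.mpr ⟨⟨x, hx'⟩, Prod.ext ?_ ?_⟩⟩
          · change (γ ⟨x, hx'⟩)⁻¹ = (a * γ ⟨x, hx'⟩)⁻¹ * a
            rw [mul_inv, mul_assoc, mul_comm _ a, ← mul_assoc, inv_mul_cancel, one_mul]
          · change x = 1⁻¹ * x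
            rw [inv_one, one_mul]
        · rintro ⟨b, hb⟩
          rw [← hb]
          exact map_one c.p
      central := fun a x => by
        obtain ⟨⟨b, x⟩, rfl⟩ := QuotientGroup.mk_surjective x
        refine congrArg (QuotientGroup.mk' Γ) (Prod.ext (mul_comm a b) ?_)
        exact (one_mul x).trans (mul_one x).symm }
  refine ⟨(T × H) ⧸ Γ, inferInstance, inferInstance, e,
    (QuotientGroup.mk' Γ).comp (MonoidHom.inr T H), hmk.comp ((isReg_const 1).prodMk isReg_id),
    fun x => rfl, fun x => QuotientGroup.eq.mpr ⟨x⁻¹, Prod.ext ?_ ?_⟩⟩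
  · change (γ x⁻¹)⁻¹ = 1⁻¹ * γ x
    rw [map_inv, inv_inv, inv_one, one_mul]
  · change ((x⁻¹ : c.p.ker) : H) = (x : H)⁻¹ * 1
    rw [mul_one]; rfl

end TorusExt

end AffVar

/-! ### The covering and the extensions as abstract data -/

lemma AffAlgGroup.exists_val_eq {G : AffAlgGroup} {x : Pt G.n} (hx : x ∈ G.carrier) :
    ∃ y : G.Gp, y.1 = x := ⟨⟨x, hx⟩, rfl⟩

lemma AlgGroupHom.exists_restrict {G H : AffAlgGroup} (f : AlgGroupHom G H) {A : AlgSubgroup G}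
    {B : AlgSubgroup H} (hinj : Set.InjOn f.toFun A.carrier)
    (himg : f.toFun '' A.carrier = B.carrier) :
    ∃ r : A.toGrp.Gp →* B.toGrp.Gp, IsReg r ∧ Function.Bijective r := by
  have hmem : ∀ x : A.toGrp.Gp, f.toFun x.1 ∈ B.carrier := fun x =>
    himg ▸ Set.mem_image_of_mem f.toFun x.2
  refine ⟨MonoidHom.mk' (fun x => ⟨f.toFun x.1, hmem x⟩) fun x y =>
    Subtype.ext (f.map_mul (A.subset x.2) (A.subset y.2)),
    AlgSubgroup.isReg_codRestrict (f.isReg.comp A.isReg_incl) hmem,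
    fun x y h => Subtype.ext (hinj x.2 y.2 (congrArg Subtype.val h)), fun y => ?_⟩
  obtain ⟨x, hx, hxy⟩ := himg.superset y.2
  exact ⟨⟨x, hx⟩, Subtype.ext hxy⟩

namespace CoveringData

variable {G : AffAlgGroup} {LD : LeviDecomposition G} (CD : CoveringData G LD)

/-- The canonical covering as a covering of a semidirect product. -/
def splitCover : SplitCover CD.Gu'.toGrp.Gp CD.Zc.toGrp.Gp CD.Gs.toGrp.Gp CD.Gt.Gp G.Gp where
  jU := CD.Gu'.incl
  jZ := CD.Zc.incl
  jS := CD.Gs.incl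
  jU_reg := CD.Gu'.isReg_incl
  jZ_reg := CD.Zc.isReg_incl
  jS_reg := CD.Gs.isReg_incl
  jU_inj := CD.Gu'.incl_injective
  jZ_inj := CD.Zc.incl_injective
  jS_inj := CD.Gs.incl_injective
  conj x u := ⟨(x * (CD.Gu'.incl u * x⁻¹)).1, CD.Gu'_normal x.1 x.2 u.1 u.2⟩
  conj_reg := AlgSubgroup.isReg_codRestrict (H := CD.Gu')
    (f := fun z : CD.Gt.Gp × CD.Gu'.toGrp.Gp => z.1 * (CD.Gu'.incl z.2 * z.1⁻¹))
    (isReg_fst.mul ((CD.Gu'.isReg_incl.comp isReg_snd).mul isReg_fst.inv)) _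
  jU_conj x u := (mul_assoc x (CD.Gu'.incl u) x⁻¹).symm
  commute z s := Subtype.ext (CD.Zc_Gs_comm z.1 z.2 s.1 s.2)
  Z_comm z z' := Subtype.ext (CD.qG_Zc_inj (z * z').2 (z' * z).2 (by
    have hz : ∀ z : CD.Zc.toGrp.Gp, CD.qG.toFun z.1 ∈ CD.Z.carrier := fun z =>
      CD.qG_Zc_img ▸ Set.mem_image_of_mem CD.qG.toFun z.2
    exact (CD.qG.map_mul (CD.Zc.subset z.2) (CD.Zc.subset z'.2)).trans
      ((CD.Z_central _ (hz z) _ (CD.Z_sub (hz z'))).trans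
        (CD.qG.map_mul (CD.Zc.subset z'.2) (CD.Zc.subset z.2)).symm)))
  inter_U u z s h := Subtype.ext (CD.levi_inter.subset
    ⟨u.2, z.1, z.2, s.1, s.2, congrArg Subtype.val h⟩)
  inter_Z z s h := Subtype.ext (CD.Zc_Gs_inter.subset
    ⟨z.2, (congrArg Subtype.val h : z.1 = s.1) ▸ s.2⟩)
  decomp x := by
    obtain ⟨u, hu, z, hz, s, hs, hx⟩ := CD.decomp x.1 x.2
    exact ⟨⟨u, hu⟩, ⟨z, hz⟩, ⟨s, hs⟩, Subtype.ext hx⟩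
  p := CD.qG.toGpHom
  p_reg := CD.qG.isReg
  p_surj g := by
    obtain ⟨x, hx, hxg⟩ := CD.qG_surj g.1 g.2
    exact ⟨⟨x, hx⟩, Subtype.ext hxg⟩
  ker_finite := Set.Finite.of_finite_image (f := Subtype.val) (CD.ker_finite.subset (by
    rintro _ ⟨x, hx, rfl⟩
    exact ⟨x.2, congrArg Subtype.val (show CD.qG.toGpHom x = 1 from hx)⟩))
    Subtype.val_injective.injOn
  ker_central x hx y := Subtype.ext (CD.ker_central x.1 x.2
    (congrArg Subtype.val (show CD.qG.toGpHom x = 1 from hx)) y.1 y.2)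
  ker_U u z s h := by
    have hu : (CD.qG.toGpHom (CD.Gu'.incl u)).1 ∈ LD.Gu.carrier :=
      CD.qG_Gu'_img ▸ Set.mem_image_of_mem CD.qG.toFun u.2
    have hz : CD.qG.toGpHom (CD.Zc.incl z) ∈ LD.L.toSubgroup :=
      CD.Z_sub (CD.qG_Zc_img ▸ Set.mem_image_of_mem CD.qG.toFun z.2)
    have hs : CD.qG.toGpHom (CD.Gs.incl s) ∈ LD.L.toSubgroup :=
      CD.Lder_sub (CD.qG_Gs_img ▸ Set.mem_image_of_mem CD.qG.toFun s.2)
    have h1 : CD.qG.toGpHom (CD.Gu'.incl u * (CD.Zc.incl z * CD.Gs.incl s)) = 1 := h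
    rw [map_mul, map_mul] at h1
    have hL : CD.qG.toGpHom (CD.Gu'.incl u) ∈ LD.L.toSubgroup := by
      rw [eq_inv_of_mul_eq_one_left h1]
      exact inv_mem (mul_mem hz hs)
    have h2 : CD.qG.toGpHom (CD.Gu'.incl u) = CD.qG.toGpHom (CD.Gu'.incl 1) := by
      rw [map_one, map_one]
      exact Subtype.ext (LD.inter.subset ⟨hu, hL⟩)
    exact Subtype.ext (CD.qG_Gu'_inj u.2 (1 : CD.Gu'.toGrp.Gp).2 (congrArg Subtype.val h2))

lemma isDomain_unipotent : IsDomain (reg CD.Gu'.toGrp.Gp) := by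
  obtain ⟨r, hr, hb⟩ := CD.qG.exists_restrict CD.qG_Gu'_inj CD.qG_Gu'_img
  have := LD.Gu_radical.2.1.isDomain
  exact isDomain_of_bijective r hr hb

lemma isDomain_central : IsDomain (reg CD.Zc.toGrp.Gp) := by
  obtain ⟨r, hr, hb⟩ := CD.qG.exists_restrict CD.qG_Zc_inj CD.qG_Zc_img
  have := CD.Z_connected.isDomain
  exact isDomain_of_bijective r hr hb

lemma homotopic_refl_unipotent (γ : Path (1 : CD.Gu'.toGrp.Gp) 1) :
    γ.Homotopic (Path.refl 1) := by
  obtain ⟨r, hr, hb⟩ := CD.qG.exists_restrict CD.qG_Gu'_inj CD.qG_Gu'_img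
  obtain ⟨M⟩ := LD.Gu_radical.2.2.1.exists_rep
  have := CD.isDomain_unipotent
  let M' : UnipotentRep CD.Gu'.toGrp.Gp :=
    { m := M.m
      rep := M.rep.comp r
      reg_rep := fun i j => hr _ (M.reg_rep i j)
      inj := M.inj.comp hb.1
      diag := fun u => M.diag (r u)
      lower := fun u => M.lower (r u) }
  exact M'.homotopic_refl γ

lemma homotopic_refl_semisimple (γ : Path (1 : CD.Gs.toGrp.Gp) 1) :
    γ.Homotopic (Path.refl 1) :=
  Path.Homotopic.Quotient.exact
    (CD.Gs_simplyConnected (FundamentalGroup.fromPath (Path.Homotopic.Quotient.mk γ)))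

lemma mem_of_commutator (K : Subgroup G.Gp) (hK : IsZClosed (K : Set G.Gp))
    (hc : ∀ x y, x * y * x⁻¹ * y⁻¹ ∈ K) (s : CD.Gs.toGrp.Gp) :
    CD.qG.toGpHom (CD.Gs.incl s) ∈ K := by
  obtain ⟨V, hV, hVK⟩ := AffAlgGroup.exists_isAlgebraicSet hK
  let K' : AlgSubgroup G :=
    { carrier := V
      subset := fun x hx => ((hVK x).mp hx).1
      isAlgebraic := hV
      one_mem := (hVK _).mpr ⟨G.one_mem, K.one_mem⟩
      mul_mem := fun {x y} hx hy => (hVK _).mpr ⟨_, K.mul_mem ((hVK x).mp hx).2 ((hVK y).mp hy).2⟩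
      inv_mem := fun {x} hx => (hVK _).mpr ⟨_, K.inv_mem ((hVK x).mp hx).2⟩ }
  have h1 := CD.Lder_min K' fun x hx y hy => by
    obtain ⟨x, rfl⟩ := AffAlgGroup.exists_val_eq (LD.L.subset hx)
    obtain ⟨y, rfl⟩ := AffAlgGroup.exists_val_eq (LD.L.subset hy)
    have h2 := hc x y
    rw [mul_assoc, mul_assoc] at h2
    exact (hVK _).mpr ⟨_, h2⟩
  exact ((hVK _).mp (h1 (CD.qG_Gs_img ▸ Set.mem_image_of_mem CD.qG.toFun s.2))).2

end CoveringData

namespace AlgExtension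

variable {G A : AffAlgGroup} {ρ : AlgAction G A} (hρ : ρ.IsTrivial) {k : ℕ}
  {τ : (Fin k → ℂˣ) ≃* A.Gp} (hτ : IsReg τ)

/-- An extension by a torus with trivial action, as a central extension by `(ℂ*)^k`. -/
def torusExt (e : AlgExtension G A ρ) : TorusExt k e.E.Gp G.Gp where
  τ := e.i.toGpHom.comp τ.toMonoidHom
  q := e.q.toGpHom
  τ_reg := e.i.isReg.comp hτ
  q_reg := e.q.isReg
  τ_inj := Function.Injective.comp (g := e.i.toGpHom) (fun a b h => Subtype.ext
    (e.i_inj a.2 b.2 (congrArg Subtype.val h))) τ.injective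
  q_surj g := by
    obtain ⟨x, hx, hxg⟩ := e.q_surj g.1 g.2
    exact ⟨⟨x, hx⟩, Subtype.ext hxg⟩
  exact x := by
    refine ⟨fun h => ?_, ?_⟩
    · obtain ⟨a, ha, hax⟩ := (e.exact x.1 x.2).mp (congrArg Subtype.val h)
      obtain ⟨a, rfl⟩ := AffAlgGroup.exists_val_eq ha
      refine ⟨τ.symm a, Subtype.ext ?_⟩
      change e.i.toFun (τ (τ.symm a)).1 = x.1
      rw [τ.apply_symm_apply, hax]
    · rintro ⟨a, rfl⟩
      exact Subtype.ext ((e.exact _ (e.i.toGpHom (τ a)).2).mpr ⟨(τ a).1, (τ a).2, rfl⟩)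
  central a x := by
    have h1 : x * (e.i.toGpHom (τ a) * x⁻¹) = e.i.toGpHom (τ a) := Subtype.ext
      ((e.conj_compat x.1 x.2 (τ a).1 (τ a).2).trans
        (congrArg e.i.toFun (hρ _ (e.q.maps_to x.2) _ (τ a).2)))
    rw [← mul_assoc] at h1
    exact (mul_inv_eq_iff_eq_mul.mp h1).symm

/-- Abstract central extensions by a torus are realized by extensions of algebraic groups. -/
lemma exists_of_torusExt (hτ' : IsReg τ.symm) {E : Type} [Group E] [AffGrp E]
    (t : TorusExt k E G.Gp) :
    ∃ (e : AlgExtension G A ρ) (φ : E →* e.E.Gp), IsReg φ ∧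
      (∀ a, φ (t.τ a) = (e.torusExt hρ hτ).τ a) ∧ ∀ x, (e.torusExt hρ hτ).q (φ x) = t.q x := by
  obtain ⟨E', φ, hφ, hφ'⟩ := exists_affAlgGroup E
  obtain ⟨i, hi⟩ := AlgGroupHom.exists_of_isReg
    (φ.toMonoidHom.comp (t.τ.comp τ.symm.toMonoidHom)) (hφ.comp (t.τ_reg.comp hτ'))
  obtain ⟨q, hq⟩ := AlgGroupHom.exists_of_isReg (t.q.comp φ.symm.toMonoidHom)
    (t.q_reg.comp hφ')
  have hi' : ∀ a : A.Gp, i.toGpHom a = φ (t.τ (τ.symm a)) := fun a => by rw [hi]; rfl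
  have hq' : ∀ x : E'.Gp, q.toGpHom x = t.q (φ.symm x) := fun a => by rw [hq]; rfl
  let e : AlgExtension G A ρ :=
    { E := E'
      i := i
      q := q
      i_inj := fun a ha b hb h => by
        obtain ⟨a, rfl⟩ := AffAlgGroup.exists_val_eq ha
        obtain ⟨b, rfl⟩ := AffAlgGroup.exists_val_eq hb
        have h1 : i.toGpHom a = i.toGpHom b := Subtype.ext h
        rw [hi', hi'] at h1
        exact congrArg Subtype.val (τ.symm.injective (t.τ_inj (φ.injective h1)))
      q_surj := fun g hg => by
        obtain ⟨g, rfl⟩ := AffAlgGroup.exists_val_eq hg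
        obtain ⟨x, hx⟩ := t.q_surj g
        have h1 : q.toGpHom (φ x) = g := by rw [hq', φ.symm_apply_apply, hx]
        exact ⟨(φ x).1, (φ x).2, congrArg Subtype.val h1⟩
      exact := fun x hx => by
        obtain ⟨x, rfl⟩ := AffAlgGroup.exists_val_eq hx
        have h1 : q.toFun x.1 = G.one ↔ q.toGpHom x = 1 :=
          ⟨fun h => Subtype.ext h, fun h => congrArg Subtype.val h⟩
        rw [h1, hq', t.exact]
        constructor
        · rintro ⟨a, ha⟩
          refine ⟨(τ a).1, (τ a).2, ?_⟩
          have h2 : i.toGpHom (τ a) = x := by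
            rw [hi', τ.symm_apply_apply, ha, φ.apply_symm_apply]
          exact congrArg Subtype.val h2
        · rintro ⟨a, ha, hax⟩
          obtain ⟨a, rfl⟩ := AffAlgGroup.exists_val_eq ha
          have h2 : i.toGpHom a = x := Subtype.ext hax
          exact ⟨τ.symm a, by rw [← h2, hi', φ.symm_apply_apply]⟩
      conj_compat := fun x hx a ha => by
        rw [hρ _ (q.maps_to hx) a ha]
        obtain ⟨a, rfl⟩ := AffAlgGroup.exists_val_eq ha
        obtain ⟨x, rfl⟩ := AffAlgGroup.exists_val_eq hx
        have h2 : x * (i.toGpHom a * x⁻¹) = i.toGpHom a := by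
          obtain ⟨y, rfl⟩ := φ.surjective x
          rw [hi', ← mul_assoc, ← map_mul, ← t.central, map_mul, mul_inv_cancel_right]
        exact congrArg Subtype.val h2 }
  refine ⟨e, φ.toMonoidHom, hφ, fun a => ?_, fun x => ?_⟩
  · exact ((hi' (τ a)).trans (by rw [τ.symm_apply_apply]; rfl)).symm
  · exact (hq' (φ x)).trans (by rw [φ.symm_apply_apply])

end AlgExtension

lemma AffAlgGroup.exists_polynomial_of_mem_prod {G H : AffAlgGroup} {p : G.Gp × H.Gp → ℂ}
    (hp : p ∈ reg (G.Gp × H.Gp)) : ∃ P : MvPolynomial (Fin (G.n + H.n)) ℂ,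
      ∀ z, p z = eval (Fin.append z.1.1 z.2.1 : Pt (G.n + H.n)) P := by
  obtain ⟨n, a, b, hab⟩ := exists_sum_of_mem_prod hp
  choose A hA using fun i => mem_reg_iff.mp (a i).2
  choose B hB using fun i => mem_reg_iff.mp (b i).2
  refine ⟨∑ i, rename (Fin.castAdd H.n) (A i) * rename (Fin.natAdd G.n) (B i), fun z => ?_⟩
  have h1 : (Fin.append z.1.1 z.2.1 : Pt (G.n + H.n)) ∘ Fin.castAdd H.n = z.1.1 :=
    funext fun i => Fin.append_left ..
  have h2 : (Fin.append z.1.1 z.2.1 : Pt (G.n + H.n)) ∘ Fin.natAdd G.n = z.2.1 :=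
    funext fun i => Fin.append_right ..
  have h3 := hab z.1 z.2
  simp only [hA, hB] at h3
  simp only [map_sum, map_mul, eval_rename, h1, h2]
  exact h3

lemma AffVar.TorusExt.IsPushout.exists_polynomial {U Z S H G : Type} [Group U] [AffGrp U] [Group Z]
    [AffGrp Z] [Group S] [AffGrp S] [Group H] [AffGrp H] [Group G] [AffGrp G]
    [IsDomain (reg U)] [IsDomain (reg Z)] [IsDomain (reg S)] {c : SplitCover U Z S H G} {k : ℕ}
    {γ₁ γ₂ : c.p.ker →* (Fin k → ℂˣ)} {E₁ E₂ E₃ : AffAlgGroup} {e₁ : TorusExt k E₁.Gp G}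
    {e₂ : TorusExt k E₂.Gp G} {e₃ : TorusExt k E₃.Gp G} (h₁ : e₁.IsPushout c γ₁)
    (h₂ : e₂.IsPushout c γ₂) (h₃ : e₃.IsPushout c (γ₁ * γ₂)) :
    ∃ (P : Fin E₃.n → MvPolynomial (Fin (E₁.n + E₂.n)) ℂ)
      (m : ∀ (x : E₁.Gp) (y : E₂.Gp), e₁.q x = e₂.q y → E₃.Gp),
      (∀ x y h, (fun i => eval (Fin.append x.1 y.1 : Pt (E₁.n + E₂.n)) (P i)) = (m x y h).1) ∧
      (∀ x x' y y' h h' hmul, m (x * x') (y * y') hmul = m x y h * m x' y' h') ∧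
      (∀ x y h, e₃.q (m x y h) = e₁.q x) ∧
      ∀ a b h, m (e₁.τ a) (e₂.τ b) h = e₃.τ (a * b) := by
  obtain ⟨f, hf, hqf, hτf⟩ := h₁.exists_baer h₂ h₃
  have hf' : ∀ i, ∃ P : MvPolynomial (Fin (E₁.n + E₂.n)) ℂ, ∀ z : e₁.fibre ⊤ e₂.q,
      (f z).1 i = eval (Fin.append z.1.1.1 z.1.2.1 : Pt (E₁.n + E₂.n)) P := fun i => by
    obtain ⟨p, hp, hpf⟩ := hf (fun x : E₃.Gp => x.1 i) (AffAlgGroup.coord_mem i)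
    obtain ⟨P, hP⟩ := AffAlgGroup.exists_polynomial_of_mem_prod hp
    exact ⟨P, fun z => (hpf z).trans (hP z.1)⟩
  choose P hP using hf'
  let w : ∀ (x : E₁.Gp) (y : E₂.Gp), e₁.q x = e₂.q y → e₁.fibre ⊤ e₂.q :=
    fun x y h => ⟨(x, y), trivial, h⟩
  refine ⟨P, fun x y h => f (w x y h), fun x y h => ?_, fun x x' y y' h h' _ => ?_,
    fun x y h => ?_, fun a b h => ?_⟩
  · exact funext fun i => (hP i (w x y h)).symm
  · exact f.map_mul (w x y h) (w x' y' h')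
  · exact hqf (w x y h)
  · exact hτf (w _ _ h) a b rfl

namespace CoveringData

variable {G : AffAlgGroup} {LD : LeviDecomposition G} {CD : CoveringData G LD} {A : AffAlgGroup}
  {ρ : AlgAction G A} {hρ : ρ.IsTrivial} {k : ℕ} {τ : (Fin k → ℂˣ) ≃* A.Gp} {hτ : IsReg τ}

lemma isPushoutOf_iff {γ : CD.PiG →* A.Gp} {e : AlgExtension G A ρ} :
    CD.IsPushoutOf γ e ↔
      (e.torusExt hρ hτ).IsPushout CD.splitCover (τ.symm.toMonoidHom.comp γ) := by
  have key : ∀ x : CD.PiG, (e.torusExt hρ hτ).τ (τ.symm (γ x)) = e.i.toGpHom (γ x) := fun x =>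
    congrArg e.i.toGpHom (τ.apply_symm_apply (γ x))
  constructor
  · rintro ⟨h, hq, hker⟩
    exact ⟨h.toGpHom, h.isReg, fun x => Subtype.ext (hq x.1 x.2),
      fun x => (Subtype.ext (hker x) : h.toGpHom x.1 = e.i.toGpHom (γ x)).trans (key x).symm⟩
  · rintro ⟨h, hh, hq, hker⟩
    obtain ⟨h, rfl⟩ := AlgGroupHom.exists_of_isReg h hh
    exact ⟨h, fun x hx => congrArg Subtype.val (hq ⟨x, hx⟩),
      fun x => congrArg Subtype.val ((hker x).trans (key x))⟩

lemma equiv_of_isPushout {γ : CD.splitCover.p.ker →* (Fin k → ℂˣ)} {e₁ e₂ : AlgExtension G A ρ}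
    (h₁ : (e₁.torusExt hρ hτ).IsPushout CD.splitCover γ)
    (h₂ : (e₂.torusExt hρ hτ).IsPushout CD.splitCover γ) : e₁.Equiv e₂ := by
  have := CD.isDomain_unipotent
  have := CD.isDomain_central
  have := CD.Gs_connected.isDomain
  obtain ⟨f, hf, hτf, hqf⟩ := h₁.exists_hom h₂
  obtain ⟨f, rfl⟩ := AlgGroupHom.exists_of_isReg f hf
  refine ⟨f, fun a ha => ?_, fun x hx => congrArg Subtype.val (hqf ⟨x, hx⟩)⟩
  obtain ⟨a, rfl⟩ := AffAlgGroup.exists_val_eq ha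
  obtain ⟨a, rfl⟩ := τ.surjective a
  exact congrArg Subtype.val (hτf a)

lemma isBaerSum_of_isPushout {γ₁ γ₂ : CD.splitCover.p.ker →* (Fin k → ℂˣ)}
    {e₁ e₂ e₃ : AlgExtension G A ρ} (h₁ : (e₁.torusExt hρ hτ).IsPushout CD.splitCover γ₁)
    (h₂ : (e₂.torusExt hρ hτ).IsPushout CD.splitCover γ₂)
    (h₃ : (e₃.torusExt hρ hτ).IsPushout CD.splitCover (γ₁ * γ₂)) : e₁.IsBaerSum e₂ e₃ := by
  have := CD.isDomain_unipotent
  have := CD.isDomain_central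
  have := CD.Gs_connected.isDomain
  obtain ⟨P, m, hP, hm, hq, hm'⟩ := h₁.exists_polynomial h₂ h₃
  have hext : ∀ {x : e₁.E.Gp} {y : e₂.E.Gp}, e₁.q.toFun x.1 = e₂.q.toFun y.1 →
      (e₁.torusExt hρ hτ).q x = (e₂.torusExt hρ hτ).q y := fun h => Subtype.ext h
  refine ⟨fun z i => eval z (P i), ⟨P, fun _ _ _ => rfl⟩, ?_, ?_, ?_, ?_⟩
  · intro x hx y hy h
    obtain ⟨x, rfl⟩ := AffAlgGroup.exists_val_eq hx
    obtain ⟨y, rfl⟩ := AffAlgGroup.exists_val_eq hy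
    exact (congrArg (· ∈ e₃.E.carrier) (hP x y (hext h))).mpr (m x y (hext h)).2
  · intro x x' y y' hx hx' hy hy' h h'
    obtain ⟨x, rfl⟩ := AffAlgGroup.exists_val_eq hx
    obtain ⟨y, rfl⟩ := AffAlgGroup.exists_val_eq hy
    obtain ⟨x', rfl⟩ := AffAlgGroup.exists_val_eq hx'
    obtain ⟨y', rfl⟩ := AffAlgGroup.exists_val_eq hy'
    have h3 : (e₁.torusExt hρ hτ).q (x * x') = (e₂.torusExt hρ hτ).q (y * y') := by
      rw [map_mul, map_mul, hext h, hext h']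
    refine (hP (x * x') (y * y') h3).trans ?_
    exact (congrArg Subtype.val (hm x x' y y' (hext h) (hext h') h3)).trans
      (congrArg₂ e₃.E.mul (hP x y (hext h)) (hP x' y' (hext h'))).symm
  · intro x hx y hy h
    obtain ⟨x, rfl⟩ := AffAlgGroup.exists_val_eq hx
    obtain ⟨y, rfl⟩ := AffAlgGroup.exists_val_eq hy
    exact (congrArg e₃.q.toFun (hP x y (hext h))).trans (congrArg Subtype.val (hq x y (hext h)))
  · intro a ha b hb
    obtain ⟨a, rfl⟩ := AffAlgGroup.exists_val_eq ha
    obtain ⟨b, rfl⟩ := AffAlgGroup.exists_val_eq hb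
    obtain ⟨a, rfl⟩ := τ.surjective a
    obtain ⟨b, rfl⟩ := τ.surjective b
    have h : (e₁.torusExt hρ hτ).q ((e₁.torusExt hρ hτ).τ a) =
        (e₂.torusExt hρ hτ).q ((e₂.torusExt hρ hτ).τ b) := by rw [TorusExt.q_τ, TorusExt.q_τ]
    refine (hP _ _ h).trans ((congrArg Subtype.val (hm' a b h)).trans ?_)
    exact congrArg (fun t : A.Gp => e₃.i.toFun t.1) (map_mul τ a b)

lemma eq_one_of_splits {γ : CD.splitCover.p.ker →* (Fin k → ℂˣ)} {e : AlgExtension G A ρ}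
    (h : (e.torusExt hρ hτ).IsPushout CD.splitCover γ) (hs : e.Splits) (x : CD.pi1Gs) :
    γ ⟨x, x.2.2⟩ = 1 := by
  have := CD.isDomain_unipotent
  have := CD.isDomain_central
  have := CD.Gs_connected.isDomain
  obtain ⟨h, hh, hq, hker⟩ := h
  obtain ⟨σ, hσ⟩ := hs
  have h1 := CD.splitCover.eq_one_of_split (e.torusExt hρ hτ) CD.mem_of_commutator hh hq
    σ.isReg (fun g => Subtype.ext (hσ g.1 g.2)) ⟨x.1.1, x.2.1⟩ x.2.2
  exact (e.torusExt hρ hτ).τ_inj (((hker ⟨x, x.2.2⟩).symm.trans h1).trans (map_one _).symm)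

lemma isPushout_of_eqOn {γ₁ γ₂ : CD.splitCover.p.ker →* (Fin k → ℂˣ)} {e : AlgExtension G A ρ}
    (h : (e.torusExt hρ hτ).IsPushout CD.splitCover γ₁)
    (hγ : ∀ x : CD.pi1Gs, γ₁ ⟨x, x.2.2⟩ = γ₂ ⟨x, x.2.2⟩) :
    (e.torusExt hρ hτ).IsPushout CD.splitCover γ₂ := by
  have := CD.isDomain_unipotent
  have := CD.isDomain_central
  have := CD.Gs_connected.isDomain
  refine h.of_eqOn ?_
  rintro ⟨x, hx⟩ ⟨s, rfl⟩
  exact hγ ⟨CD.Gs.incl s, s.2, hx⟩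

variable (hρ hτ)

lemma exists_isPushout (CD : CoveringData G LD) (hτ' : IsReg τ.symm)
    (γ : CD.splitCover.p.ker →* (Fin k → ℂˣ)) :
    ∃ e : AlgExtension G A ρ, (e.torusExt hρ hτ).IsPushout CD.splitCover γ := by
  obtain ⟨E, _, _, t, h, hh, hq, hker⟩ := TorusExt.exists_isPushout CD.splitCover γ
  obtain ⟨e, φ, hφ, hφτ, hφq⟩ := AlgExtension.exists_of_torusExt hρ hτ hτ' t
  exact ⟨e, φ.comp h, hφ.comp hh, fun x => (hφq _).trans (hq x),
    fun x => (congrArg φ (hker x)).trans (hφτ _)⟩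

lemma exists_isPushout_eq (CD : CoveringData G LD) (e : AlgExtension G A ρ) :
    ∃ γ, (e.torusExt hρ hτ).IsPushout CD.splitCover γ := by
  have := CD.isDomain_unipotent
  have := CD.isDomain_central
  have := CD.Gs_connected.isDomain
  obtain ⟨h, hh, hq⟩ := CD.splitCover.exists_lift (e.torusExt hρ hτ) CD.homotopic_refl_unipotent
    CD.homotopic_refl_semisimple
  exact (e.torusExt hρ hτ).exists_isPushout_of_lift hh hq

end CoveringData

/-- For a connected algebraic group `G` and a torus `A_s`
with trivial `G`-action, the pushout map `Φ : Hom(Π_G, A_s) → Ext_alg(G, A_s)`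
factors through an isomorphism of abelian groups
`Φ' : Hom(π₁(G'_red), A_s) ≅ Ext_alg(G, A_s)`. -/
theorem ext_group_iso_hom_of_pi1
    (G : AffAlgGroup) (hG : G.IsConnected) (LD : LeviDecomposition G)
    (CD : CoveringData G LD)
    (As : AffAlgGroup) (hAs : As.IsTorus)
    (ρ : AlgAction G As) (hρ : ρ.IsTrivial)
    (Ext : Type) [AddCommGroup Ext] (cm : ExtClassMap G As ρ Ext) :
    ∃ Φ' : (↥CD.pi1Gs →* As.Gp) → Ext,
      Function.Bijective Φ' ∧
      (∀ f g h : ↥CD.pi1Gs →* As.Gp, (∀ x, h x = f x * g x) → Φ' h = Φ' f + Φ' g) ∧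
      (∀ (γ : ↥CD.PiG →* As.Gp) (e : AlgExtension G As ρ), CD.IsPushoutOf γ e →
        Φ' (γ.comp (Subgroup.inclusion CD.pi1Gs_le_PiG)) = cm.cls e) := by
  obtain ⟨k, τ, hτ, hτ'⟩ := hAs.exists_mulEquiv
  choose γ hγ using fun f : CD.pi1Gs →* As.Gp => CD.splitCover.exists_extension_ker CD.pi1Gs
    CD.pi1Gs_le_PiG (τ.symm.toMonoidHom.comp f)
  have hγ' : ∀ f (x : CD.pi1Gs), γ f ⟨x, x.2.2⟩ = τ.symm (f x) :=
    fun f x => DFunLike.congr_fun (hγ f) x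
  choose ext hext using fun γ => CD.exists_isPushout hρ hτ hτ' γ
  have hcls : ∀ {δ} {e : AlgExtension G As ρ} (f : CD.pi1Gs →* As.Gp),
      (e.torusExt hρ hτ).IsPushout CD.splitCover δ →
      (∀ x : CD.pi1Gs, δ ⟨x, x.2.2⟩ = τ.symm (f x)) → cm.cls (ext (γ f)) = cm.cls e :=
    fun f he hδ => (cm.cls_eq_iff _ _).mpr (.rel _ _ (CoveringData.equiv_of_isPushout (hext (γ f))
      (CoveringData.isPushout_of_eqOn he fun x => (hδ x).trans (hγ' f x).symm)))
  have hadd : ∀ f g h : CD.pi1Gs →* As.Gp, (∀ x, h x = f x * g x) →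
      cm.cls (ext (γ h)) = cm.cls (ext (γ f)) + cm.cls (ext (γ g)) := fun f g h hfg =>
    (hcls h (hext (γ f * γ g)) fun x => by
      rw [MonoidHom.mul_apply, hγ', hγ', hfg, map_mul]).trans
      (cm.cls_baer _ _ _ (CoveringData.isBaerSum_of_isPushout (hext _) (hext _) (hext _))).symm
  refine ⟨fun f => cm.cls (ext (γ f)), ⟨fun f g hfg => ?_, fun c => ?_⟩, hadd, fun δ e he => ?_⟩
  · let d : CD.pi1Gs →* As.Gp := τ.toMonoidHom.comp
      ((τ.symm.toMonoidHom.comp f) * (τ.symm.toMonoidHom.comp g)⁻¹)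
    have hd : ∀ x, d x = f x * (g x)⁻¹ := fun x => by
      change τ (τ.symm (f x) * (τ.symm (g x))⁻¹) = _
      rw [map_mul, map_inv, τ.apply_symm_apply, τ.apply_symm_apply]
    have h0 : cm.cls (ext (γ d)) = 0 := by
      have h1 := hadd d g f fun x => by rw [hd, inv_mul_cancel_right]
      exact left_eq_add.mp ((hfg.symm.trans h1).trans (add_comm _ _))
    refine MonoidHom.ext fun x => ?_
    have h2 := CoveringData.eq_one_of_splits (hext (γ d)) ((cm.cls_eq_zero_iff _).mp h0) x
    rw [hγ', map_eq_one_iff _ τ.symm.injective, hd] at h2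
    exact mul_inv_eq_one.mp h2
  · obtain ⟨e, rfl⟩ := cm.surj c
    obtain ⟨δ, hδ⟩ := CD.exists_isPushout_eq hρ hτ e
    refine ⟨τ.toMonoidHom.comp (δ.comp (Subgroup.inclusion CD.pi1Gs_le_PiG)),
      hcls _ hδ fun x => (τ.symm_apply_apply _).symm⟩
  · exact hcls _ (CoveringData.isPushoutOf_iff.mp he) fun x => rfl
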